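/- Let d, m ≥ 1, r⃗ ∈ (0,∞)^m, q ∈ (0,∞), s ∈ (q,∞], and set ρ := (1/q − 1/s)^{-1}. Let (Ω,μ) be a σ-finite measure space and t⃗ ∈ (0,∞]^m with t_j > r_j for all j and q ≤ t < s, t < ∞, where 1/t := ∑_{j=1}^m 1/t_j. Let T be an m-linear operator defined on m-tuples of functions in L^∞_c(ℝ^d), with values in measurable functions on ℝ^d, such that ‖T(f⃗)·g‖_{L^q(ℝ^d)} ≤ C_T ‖M_{(r_1,…,r_m,ρ)}(f_1,…,f_m,g)‖_{L^q(ℝ^d)} for all f_j, g ∈ L^∞_c(ℝ^d) and some fixed C_T ≥ 0. Then for all p⃗ ∈ (0,∞]^m with r_j < p_j for all j and p < s (1/p := ∑_{j=1}^m 1/p_j) and all w⃗ ∈ A_{p⃗,(r⃗,s)} with w := ∏_j w_j, there is a constant C depending only on d, m, p⃗, q, r⃗, s, t⃗ such that for all simple, bounded, boundedly supported f_j : ℝ^d × Ω → ℂ: ‖ ‖T̃(f⃗)(x,·)‖_{L^t(Ω)} ‖_{L^p_w(ℝ^d,dx)} ≤ C · C_T · [w⃗]_{p⃗,(r⃗,s)}^{max{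 max_{1≤j≤m} (1/r_j)/(1/r_j − 1/p_j), (1/q − 1/s)/(1/p − 1/s) }} · ∏_{j=1}^m ‖ ‖f_j(x,·)‖_{L^{t_j}(Ω)} ‖_{L^{p_j}_{w_j}(ℝ^d,dx)}, where T̃(f⃗)(x,ω) := T(f_1(·,ω),…,f_m(·,ω))(x) is the tensor extension, well defined for simple f⃗. -/

import Mathlib

open MeasureTheory ENNReal

noncomputable section

structure Cube (d : ℕ) where
  corner : Fin d → ℝ
  side : ℝ
  side_pos : 0 < side

namespace Cube
def set {d : ℕ} (Q : Cube d) : Set (Fin d → ℝ) :=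
  {x | ∀ i, Q.corner i ≤ x i ∧ x i < Q.corner i + Q.side}
def vol {d : ℕ} (Q : Cube d) : ℝ≥0∞ := volume Q.set
def IsDyadic {d : ℕ} (Q : Cube d) : Prop :=
  ∃ (k : ℤ) (n : Fin d → ℤ), Q.side = (2:ℝ) ^ (-k) ∧ ∀ i, Q.corner i = (2:ℝ) ^ (-k) * (n i : ℝ)
end Cube

def IsSparse {d : ℕ} (S : Set (Cube d)) : Prop :=
  ∃ E : Cube d → Set (Fin d → ℝ),
    (∀ Q ∈ S, MeasurableSet (E Q) ∧ E Q ⊆ Q.set ∧ Q.vol ≤ 2 * volume (E Q)) ∧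
    S.PairwiseDisjoint E

def eNorm {α : Type*} [MeasurableSpace α] (p : ℝ≥0∞) (μ : Measure α) (F : α → ℝ≥0∞) : ℝ≥0∞ :=
  if p = ∞ then essSup F μ else (∫⁻ x, F x ^ p.toReal ∂μ) ^ (1 / p.toReal)

def nn {α : Type*} (f : α → ℂ) : α → ℝ≥0∞ := fun x => (‖f x‖₊ : ℝ≥0∞)

def avg {d : ℕ} (r : ℝ≥0∞) (F : (Fin d → ℝ) → ℝ≥0∞) (Q : Cube d) : ℝ≥0∞ :=
  if r = ∞ then essSup F (volume.restrict Q.set)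
  else ((∫⁻ x in Q.set, F x ^ r.toReal) / Q.vol) ^ (1 / r.toReal)

def maximal {d k : ℕ} (r : Fin k → ℝ≥0∞) (F : Fin k → (Fin d → ℝ) → ℝ≥0∞)
    (x : Fin d → ℝ) : ℝ≥0∞ :=
  ⨆ (Q : Cube d) (_ : x ∈ Q.set), ∏ j, avg (r j) (F j) Q

def maximalX {d k : ℕ} (r : Fin k → ℝ≥0∞) (ρ : ℝ≥0∞) (F : Fin k → (Fin d → ℝ) → ℝ≥0∞)
    (G : (Fin d → ℝ) → ℝ≥0∞) (x : Fin d → ℝ) : ℝ≥0∞ :=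
  ⨆ (Q : Cube d) (_ : x ∈ Q.set), (∏ j, avg (r j) (F j) Q) * avg ρ G Q

def wNorm {d : ℕ} (p : ℝ≥0∞) (w : (Fin d → ℝ) → ℝ) (F : (Fin d → ℝ) → ℝ≥0∞) : ℝ≥0∞ :=
  eNorm p volume (fun x => F x * ENNReal.ofReal (w x))

def aConst {d m : ℕ} (p r : Fin m → ℝ≥0∞) (s : ℝ≥0∞)
    (w : Fin m → (Fin d → ℝ) → ℝ) : ℝ≥0∞ :=
  ⨆ Q : Cube d,
    (∏ j, avg ((r j)⁻¹ - (p j)⁻¹)⁻¹ (fun x => ENNReal.ofReal (w j x)⁻¹) Q) *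
      avg ((∑ j, (p j)⁻¹) - s⁻¹)⁻¹ (fun x => ENNReal.ofReal (∏ j, w j x)) Q

def latAvg {d : ℕ} {Ω : Type*} (r : ℝ≥0∞) (f : (Fin d → ℝ) → Ω → ℂ) (Q : Cube d) (ω : Ω) : ℝ≥0∞ :=
  ((∫⁻ y in Q.set, (‖f y ω‖₊ : ℝ≥0∞) ^ r.toReal) / Q.vol) ^ (1 / r.toReal)

def latMax {d m : ℕ} {Ω : Type*} (r : Fin m → ℝ≥0∞) (D : Finset (Cube d))
    (f : Fin m → (Fin d → ℝ) → Ω → ℂ) (x : Fin d → ℝ) (ω : Ω) : ℝ≥0∞ :=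
  ⨆ Q ∈ D, ⨆ (_ : x ∈ Cube.set Q), ∏ j, latAvg (r j) (f j) Q ω

def latMaxX {d m : ℕ} {Ω : Type*} (r : Fin m → ℝ≥0∞) (ρ : ℝ≥0∞) (D : Finset (Cube d))
    (f : Fin m → (Fin d → ℝ) → Ω → ℂ) (g : (Fin d → ℝ) → Ω → ℂ)
    (x : Fin d → ℝ) (ω : Ω) : ℝ≥0∞ :=
  ⨆ Q ∈ D, ⨆ (_ : x ∈ Cube.set Q), (∏ j, latAvg (r j) (f j) Q ω) * latAvg ρ g Q ω

def MemLinftyC {d : ℕ} (f : (Fin d → ℝ) → ℂ) : Prop :=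
  Measurable f ∧ (∃ M : ℝ, ∀ x, ‖f x‖ ≤ M) ∧ Bornology.IsBounded (Function.support f)

def SimpleLinftyC {d : ℕ} (f : (Fin d → ℝ) → ℂ) : Prop :=
  Measurable f ∧ (Set.range f).Finite ∧ Bornology.IsBounded (Function.support f)

def PairSimple {d : ℕ} {Ω : Type*} [MeasurableSpace Ω] (f : (Fin d → ℝ) → Ω → ℂ) : Prop :=
  Measurable (Function.uncurry f) ∧ (Set.range (Function.uncurry f)).Finite ∧
    ∃ B : Set (Fin d → ℝ), Bornology.IsBounded B ∧ ∀ x ∉ B, ∀ ω, f x ω = 0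

def VecSimple {d : ℕ} {Ω : Type*} [MeasurableSpace Ω] (f : (Fin d → ℝ) → Ω → ℂ) : Prop :=
  ∃ (N : ℕ) (A : Fin N → Set (Fin d → ℝ)) (ξ : Fin N → Ω → ℂ),
    (∀ i, MeasurableSet (A i)) ∧ (∀ i, Bornology.IsBounded (A i)) ∧
    (∀ i, Measurable (ξ i)) ∧ (∃ M : ℝ, ∀ i ω, ‖ξ i ω‖ ≤ M) ∧
    ∀ x ω, f x ω = ∑ i, (A i).indicator (fun _ => ξ i ω) x

set_option linter.unusedSectionVars false

/-- A (two-sided) filtration by countable partitions. -/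
structure Fil (X ι : Type) [MeasurableSpace X] [MeasurableSpace ι] where
  e : ℤ → X → ι
  meas : ∀ n, Measurable (e n)
  mono : ∀ n x y, e (n + 1) x = e (n + 1) y → e n x = e n y

namespace Fil
variable {X ι : Type} [MeasurableSpace X] [MeasurableSpace ι]

def cell (E : Fil X ι) (n : ℤ) (x : X) : Set X := {y | E.e n y = E.e n x}

def av (E : Fil X ι) (ν : Measure X) (n : ℤ) (f : X → ℝ≥0∞) (x : X) : ℝ≥0∞ :=
  (∫⁻ y in E.cell n x, f y ∂ν) / ν (E.cell n x)

def mx (E : Fil X ι) (ν : Measure X) (f : X → ℝ≥0∞) (x : X) : ℝ≥0∞ :=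
  ⨆ n : ℤ, E.av ν n f x

def Sat (E : Fil X ι) (n : ℤ) (A : Set X) : Prop := ∀ x ∈ A, E.cell n x ⊆ A

variable (E : Fil X ι)

lemma mono' {m n : ℤ} (h : m ≤ n) {x y : X} (hxy : E.e n x = E.e n y) : E.e m x = E.e m y := by
  obtain ⟨k, rfl⟩ := Int.le.dest h
  induction k with
  | zero => simpa using hxy
  | succ k ih =>
    apply ih (by omega)
    apply E.mono
    rw [add_assoc]; exact_mod_cast hxy

lemma mem_cell (n : ℤ) (x : X) : x ∈ E.cell n x := rfl

lemma cell_eq {n : ℤ} {x y : X} (h : y ∈ E.cell n x) : E.cell n y = E.cell n x := by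
  have h' : E.e n y = E.e n x := h
  simp [cell, h']

lemma cell_subset {m n : ℤ} (h : m ≤ n) (x : X) : E.cell n x ⊆ E.cell m x :=
  fun _ hy => E.mono' h hy

lemma sat_cell {m n : ℤ} (h : m ≤ n) (x : X) : E.Sat n (E.cell m x) := by
  intro y hy
  rw [← E.cell_eq hy]
  exact E.cell_subset h y

lemma av_eq (ν : Measure X) {n : ℤ} (f : X → ℝ≥0∞) {x y : X} (h : y ∈ E.cell n x) :
    E.av ν n f y = E.av ν n f x := by
  simp only [av, E.cell_eq h]

lemma av_mono (ν : Measure X) (n : ℤ) {f g : X → ℝ≥0∞} (h : ∀ x, f x ≤ g x) (x : X) :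
    E.av ν n f x ≤ E.av ν n g x := by
  unfold av; gcongr; exact h _

variable [Countable ι] [MeasurableSingletonClass ι]

lemma meas_cell (n : ℤ) (x : X) : MeasurableSet (E.cell n x) :=
  E.meas n (measurableSet_singleton (E.e n x))

lemma Sat.eq_biUnion {E : Fil X ι} {n : ℤ} {A : Set X} (h : E.Sat n A) :
    A = ⋃ i ∈ E.e n '' A, E.e n ⁻¹' {i} := by
  ext x
  simp only [Set.mem_image, Set.mem_iUnion, Set.mem_preimage, Set.mem_singleton_iff, exists_prop]
  constructor
  · intro hx; exact ⟨_, ⟨x, hx, rfl⟩, rfl⟩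
  · rintro ⟨i, ⟨y, hy, rfl⟩, hx⟩
    exact h y hy hx

lemma Sat.meas {E : Fil X ι} {n : ℤ} {A : Set X} (h : E.Sat n A) : MeasurableSet A := by
  rw [h.eq_biUnion]
  exact MeasurableSet.biUnion (Set.to_countable _)
    fun i _ => E.meas n (measurableSet_singleton i)

lemma Sat.lintegral {E : Fil X ι} {n : ℤ} {A : Set X} (h : E.Sat n A) (ν : Measure X)
    (F : X → ℝ≥0∞) :
    ∫⁻ x in A, F x ∂ν = ∑' i : ↥(E.e n '' A), ∫⁻ x in E.e n ⁻¹' {i.1}, F x ∂ν := by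
  conv_lhs => rw [h.eq_biUnion]
  apply lintegral_biUnion (Set.to_countable _)
    (fun i _ => E.meas n (measurableSet_singleton i))
  intro i _ j _ hij
  apply Set.disjoint_left.2
  intro x hx hx'
  apply hij
  simp at hx hx'
  rw [← hx, hx']

lemma Sat.lintegral_le {E : Fil X ι} {n : ℤ} {A : Set X} (h : E.Sat n A) (ν ν' : Measure X)
    (F G : X → ℝ≥0∞)
    (hFG : ∀ x ∈ A, ∫⁻ y in E.cell n x, F y ∂ν ≤ ∫⁻ y in E.cell n x, G y ∂ν') :
    ∫⁻ x in A, F x ∂ν ≤ ∫⁻ x in A, G x ∂ν' := by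
  rw [h.lintegral, h.lintegral]
  apply ENNReal.tsum_le_tsum
  rintro ⟨i, x, hx, rfl⟩
  exact hFG x hx

lemma lintegral_cell_av (ν : Measure X) (n : ℤ) (f : X → ℝ≥0∞) (x : X)
    (hν : ν (E.cell n x) ≠ ∞) :
    ∫⁻ y in E.cell n x, E.av ν n f y ∂ν = ∫⁻ y in E.cell n x, f y ∂ν := by
  rw [setLIntegral_congr_fun (E.meas_cell n x) (g := fun _ => E.av ν n f x)
    (fun y hy => E.av_eq ν f hy)]
  rw [setLIntegral_const]
  unfold av
  by_cases h0 : ν (E.cell n x) = 0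
  · simp [h0, Measure.restrict_eq_zero.2 h0]
  · rw [ENNReal.div_mul_cancel h0 hν]

lemma Sat.lintegral_av {E : Fil X ι} {n : ℤ} {A : Set X} (h : E.Sat n A) (ν : Measure X)
    (hν : ∀ n x, ν (E.cell n x) ≠ ∞) (f : X → ℝ≥0∞) :
    ∫⁻ x in A, E.av ν n f x ∂ν = ∫⁻ x in A, f x ∂ν := by
  apply le_antisymm
  · exact h.lintegral_le _ _ _ _ fun x _ => (E.lintegral_cell_av ν n f x (hν n x)).le
  · exact h.lintegral_le _ _ _ _ fun x _ => (E.lintegral_cell_av ν n f x (hν n x)).ge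

lemma measurable_av (ν : Measure X) (n : ℤ) (f : X → ℝ≥0∞) : Measurable (E.av ν n f) := by
  have : E.av ν n f =
      (fun i => (∫⁻ y in E.e n ⁻¹' {i}, f y ∂ν) / ν (E.e n ⁻¹' {i})) ∘ E.e n := by
    ext x; rfl
  rw [this]
  exact (measurable_of_countable _).comp (E.meas n)

lemma measurable_mx (ν : Measure X) (f : X → ℝ≥0∞) : Measurable (E.mx ν f) :=
  Measurable.iSup fun n => E.measurable_av ν n f

/-- weak type bound for levels `≥ a`. -/
lemma weak_aux (ν : Measure X) (hν : ∀ n x, ν (E.cell n x) ≠ ∞) (f : X → ℝ≥0∞)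
    (lam : ℝ≥0∞) (a : ℤ) :
    lam * ν {x | ∃ n, a ≤ n ∧ lam < E.av ν n f x} ≤ ∫⁻ x, f x ∂ν := by
  let A : ℤ → Set X := fun n =>
    {x | a ≤ n ∧ lam < E.av ν n f x ∧ ∀ m, a ≤ m → m < n → E.av ν m f x ≤ lam}
  have hsat : ∀ n, E.Sat n (A n) := by
    rintro n x ⟨h1, h2, h3⟩ y hy
    refine ⟨h1, by rwa [E.av_eq ν f hy], fun m hm hmn => ?_⟩
    rw [E.av_eq ν f (E.cell_subset hmn.le x hy)]
    exact h3 m hm hmn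
  have hdisj : Pairwise (Function.onFun Disjoint A) := by
    intro n m hnm
    apply Set.disjoint_left.2
    rintro x ⟨h1, h2, h3⟩ ⟨h1', h2', h3'⟩
    rcases lt_or_gt_of_ne hnm with h | h
    · exact absurd h2 (not_lt.2 (h3' n h1 h))
    · exact absurd h2' (not_lt.2 (h3 m h1' h))
  have hun : {x | ∃ n, a ≤ n ∧ lam < E.av ν n f x} = ⋃ n, A n := by
    ext x
    simp only [Set.mem_ofPred_eq, Set.mem_iUnion]
    constructor
    · rintro ⟨n, hn, hx⟩
      obtain ⟨k, rfl⟩ := Int.le.dest hn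
      classical
      have hex : ∃ k : ℕ, lam < E.av ν (a + k) f x := ⟨k, hx⟩
      refine ⟨a + (Nat.find hex : ℕ), by omega, Nat.find_spec hex, fun m hm hmn => ?_⟩
      obtain ⟨l, rfl⟩ := Int.le.dest hm
      exact not_lt.1 (Nat.find_min hex (m := l) (by omega))
    · rintro ⟨n, h1, h2, _⟩
      exact ⟨n, h1, h2⟩
  rw [hun, measure_iUnion hdisj fun n => (hsat n).meas, ← ENNReal.tsum_mul_left]
  calc ∑' n, lam * ν (A n) ≤ ∑' n, ∫⁻ x in A n, f x ∂ν := by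
        apply ENNReal.tsum_le_tsum
        intro n
        rw [← (hsat n).lintegral_av ν hν f, ← setLIntegral_const]
        exact setLIntegral_mono (E.measurable_av ν n f) fun x hx => hx.2.1.le
    _ = ∫⁻ x in ⋃ n, A n, f x ∂ν := (lintegral_iUnion (fun n => (hsat n).meas) hdisj f).symm
    _ ≤ ∫⁻ x, f x ∂ν := setLIntegral_le_lintegral _ _

lemma weak (ν : Measure X) (hν : ∀ n x, ν (E.cell n x) ≠ ∞) (f : X → ℝ≥0∞)
    (lam : ℝ≥0∞) : lam * ν {x | lam < E.mx ν f x} ≤ ∫⁻ x, f x ∂ν := by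
  have hun : {x | lam < E.mx ν f x} =
      ⋃ a : ℕ, {x | ∃ n, -(a : ℤ) ≤ n ∧ lam < E.av ν n f x} := by
    ext x
    simp only [mx, Set.mem_ofPred_eq, Set.mem_iUnion, lt_iSup_iff]
    constructor
    · rintro ⟨n, hn⟩
      exact ⟨n.natAbs, n, by omega, hn⟩
    · rintro ⟨a, n, _, hn⟩; exact ⟨n, hn⟩
  rw [hun, Monotone.measure_iUnion, ENNReal.mul_iSup]
  · exact iSup_le fun a => E.weak_aux ν hν f lam _
  · intro a b hab x
    rintro ⟨n, hn, hx⟩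
    exact ⟨n, by omega, hx⟩

lemma av_add_const_le (ν : Measure X) (n : ℤ) (f g : X → ℝ≥0∞) (hf : Measurable f) (c : ℝ≥0∞)
    (hfg : ∀ x, g x ≤ f x + c) (x : X) :
    E.av ν n g x ≤ E.av ν n f x + c := by
  unfold av
  calc (∫⁻ y in E.cell n x, g y ∂ν) / ν (E.cell n x)
      ≤ (∫⁻ y in E.cell n x, (f y + c) ∂ν) / ν (E.cell n x) := by gcongr; exact hfg _
    _ = ((∫⁻ y in E.cell n x, f y ∂ν) + c * ν (E.cell n x)) / ν (E.cell n x) := by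
        rw [lintegral_add_left hf, setLIntegral_const]
    _ ≤ _ := by
        rw [ENNReal.add_div]
        gcongr
        rw [mul_div_assoc]
        exact mul_le_of_le_one_right' ENNReal.div_self_le_one

lemma weak2 (ν : Measure X) (hν : ∀ n x, ν (E.cell n x) ≠ ∞) (f : X → ℝ≥0∞)
    (hf : Measurable f) (lam : ℝ≥0∞) (hl : lam ≠ ∞) :
    lam * ν {x | 2 * lam < E.mx ν f x} ≤ ∫⁻ x in {x | lam < f x}, f x ∂ν := by
  have hm : MeasurableSet {x | lam < f x} := measurableSet_lt measurable_const hf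
  rw [← lintegral_indicator hm]
  refine le_trans ?_ (E.weak ν hν _ lam)
  refine mul_le_mul' le_rfl (measure_mono fun x hx => ?_)
  simp only [mx, lt_iSup_iff, Set.mem_ofPred_eq] at hx ⊢
  obtain ⟨n, hn⟩ := hx
  refine ⟨n, ?_⟩
  by_contra hcon
  have := E.av_add_const_le ν n ({x | lam < f x}.indicator f) f (hf.indicator hm) lam (by
    intro x
    by_cases h : lam < f x
    · rw [Set.indicator_of_mem (by exact h)]; exact le_self_add
    · rw [Set.indicator_of_notMem (by exact h)]; simpa using h) x
  have h2 : E.av ν n f x ≤ 2 * lam := by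
    rw [two_mul]
    exact this.trans (by gcongr; exact not_lt.1 hcon)
  exact absurd hn (not_lt.2 h2)

def doobC (p : ℝ) : ℝ≥0∞ := ENNReal.ofReal p * (2 * (ENNReal.ofReal (p - 1))⁻¹ * 2 ^ (p - 1))

lemma doobC_ne_top {p : ℝ} (hp : 1 < p) : doobC p ≠ ∞ := by
  unfold doobC
  have h : (ENNReal.ofReal (p - 1))⁻¹ ≠ ∞ := by
    simp; linarith
  have h2 : (2 : ℝ≥0∞) ^ (p - 1) ≠ ∞ := ENNReal.rpow_ne_top_of_nonneg (by linarith) (by simp)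
  exact ENNReal.mul_ne_top (by simp) (ENNReal.mul_ne_top (ENNReal.mul_ne_top (by simp) h) h2)

lemma doob (ν : Measure X) (hν : ∀ n x, ν (E.cell n x) ≠ ∞) (f : X → ℝ≥0∞)
    (hf : Measurable f) {p : ℝ} (hp : 1 < p) :
    ∫⁻ x, (E.mx ν f x) ^ p ∂ν ≤ doobC p * ∫⁻ x, f x ^ p ∂ν := by
  by_cases htop : ∫⁻ x, f x ^ p ∂ν = ∞
  · rw [htop, ENNReal.mul_top]
    · simp
    · unfold doobC
      have : (0:ℝ) < p := by linarith
      simp [this, ENNReal.rpow_eq_zero_iff]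
  have hfin : ∀ᵐ x ∂ν, f x < ∞ := by
    filter_upwards [ae_lt_top (hf.pow_const p) htop] with x hx
    by_contra h
    have : f x = ∞ := by simpa using h
    rw [this, ENNReal.top_rpow_of_pos (by linarith)] at hx
    exact absurd hx (by simp)
  let M := E.mx ν f
  have hM : Measurable M := E.measurable_mx ν f
  let ν' := ν.withDensity f
  have hfin' : ∀ᵐ x ∂ν', f x < ∞ := (withDensity_absolutelyContinuous ν f).ae_le hfin
  -- key bound for truncations
  have key : ∀ k : ℕ, ∫⁻ x, (min (M x) k) ^ p ∂ν ≤ doobC p * ∫⁻ x, f x ^ p ∂ν := by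
    intro k
    have h1 : ∀ x, (min (M x) k) ^ p = ENNReal.ofReal ((min (M x) k).toReal ^ p) := by
      intro x
      have hne : min (M x) (k : ℝ≥0∞) ≠ ∞ := ne_top_of_le_ne_top (ENNReal.natCast_ne_top k) (min_le_right _ _)
      rw [← ENNReal.ofReal_rpow_of_nonneg ENNReal.toReal_nonneg (by linarith),
        ENNReal.ofReal_toReal hne]
    simp_rw [h1]
    rw [lintegral_rpow_eq_lintegral_meas_lt_mul ν (ae_of_all _ fun x => ENNReal.toReal_nonneg)
      ((hM.min measurable_const).ennreal_toReal.aemeasurable) (by linarith)]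
    unfold doobC
    rw [mul_assoc]
    gcongr ENNReal.ofReal p * ?_
    have h2 : ∫⁻ x, ENNReal.ofReal ((2 * (f x).toReal) ^ (p - 1)) ∂ν' =
        2 ^ (p - 1) * ∫⁻ x, f x ^ p ∂ν := by
      have : ∫⁻ x, ENNReal.ofReal ((2 * (f x).toReal) ^ (p - 1)) ∂ν' =
          ∫⁻ x, 2 ^ (p - 1) * f x ^ (p - 1) ∂ν' := by
        apply lintegral_congr_ae
        filter_upwards [hfin'] with x hx
        rw [← ENNReal.ofReal_rpow_of_nonneg (by positivity) (by linarith),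
          ENNReal.ofReal_mul (by norm_num), ENNReal.ofReal_toReal hx.ne,
          ENNReal.mul_rpow_of_nonneg _ _ (by linarith)]
        simp
      rw [this, lintegral_const_mul _ (hf.pow_const _),
        lintegral_withDensity_eq_lintegral_mul _ hf (hf.pow_const _)]
      congr 1
      apply lintegral_congr_ae
      filter_upwards [hfin] with x hx
      simp only [Pi.mul_apply]
      conv_lhs => enter [1]; rw [← ENNReal.rpow_one (f x)]
      rw [← ENNReal.rpow_add_of_nonneg _ _ (by norm_num) (by linarith)]
      congr 1; ring
    have h3 := lintegral_rpow_eq_lintegral_meas_lt_mul ν' (f := fun x => 2 * (f x).toReal)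
      (ae_of_all _ fun x => by positivity)
      ((hf.ennreal_toReal.const_mul 2).aemeasurable) (p := p - 1) (by linarith)
    rw [h2] at h3
    have hp1 : ENNReal.ofReal (p - 1) ≠ 0 := by simp; linarith
    have h4 : ∫⁻ t in Set.Ioi (0:ℝ), ν' {a | t < 2 * (f a).toReal} *
        ENNReal.ofReal (t ^ (p - 1 - 1)) =
        (ENNReal.ofReal (p - 1))⁻¹ * (2 ^ (p - 1) * ∫⁻ x, f x ^ p ∂ν) := by
      rw [h3, ← mul_assoc, ENNReal.inv_mul_cancel hp1 (by simp), one_mul]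
    have h5 : 2 * (ENNReal.ofReal (p - 1))⁻¹ * 2 ^ (p - 1) * ∫⁻ x, f x ^ p ∂ν =
       2 * ∫⁻ t in Set.Ioi (0:ℝ), ν' {a | t < 2 * (f a).toReal} *
        ENNReal.ofReal (t ^ (p - 1 - 1)) := by
      rw [h4]; ring
    rw [h5, ← lintegral_const_mul' _ _ (by simp)]
    apply setLIntegral_mono' measurableSet_Ioi
    intro t ht
    have ht : 0 < t := ht
    have h6 : ENNReal.ofReal (t ^ (p - 1)) =
        ENNReal.ofReal (t / 2) * (2 * ENNReal.ofReal (t ^ (p - 1 - 1))) := by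
      have : (2 : ℝ≥0∞) = ENNReal.ofReal 2 := by simp
      rw [this, ← ENNReal.ofReal_mul (by norm_num), ← ENNReal.ofReal_mul (by positivity)]
      congr 1
      have : t ^ (p - 1) = t * t ^ (p - 1 - 1) := by
        rw [← Real.rpow_one_add' ht.le (by linarith)]; congr 1; ring
      rw [this]; ring
    rw [h6]
    have h7 : ENNReal.ofReal (t / 2) * ν {a | t < (min (M a) k).toReal} ≤
        ν' {a | t < 2 * (f a).toReal} := by
      calc ENNReal.ofReal (t / 2) * ν {a | t < (min (M a) k).toReal}
          ≤ ENNReal.ofReal (t / 2) * ν {a | 2 * ENNReal.ofReal (t / 2) < M a} := by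
            refine mul_le_mul' le_rfl (measure_mono fun x hx => ?_)
            simp only [Set.mem_ofPred_eq] at hx ⊢
            have : 2 * ENNReal.ofReal (t / 2) = ENNReal.ofReal t := by
              have : (2 : ℝ≥0∞) = ENNReal.ofReal 2 := by simp
              rw [this, ← ENNReal.ofReal_mul (by norm_num)]; congr 1; ring
            rw [this]
            have hne : min (M x) (k : ℝ≥0∞) ≠ ∞ := ne_top_of_le_ne_top (ENNReal.natCast_ne_top k) (min_le_right _ _)
            exact ((ENNReal.ofReal_lt_iff_lt_toReal ht.le hne).2 hx).trans_le (min_le_left _ _)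
        _ ≤ ∫⁻ x in {x | ENNReal.ofReal (t / 2) < f x}, f x ∂ν := E.weak2 ν hν f hf _ (by simp)
        _ = ν' {x | ENNReal.ofReal (t / 2) < f x} := by
            rw [withDensity_apply _ (measurableSet_lt measurable_const hf)]
        _ ≤ ν' {a | t < 2 * (f a).toReal} := by
            apply measure_mono_ae
            filter_upwards [hfin'] with x hx h
            have h' : ENNReal.ofReal (t / 2) < f x := h
            have := (ENNReal.ofReal_lt_iff_lt_toReal (by positivity) hx.ne).1 h'
            show t < 2 * (f x).toReal
            linarith
    calc ν {a | t < (min (M a) k).toReal} * (ENNReal.ofReal (t / 2) *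
          (2 * ENNReal.ofReal (t ^ (p - 1 - 1))))
        = (ENNReal.ofReal (t / 2) * ν {a | t < (min (M a) k).toReal}) *
          (2 * ENNReal.ofReal (t ^ (p - 1 - 1))) := by ring
      _ ≤ ν' {a | t < 2 * (f a).toReal} * (2 * ENNReal.ofReal (t ^ (p - 1 - 1))) := by gcongr
      _ = _ := by ring
  have hsup : ∀ x, (M x) ^ p = ⨆ k : ℕ, (min (M x) k) ^ p := by
    intro x
    have h1 : M x = ⨆ k : ℕ, min (M x) (k : ℝ≥0∞) := by
      rw [← inf_iSup_eq, ENNReal.iSup_natCast]; simp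
    conv_lhs => rw [h1]
    exact (ENNReal.orderIsoRpow p (by linarith)).map_iSup _
  calc ∫⁻ x, (M x) ^ p ∂ν = ⨆ k : ℕ, ∫⁻ x, (min (M x) k) ^ p ∂ν := by
        simp_rw [hsup]
        apply lintegral_iSup
        · intro k; exact (hM.min measurable_const).pow_const _
        · intro k l hkl x
          dsimp only
          gcongr
    _ ≤ _ := iSup_le key

end Fil

section eNormBasics
variable {α : Type*} [MeasurableSpace α]

lemma eNorm_top (μ : Measure α) (F : α → ℝ≥0∞) : eNorm ∞ μ F = essSup F μ := by simp [eNorm]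

lemma eNorm_of_ne_top {p : ℝ≥0∞} (hp : p ≠ ∞) (μ : Measure α) (F : α → ℝ≥0∞) :
    eNorm p μ F = (∫⁻ x, F x ^ p.toReal ∂μ) ^ (1 / p.toReal) := by simp [eNorm, hp]

lemma eNorm_mono_ae {p : ℝ≥0∞} {μ : Measure α} {F G : α → ℝ≥0∞} (h : ∀ᵐ x ∂μ, F x ≤ G x) :
    eNorm p μ F ≤ eNorm p μ G := by
  unfold eNorm
  split_ifs with hp
  · exact essSup_mono_ae h
  · apply ENNReal.rpow_le_rpow _ (by positivity)
    apply lintegral_mono_ae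
    filter_upwards [h] with x hx
    exact ENNReal.rpow_le_rpow hx ENNReal.toReal_nonneg

lemma eNorm_mono {p : ℝ≥0∞} {μ : Measure α} {F G : α → ℝ≥0∞} (h : ∀ x, F x ≤ G x) :
    eNorm p μ F ≤ eNorm p μ G := eNorm_mono_ae (ae_of_all _ h)

lemma eNorm_rpow {p : ℝ≥0∞} (μ : Measure α) (F : α → ℝ≥0∞) {a : ℝ} (ha : 0 < a) :
    eNorm p μ (fun x => F x ^ a) = (eNorm (p * ENNReal.ofReal a) μ F) ^ a := by
  have ha' : ENNReal.ofReal a ≠ 0 := by simpa using ha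
  unfold eNorm
  by_cases hp : p = ∞
  · subst hp
    simp only [if_true, ENNReal.top_mul ha']
    exact ((ENNReal.orderIsoRpow a ha).essSup_apply F μ).symm
  · have : p * ENNReal.ofReal a ≠ ∞ := ENNReal.mul_ne_top hp (by simp)
    simp only [hp, this, if_false]
    rw [ENNReal.toReal_mul, ENNReal.toReal_ofReal ha.le, ← ENNReal.rpow_mul]
    congr 1
    · apply lintegral_congr
      intro x
      rw [← ENNReal.rpow_mul, mul_comm]
    · by_cases h : p.toReal = 0
      · simp [h]
      · field_simp

lemma eNorm_eq_zero {p : ℝ≥0∞} (hp : 0 < p) {μ : Measure α} {F : α → ℝ≥0∞} (hF : Measurable F)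
    (h : eNorm p μ F = 0) : ∀ᵐ x ∂μ, F x = 0 := by
  unfold eNorm at h
  split_ifs at h with hp'
  · filter_upwards [ENNReal.essSup_eq_zero_iff.1 h] with x hx using hx
  · have hpr : 0 < p.toReal := ENNReal.toReal_pos hp.ne' hp'
    rw [ENNReal.rpow_eq_zero_iff_of_pos (by positivity), lintegral_eq_zero_iff (hF.pow_const _)] at h
    filter_upwards [h] with x hx
    simpa [ENNReal.rpow_eq_zero_iff_of_pos hpr] using hx

lemma eNorm_const_mul (p : ℝ≥0∞) (hp : 0 < p) (μ : Measure α) (F : α → ℝ≥0∞) (hF : Measurable F)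
    (c : ℝ≥0∞) : eNorm p μ (fun x => c * F x) = c * eNorm p μ F := by
  unfold eNorm
  split_ifs with hp'
  · exact ENNReal.essSup_const_mul
  · have hpr : 0 < p.toReal := ENNReal.toReal_pos hp.ne' hp'
    simp_rw [ENNReal.mul_rpow_of_nonneg _ _ hpr.le]
    rw [lintegral_const_mul _ (hF.pow_const _), ENNReal.mul_rpow_of_nonneg _ _ (by positivity),
      ← ENNReal.rpow_mul]
    congr 1
    rw [mul_one_div_cancel hpr.ne', ENNReal.rpow_one]

lemma measurable_eNorm {β : Type*} [MeasurableSpace β] (p : ℝ≥0∞) (μ : Measure α) [SFinite μ]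
    (f : β → α → ℝ≥0∞) (hf : Measurable (Function.uncurry f)) :
    Measurable (fun x => eNorm p μ (f x)) := by
  unfold eNorm
  split_ifs with hp
  · apply measurable_of_Ioi
    intro c
    have : (fun x => essSup (f x) μ) ⁻¹' Set.Ioi c = {x | μ {y | c < f x y} ≠ 0} := by
      ext x
      simp only [Set.mem_preimage, Set.mem_Ioi, Set.mem_ofPred_eq]
      constructor
      · intro h h0
        apply absurd h (not_lt.2 _)
        refine essSup_le_of_ae_le _ ?_
        rw [Filter.EventuallyLE, ae_iff]
        simpa using h0
      · intro h
        by_contra hcon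
        apply h
        have h1 : ∀ᵐ y ∂μ, f x y ≤ essSup (f x) μ := ENNReal.ae_le_essSup (f x)
        rw [← nonpos_iff_eq_zero, ← ae_iff.1 h1]
        apply measure_mono
        intro y hy
        simp only [Set.mem_ofPred_eq, not_le] at hy ⊢
        exact lt_of_le_of_lt (not_lt.1 hcon) hy
    rw [this]
    have hm : Measurable (fun x => μ (Prod.mk x ⁻¹' {z : β × α | c < Function.uncurry f z})) :=
      measurable_measure_prodMk_left (measurableSet_lt measurable_const hf)
    exact hm (measurableSet_singleton (0:ℝ≥0∞)).compl
  · exact (Measurable.lintegral_prod_right' (f := fun z => Function.uncurry f z ^ p.toReal) (hf.pow_const _)).pow_const _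

lemma holder_eNorm {J : Type*} [Fintype J] (μ : Measure α) (P : J → ℝ≥0∞)
    (hP : ∑ j, (P j)⁻¹ = 1) (G : J → α → ℝ≥0∞) (hG : ∀ j, AEMeasurable (G j) μ) :
    ∫⁻ x, ∏ j, G j x ∂μ ≤ ∏ j, eNorm (P j) μ (G j) := by
  classical
  have hP0 : ∀ j, P j ≠ 0 := by
    intro j h0
    have : (P j)⁻¹ ≤ 1 := hP ▸ Finset.single_le_sum (f := fun j => (P j)⁻¹) (fun _ _ => zero_le) (Finset.mem_univ j)
    simp [h0] at this
  let f : J → α → ℝ≥0∞ := fun j x => if P j = ∞ then 1 else G j x ^ (P j).toReal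
  let c : J → ℝ≥0∞ := fun j => if P j = ∞ then essSup (G j) μ else 1
  have hf : ∀ j, AEMeasurable (f j) μ := by
    intro j
    by_cases h : P j = ∞
    · simp only [f, h, if_true]; exact aemeasurable_const
    · simp only [f, h, if_false]; exact (hG j).pow_const _
  have hle : ∀ᵐ x ∂μ, ∀ j, G j x ≤ c j * f j x ^ ((P j)⁻¹).toReal := by
    rw [ae_all_iff]
    intro j
    by_cases h : P j = ∞
    · simp only [f, c, h, if_true]
      filter_upwards [ENNReal.ae_le_essSup (G j)] with x hx
      simpa using hx
    · simp only [f, c, h, if_false]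
      refine ae_of_all _ fun x => ?_
      rw [one_mul, ← ENNReal.rpow_mul, ENNReal.toReal_inv, mul_inv_cancel₀, ENNReal.rpow_one]
      exact (ENNReal.toReal_pos (hP0 j) h).ne'
  have hsum : ∑ j, ((P j)⁻¹).toReal = 1 := by
    rw [← ENNReal.toReal_sum, hP]
    · simp
    · intro j _; simp [hP0 j]
  calc ∫⁻ x, ∏ j, G j x ∂μ ≤ ∫⁻ x, (∏ j, c j) * ∏ j, f j x ^ ((P j)⁻¹).toReal ∂μ := by
        apply lintegral_mono_ae
        filter_upwards [hle] with x hx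
        rw [← Finset.prod_mul_distrib]
        exact Finset.prod_le_prod' fun j _ => hx j
    _ = (∏ j, c j) * ∫⁻ x, ∏ j, f j x ^ ((P j)⁻¹).toReal ∂μ := by
        apply lintegral_const_mul''
        exact Finset.aemeasurable_fun_prod _ fun j _ => (hf j).pow_const _
    _ ≤ (∏ j, c j) * ∏ j, (∫⁻ x, f j x ∂μ) ^ ((P j)⁻¹).toReal := by
        gcongr
        exact ENNReal.lintegral_prod_norm_pow_le _ (fun j _ => hf j) hsum
          (fun j _ => ENNReal.toReal_nonneg)
    _ = ∏ j, eNorm (P j) μ (G j) := by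
        rw [← Finset.prod_mul_distrib]
        apply Finset.prod_congr rfl
        intro j _
        by_cases h : P j = ∞
        · simp [f, c, h, eNorm]
        · simp only [f, c, h, if_false, eNorm, ENNReal.toReal_inv, one_mul, one_div]

/-- Hölder with powers: `∑ α_j / θ_j = 1`. -/
lemma holder_pow {J : Type*} [Fintype J] (μ : Measure α) (a : J → ℝ) (ha : ∀ j, 0 < a j)
    (θ : J → ℝ≥0∞) (hP : ∑ j, ENNReal.ofReal (a j) * (θ j)⁻¹ = 1)
    (G : J → α → ℝ≥0∞) (hG : ∀ j, AEMeasurable (G j) μ) :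
    ∫⁻ x, ∏ j, G j x ^ a j ∂μ ≤ ∏ j, eNorm (θ j) μ (G j) ^ a j := by
  have hne : ∀ j, ENNReal.ofReal (a j) ≠ 0 := fun j => by simpa using ha j
  refine (holder_eNorm μ (fun j => (ENNReal.ofReal (a j))⁻¹ * θ j) ?_ (fun j x => G j x ^ a j)
    (fun j => (hG j).pow_const _)).trans (le_of_eq ?_)
  · rw [← hP]
    apply Finset.sum_congr rfl
    intro j _
    rw [ENNReal.mul_inv (by simp) (by simp [ha j]), inv_inv]
  · apply Finset.prod_congr rfl
    intro j _
    rw [eNorm_rpow μ _ (ha j)]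
    congr 2
    rw [mul_comm, ← mul_assoc, ENNReal.mul_inv_cancel (hne j) (by simp), one_mul]

/-- Minkowski integral inequality. -/
lemma minkowski {Y : Type*} [MeasurableSpace Y] (ν : Measure Y) [SFinite ν] (μ : Measure α)
    [SigmaFinite μ] (h : Y → α → ℝ≥0∞) (hh : Measurable (Function.uncurry h)) {θ : ℝ≥0∞}
    (hθ : 1 < θ) :
    eNorm θ μ (fun ω => ∫⁻ y, h y ω ∂ν) ≤ ∫⁻ y, eNorm θ μ (h y) ∂ν := by
  have hHm : Measurable (fun y => eNorm θ μ (h y)) := measurable_eNorm θ μ h hh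
  have hswap : Measurable (fun z : α × Y => h z.2 z.1) := hh.comp measurable_swap
  have hu : Measurable (fun ω => ∫⁻ y, h y ω ∂ν) :=
    Measurable.lintegral_prod_right' (f := fun z : α × Y => h z.2 z.1) hswap
  by_cases htop : θ = ∞
  · subst htop
    simp only [eNorm_top] at *
    refine essSup_le_of_ae_le _ ?_
    have h1 : ∀ᵐ z ∂(ν.prod μ), Function.uncurry h z ≤ essSup (h z.1) μ := by
      rw [Measure.ae_prod_iff_ae_ae]
      · exact ae_of_all _ fun y => ENNReal.ae_le_essSup (h y)
      · exact measurableSet_le hh (hHm.comp measurable_fst)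
    have h2 : ∀ᵐ ω ∂μ, ∀ᵐ y ∂ν, h y ω ≤ essSup (h y) μ := by
      have h3 : ∀ᵐ y ∂ν, ∀ᵐ ω ∂μ, h y ω ≤ essSup (h y) μ := Measure.ae_ae_of_ae_prod h1
      rw [Measure.ae_ae_comm (p := fun y ω => h y ω ≤ essSup (h y) μ)] at h3
      · exact h3
      · exact measurableSet_le hh (hHm.comp measurable_fst)
    filter_upwards [h2] with ω hω
    exact lintegral_mono_ae hω
  set p := θ.toReal with hp
  have hp1 : 1 < p := by
    have := (ENNReal.toReal_lt_toReal (by simp) htop).2 hθ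
    simpa using this
  have hp0 : 0 < p := by linarith
  set u : α → ℝ≥0∞ := fun ω => ∫⁻ y, h y ω ∂ν with hudef
  set R := ∫⁻ y, eNorm θ μ (h y) ∂ν with hR
  let un : ℕ → α → ℝ≥0∞ := fun n ω => (spanningSets μ n).indicator (fun ω => min (u ω) n) ω
  have hunm : ∀ n, Measurable (un n) := fun n =>
    (hu.min measurable_const).indicator (measurableSet_spanningSets μ n)
  have hunle : ∀ n ω, un n ω ≤ u ω := by
    intro n ω
    by_cases hω : ω ∈ spanningSets μ n
    · simp only [un, Set.indicator_of_mem hω]; exact min_le_left _ _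
    · simp only [un, Set.indicator_of_notMem hω]; exact zero_le
  have key : ∀ n, ∫⁻ ω, un n ω ^ p ∂μ ≤ R ^ p := by
    intro n
    set I := ∫⁻ ω, un n ω ^ p ∂μ with hI
    have hIfin : I ≠ ∞ := by
      have : I ≤ ∫⁻ ω in spanningSets μ n, (n : ℝ≥0∞) ^ p ∂μ := by
        rw [hI, ← lintegral_indicator (measurableSet_spanningSets μ n)]
        apply lintegral_mono
        intro ω
        by_cases hω : ω ∈ spanningSets μ n
        · simp only [un, Set.indicator_of_mem hω]
          gcongr; exact min_le_right _ _
        · simp only [un, Set.indicator_of_notMem hω]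
          simp [hp0]
      refine ne_top_of_le_ne_top ?_ this
      rw [setLIntegral_const]
      exact ENNReal.mul_ne_top (ENNReal.rpow_ne_top_of_nonneg hp0.le (by simp))
        (measure_spanningSets_lt_top μ n).ne
    by_cases hI0 : I = 0
    · rw [hI0]; exact zero_le
    have hconj : p.HolderConjugate (p / (p - 1)) := Real.HolderConjugate.conjExponent hp1
    have h1 : I ≤ R * I ^ (1 - 1 / p) := by
      calc I ≤ ∫⁻ ω, u ω * un n ω ^ (p - 1) ∂μ := by
            apply lintegral_mono
            intro ω
            have : un n ω ^ p = un n ω * un n ω ^ (p - 1) := by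
              conv_rhs => enter [1]; rw [← ENNReal.rpow_one (un n ω)]
              rw [← ENNReal.rpow_add_of_nonneg _ _ (by norm_num) (by linarith)]
              congr 1; ring
            simp only [this]
            gcongr
            exact hunle n ω
        _ = ∫⁻ ω, ∫⁻ y, h y ω * un n ω ^ (p - 1) ∂ν ∂μ := by
            apply lintegral_congr
            intro ω
            rw [lintegral_mul_const]
            exact hh.comp (measurable_id.prodMk measurable_const)
        _ = ∫⁻ y, ∫⁻ ω, h y ω * un n ω ^ (p - 1) ∂μ ∂ν := by
            apply lintegral_lintegral_swap
            exact (hswap.mul (((hunm n).pow_const _).comp measurable_fst)).aemeasurable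
        _ ≤ ∫⁻ y, eNorm θ μ (h y) * I ^ (1 - 1 / p) ∂ν := by
            apply lintegral_mono
            intro y
            have hhy : Measurable (h y) := hh.comp (measurable_const.prodMk measurable_id)
            refine (ENNReal.lintegral_mul_le_Lp_mul_Lq μ hconj hhy.aemeasurable
              ((hunm n).pow_const _).aemeasurable).trans (le_of_eq ?_)
            dsimp only
            rw [eNorm_of_ne_top htop]
            congr 1
            have : ∀ ω, (un n ω ^ (p - 1)) ^ (p / (p - 1)) = un n ω ^ p := by
              intro ω
              rw [← ENNReal.rpow_mul]
              congr 1
              have : p - 1 ≠ 0 := by linarith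
              field_simp
            simp_rw [this]
            congr 1
            have : p - 1 ≠ 0 := by linarith
            field_simp
        _ = R * I ^ (1 - 1 / p) := by
            rw [lintegral_mul_const _ hHm]
    have h2 : I ^ (1 / p) ≤ R := by
      have h3 : I ^ (1 - 1 / p) ≠ 0 := by
        simp [ENNReal.rpow_eq_zero_iff, hI0, hIfin]
      have h4 : I ^ (1 - 1 / p) ≠ ∞ := by
        simp [ENNReal.rpow_eq_top_iff, hI0, hIfin]
      have h5 : I = I ^ (1 / p) * I ^ (1 - 1 / p) := by
        rw [← ENNReal.rpow_add _ _ hI0 hIfin]; simp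
      rw [h5] at h1
      rw [← h5] at h1
      rw [← ENNReal.mul_le_mul_iff_left h3 h4, ← h5]
      exact h1
    calc I = (I ^ (1 / p)) ^ p := by
          rw [← ENNReal.rpow_mul, one_div_mul_cancel hp0.ne', ENNReal.rpow_one]
      _ ≤ R ^ p := by gcongr
  rw [eNorm_of_ne_top htop, ← hp]
  have hsup : ∀ ω, u ω ^ p = ⨆ n, un n ω ^ p := by
    intro ω
    have h1 : u ω = ⨆ n, un n ω := by
      apply le_antisymm _ (iSup_le fun n => hunle n ω)
      have hω : ω ∈ ⋃ n, spanningSets μ n := by rw [iUnion_spanningSets]; trivial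
      obtain ⟨n0, hn0⟩ := Set.mem_iUnion.1 hω
      have h2 : u ω = ⨆ k : ℕ, min (u ω) (k : ℝ≥0∞) := by
        rw [← inf_iSup_eq, ENNReal.iSup_natCast]; simp
      conv_lhs => rw [h2]
      apply iSup_le
      intro k
      refine le_trans ?_ (le_iSup _ (max k n0))
      have hm : ω ∈ spanningSets μ (max k n0) := monotone_spanningSets μ (le_max_right _ _) hn0
      simp only [un, Set.indicator_of_mem hm]
      gcongr
      exact le_max_left _ _
    conv_lhs => rw [h1]
    exact (ENNReal.orderIsoRpow p hp0).map_iSup _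
  have hfin : ∫⁻ ω, u ω ^ p ∂μ ≤ R ^ p := by
    simp_rw [hsup]
    rw [lintegral_iSup]
    · exact iSup_le key
    · intro n; exact (hunm n).pow_const _
    · intro k l hkl ω
      dsimp only
      apply ENNReal.rpow_le_rpow _ hp0.le
      by_cases hω : ω ∈ spanningSets μ k
      · have hω' := monotone_spanningSets μ hkl hω
        simp only [un, Set.indicator_of_mem hω, Set.indicator_of_mem hω']
        gcongr
      · simp only [un, Set.indicator_of_notMem hω]; exact zero_le
  calc (∫⁻ ω, u ω ^ p ∂μ) ^ (1 / p) ≤ (R ^ p) ^ (1 / p) := by gcongr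
    _ = R := by rw [← ENNReal.rpow_mul, mul_one_div_cancel hp0.ne', ENNReal.rpow_one]

end eNormBasics

namespace Fil
variable {X ι : Type} [MeasurableSpace X] [MeasurableSpace ι]
variable (E : Fil X ι) [Countable ι] [MeasurableSingletonClass ι]

lemma av_minkowski (ν : Measure X) [SFinite ν] {Ω : Type*} [MeasurableSpace Ω] (μ : Measure Ω)
    [SigmaFinite μ] (h : X → Ω → ℝ≥0∞) (hh : Measurable (Function.uncurry h)) {θ : ℝ≥0∞}
    (hθ : 1 < θ) (n : ℤ) (x : X) :
    eNorm θ μ (fun ω => E.av ν n (fun y => h y ω) x) ≤ E.av ν n (fun y => eNorm θ μ (h y)) x := by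
  unfold av
  simp_rw [div_eq_mul_inv, mul_comm _ (ν (E.cell n x))⁻¹]
  rw [eNorm_const_mul θ (lt_trans one_pos hθ)]
  · gcongr
    exact minkowski _ μ h hh hθ
  · exact Measurable.lintegral_prod_right' (f := fun z : Ω × X => h z.2 z.1)
      (hh.comp measurable_swap)

def doobE (θ : ℝ≥0∞) : ℝ≥0∞ :=
  if θ = ∞ then 1 else doobC θ.toReal ^ (1 / θ.toReal)

lemma doobE_ne_top {θ : ℝ≥0∞} (hθ : 1 < θ) : doobE θ ≠ ∞ := by
  unfold doobE
  split_ifs with h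
  · simp
  · have h1 : 1 < θ.toReal := by
      have := (ENNReal.toReal_lt_toReal (by simp) h).2 hθ
      simpa using this
    exact ENNReal.rpow_ne_top_of_nonneg (by positivity) (doobC_ne_top h1)

lemma av_le_essSup (ν : Measure X) (f : X → ℝ≥0∞) (n : ℤ) (x : X) :
    E.av ν n f x ≤ essSup f ν := by
  unfold av
  calc (∫⁻ y in E.cell n x, f y ∂ν) / ν (E.cell n x)
      ≤ (∫⁻ y in E.cell n x, essSup f ν ∂ν) / ν (E.cell n x) := by
        gcongr 1
        apply lintegral_mono_ae
        exact ae_restrict_of_ae (ENNReal.ae_le_essSup f)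
    _ ≤ _ := by
        rw [setLIntegral_const, mul_div_assoc]
        exact mul_le_of_le_one_right' ENNReal.div_self_le_one

lemma doob_eNorm (ν : Measure X) (hν : ∀ n x, ν (E.cell n x) ≠ ∞) (f : X → ℝ≥0∞)
    (hf : Measurable f) {θ : ℝ≥0∞} (hθ : 1 < θ) :
    eNorm θ ν (E.mx ν f) ≤ doobE θ * eNorm θ ν f := by
  by_cases h : θ = ∞
  · subst h
    simp only [doobE, if_true, one_mul, eNorm_top]
    refine essSup_le_of_ae_le _ ?_
    exact ae_of_all _ fun x => iSup_le fun n => E.av_le_essSup ν f n x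
  · have h1 : 1 < θ.toReal := by
      have := (ENNReal.toReal_lt_toReal (by simp) h).2 hθ
      simpa using this
    simp only [doobE, h, if_false, eNorm_of_ne_top h]
    rw [← ENNReal.mul_rpow_of_nonneg _ _ (by positivity)]
    gcongr
    exact E.doob ν hν f hf h1

end Fil

lemma prod_rpow_sum {J : Type*} (s : Finset J) (v : ℝ≥0∞) (h0 : v ≠ 0) (h1 : v ≠ ∞) (a : J → ℝ) :
    ∏ j ∈ s, v ^ a j = v ^ ∑ j ∈ s, a j := by
  classical
  induction s using Finset.induction_on with
  | empty => simp
  | insert i s hi ih => rw [Finset.prod_insert hi, Finset.sum_insert hi, ENNReal.rpow_add _ _ h0 h1, ih]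

namespace Fil
variable {X ι : Type} [MeasurableSpace X] [MeasurableSpace ι]
variable (E : Fil X ι) [Countable ι] [MeasurableSingletonClass ι]
variable {Ω : Type} [MeasurableSpace Ω]

lemma measurable_av_joint (v : Measure X) [SFinite v] (n : ℤ) (g : X → Ω → ℝ≥0∞)
    (hg : Measurable (Function.uncurry g)) :
    Measurable (fun z : X × Ω => E.av v n (fun y => g y z.2) z.1) := by
  have h1 : Measurable (fun z : ι × Ω =>
      (∫⁻ y in E.e n ⁻¹' {z.1}, g y z.2 ∂v) / v (E.e n ⁻¹' {z.1})) := by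
    apply measurable_from_prod_countable_right
    intro i
    have h2 : Measurable (fun ω => ∫⁻ y in E.e n ⁻¹' {i}, g y ω ∂v) :=
      Measurable.lintegral_prod_right' (ν := v.restrict (E.e n ⁻¹' {i}))
        (f := fun z : Ω × X => g z.2 z.1) (hg.comp measurable_swap)
    exact h2.div_const (v (E.e n ⁻¹' {i}))
  exact h1.comp (((E.meas n).comp measurable_fst).prodMk measurable_snd)

lemma measurable_mx_joint (v : Measure X) [SFinite v] (g : X → Ω → ℝ≥0∞)
    (hg : Measurable (Function.uncurry g)) :
    Measurable (fun z : X × Ω => E.mx v (fun y => g y z.2) z.1) :=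
  Measurable.iSup fun n => E.measurable_av_joint v n g hg

lemma doob_vec (v : Measure X) [SFinite v] (hfin : ∀ n x, v (E.cell n x) ≠ ∞)
    (μ : Measure Ω) [SigmaFinite μ] (g : X → Ω → ℝ≥0∞)
    (hg : Measurable (Function.uncurry g)) {θ : ℝ≥0∞} (hθ : 1 < θ) (c : ℝ≥0∞) (S : Set X)
    (hS : MeasurableSet S) (hgc : ∀ x, eNorm θ μ (g x) ≤ S.indicator (fun _ => c) x) :
    eNorm θ v (fun x => eNorm θ μ (fun ω => E.mx v (fun y => g y ω) x)) ≤
      doobE θ * c * v S ^ (θ⁻¹).toReal := by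
  have hmj := E.measurable_mx_joint v g hg
  have hgω : ∀ ω, Measurable (fun y => g y ω) := fun ω =>
    hg.comp (measurable_id.prodMk measurable_const)
  by_cases htop : θ = ∞
  · subst htop
    simp only [eNorm_top] at *
    simp only [doobE, if_true, one_mul, ENNReal.inv_top, ENNReal.toReal_zero, ENNReal.rpow_zero, mul_one]
    have hae : ∀ᵐ ω ∂μ, ∀ᵐ x ∂v, g x ω ≤ c := by
      have h3 : ∀ᵐ y ∂v, ∀ᵐ ω ∂μ, g y ω ≤ c := by
        refine ae_of_all _ fun y => ?_
        filter_upwards [ENNReal.ae_le_essSup (g y)] with ω hω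
        refine hω.trans ((hgc y).trans ?_)
        exact Set.indicator_le_self' (fun _ _ => zero_le) y
      rw [Measure.ae_ae_comm (p := fun y ω => g y ω ≤ c)] at h3
      · exact h3
      · exact measurableSet_le hg measurable_const
    refine essSup_le_of_ae_le _ (ae_of_all _ fun x => ?_)
    refine essSup_le_of_ae_le _ ?_
    filter_upwards [hae] with ω hω
    refine iSup_le fun n => (E.av_le_essSup v _ n x).trans ?_
    exact essSup_le_of_ae_le _ hω
  · have h1 : 1 < θ.toReal := by
      have := (ENNReal.toReal_lt_toReal (by simp) htop).2 hθ
      simpa using this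
    set p := θ.toReal with hp
    have hp0 : 0 < p := by linarith
    simp only [eNorm_of_ne_top htop] at *
    simp only [doobE, htop, if_false, ENNReal.toReal_inv, ← hp] at *
    have hpp : ∀ z : ℝ≥0∞, (z ^ (1 / p)) ^ p = z := by
      intro z; rw [← ENNReal.rpow_mul, one_div_mul_cancel hp0.ne', ENNReal.rpow_one]
    have hpp' : ∀ z : ℝ≥0∞, (z ^ p) ^ (1 / p) = z := by
      intro z; rw [← ENNReal.rpow_mul, mul_one_div_cancel hp0.ne', ENNReal.rpow_one]
    simp only [hpp]
    have hmain : ∫⁻ x, ∫⁻ ω, E.mx v (fun y => g y ω) x ^ p ∂μ ∂v ≤ doobC p * (c ^ p * v S) := by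
      calc ∫⁻ x, ∫⁻ ω, E.mx v (fun y => g y ω) x ^ p ∂μ ∂v
          = ∫⁻ ω, ∫⁻ x, E.mx v (fun y => g y ω) x ^ p ∂v ∂μ := by
            apply lintegral_lintegral_swap
            exact (hmj.pow_const _).aemeasurable
        _ ≤ ∫⁻ ω, doobC p * ∫⁻ x, g x ω ^ p ∂v ∂μ := by
            apply lintegral_mono
            intro ω
            exact E.doob v hfin _ (hgω ω) h1
        _ = doobC p * ∫⁻ ω, ∫⁻ x, g x ω ^ p ∂v ∂μ := by
            apply lintegral_const_mul
            exact Measurable.lintegral_prod_right' (f := fun z : Ω × X => g z.2 z.1 ^ p)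
              ((hg.comp measurable_swap).pow_const _)
        _ = doobC p * ∫⁻ x, ∫⁻ ω, g x ω ^ p ∂μ ∂v := by
            congr 1
            apply lintegral_lintegral_swap
            exact ((hg.comp measurable_swap).pow_const _).aemeasurable
        _ ≤ doobC p * ∫⁻ x, S.indicator (fun _ => c ^ p) x ∂v := by
            gcongr with x
            have := ENNReal.rpow_le_rpow (hgc x) hp0.le
            rw [hpp] at this
            refine this.trans (le_of_eq ?_)
            by_cases hx : x ∈ S <;> simp [hx, hp0]
        _ = doobC p * (c ^ p * v S) := by
            rw [lintegral_indicator_const hS]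
    calc (∫⁻ x, ∫⁻ ω, E.mx v (fun y => g y ω) x ^ p ∂μ ∂v) ^ (1 / p)
        ≤ (doobC p * (c ^ p * v S)) ^ (1 / p) := by gcongr
      _ = _ := by
        rw [ENNReal.mul_rpow_of_nonneg _ _ (by positivity), ENNReal.mul_rpow_of_nonneg _ _ (by positivity),
          hpp', ← mul_assoc, one_div]

/-- restricted sup -/
def rs (n N : ℤ) (φ : ℤ → ℝ≥0∞) : ℝ≥0∞ := ⨆ k : ℤ, ⨆ _ : n ≤ k ∧ k ≤ N, φ k

lemma le_rs {n N k : ℤ} (h1 : n ≤ k) (h2 : k ≤ N) (φ : ℤ → ℝ≥0∞) : φ k ≤ rs n N φ :=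
  le_iSup₂_of_le k ⟨h1, h2⟩ le_rfl

lemma rs_anti {n n' N : ℤ} (h : n ≤ n') (φ : ℤ → ℝ≥0∞) : rs n' N φ ≤ rs n N φ :=
  iSup₂_le fun _ hk => le_rs (h.trans hk.1) hk.2 φ

lemma av_indicator_cell (v : Measure X) {n k : ℤ} (hnk : n ≤ k) (f : X → ℝ≥0∞) (x0 : X) {x : X}
    (hx : x ∈ E.cell n x0) : E.av v k ((E.cell n x0).indicator f) x = E.av v k f x := by
  unfold av
  congr 1
  apply setLIntegral_congr_fun (E.meas_cell k x)
  intro y hy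
  have : y ∈ E.cell n x0 := E.sat_cell hnk x0 x hx hy
  simp [this]

/-- measure of the bad set for one function -/
lemma bad_measure (v : Measure X) (hfin : ∀ n x, v (E.cell n x) ≠ ∞)
    (hpos : ∀ n x, v (E.cell n x) ≠ 0) (f : X → ℝ≥0∞) (K : ℝ≥0∞) (hK : 1 ≤ K) (hK' : K ≠ ∞)
    (n : ℤ) (x0 : X) :
    v {x | x ∈ E.cell n x0 ∧ ∃ k, n ≤ k ∧ K * E.av v n f x0 < E.av v k f x} ≤
      v (E.cell n x0) / K := by
  set S := E.cell n x0
  set a := E.av v n f x0 with ha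
  have hK0 : K ≠ 0 := (lt_of_lt_of_le one_pos hK).ne'
  have hInt : ∫⁻ x in S, f x ∂v = a * v S := by
    rw [ha]; unfold av
    rw [ENNReal.div_mul_cancel (hpos n x0) (hfin n x0)]
  by_cases hatop : a = ∞
  · have : {x | x ∈ S ∧ ∃ k, n ≤ k ∧ K * a < E.av v k f x} = ∅ := by
      ext x
      simp [hatop, ENNReal.mul_top hK0]
    rw [this]; simp
  by_cases ha0 : a = 0
  · have : {x | x ∈ S ∧ ∃ k, n ≤ k ∧ K * a < E.av v k f x} = ∅ := by
      ext x
      simp only [Set.mem_ofPred_eq, Set.mem_empty_iff_false, iff_false, not_and, not_exists, not_lt]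
      intro hx k hk
      have : ∫⁻ y in E.cell k x, f y ∂v ≤ 0 := by
        have h2 : ∫⁻ y in E.cell k x, f y ∂v ≤ ∫⁻ x in S, f x ∂v :=
          lintegral_mono_set (E.sat_cell hk x0 x hx)
        rwa [hInt, ha0, zero_mul] at h2
      unfold av
      rw [nonpos_iff_eq_zero.1 this]; simp
    rw [this]; simp
  have hw := E.weak v hfin (S.indicator f) (K * a)
  rw [lintegral_indicator (E.meas_cell n x0), hInt] at hw
  rw [ENNReal.le_div_iff_mul_le (Or.inl hK0) (Or.inl hK')]
  have h2 : K * a * v {x | x ∈ S ∧ ∃ k, n ≤ k ∧ K * a < E.av v k f x} ≤ a * v S := by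
    refine le_trans (mul_le_mul' le_rfl (measure_mono ?_)) hw
    rintro x ⟨hx, k, hk, hlt⟩
    refine lt_of_lt_of_le hlt ?_
    refine le_trans (le_of_eq ?_) (le_iSup _ k)
    exact (E.av_indicator_cell v hk f x0 hx).symm
  have h3 : ∀ z : ℝ≥0∞, K * a * z = a * (z * K) := fun z => by ring
  rw [h3, ENNReal.mul_le_mul_iff_right ha0 hatop] at h2
  exact h2

end Fil

namespace Fil
variable {X ι : Type} [MeasurableSpace X] [MeasurableSpace ι]
variable (E : Fil X ι) [Countable ι] [MeasurableSingletonClass ι]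
variable {Ω : Type} [MeasurableSpace Ω]
variable {J : Type} [Fintype J]

/-- constant in the stopping-time argument -/
def bK (J : Type) [Fintype J] : ℝ≥0∞ := 2 * ((Fintype.card J : ℝ≥0∞) + 1)

lemma one_le_bK : 1 ≤ bK J := by
  unfold bK
  calc (1:ℝ≥0∞) ≤ 2 * (0 + 1) := by norm_num
    _ ≤ _ := by gcongr; exact zero_le

lemma bK_ne_top : bK J ≠ ∞ := by
  unfold bK
  exact ENNReal.mul_ne_top (by simp) (by simp)

def bC (A : ℝ≥0∞) (a : J → ℝ) (θ : J → ℝ≥0∞) : ℝ≥0∞ :=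
  ∏ j, (doobE (θ j) * (A * bK J)) ^ a j

def PR (v : Measure X) (a : J → ℝ) (h : J → X → ℝ≥0∞) (n : ℤ) (x : X) : ℝ≥0∞ :=
  ∏ j, E.av v n (h j) x ^ a j

lemma measurable_PR (v : Measure X) (a : J → ℝ) (h : J → X → ℝ≥0∞) (n : ℤ) :
    Measurable (E.PR v a h n) :=
  Finset.measurable_prod _ fun j _ => (E.measurable_av v n (h j)).pow_const _

lemma measurable_PR_joint (v : Measure X) [SFinite v] (a : J → ℝ) (h : J → X → Ω → ℝ≥0∞)
    (hh : ∀ j, Measurable (Function.uncurry (h j))) (n : ℤ) :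
    Measurable (fun z : X × Ω => E.PR v a (fun j y => h j y z.2) n z.1) :=
  Finset.measurable_prod _ fun j _ => (E.measurable_av_joint v n (h j) (hh j)).pow_const _

lemma measurable_rs {Y : Type*} [MeasurableSpace Y] (n N : ℤ) (φ : ℤ → Y → ℝ≥0∞)
    (h : ∀ k, Measurable (φ k)) : Measurable (fun y => rs n N (fun k => φ k y)) :=
  Measurable.iSup fun k => Measurable.iSup fun _ => h k

lemma meas_sec {Y Z : Type*} [MeasurableSpace Y] [MeasurableSpace Z] {Φ : Y × Z → ℝ≥0∞}
    (h : Measurable Φ) (y : Y) : Measurable (fun z => Φ (y, z)) := h.comp measurable_prodMk_left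

lemma PR_eq (v : Measure X) (a : J → ℝ) (h : J → X → ℝ≥0∞) {n : ℤ} {x y : X}
    (hy : y ∈ E.cell n x) : E.PR v a h n y = E.PR v a h n x := by
  unfold PR
  exact Finset.prod_congr rfl fun j _ => by rw [E.av_eq v (h j) hy]

/-- the main (stopped) part -/
lemma main_part (v : Measure X) [SFinite v] (hfin : ∀ n x, v (E.cell n x) ≠ ∞)
    (hpos : ∀ n x, v (E.cell n x) ≠ 0)
    (μ : Measure Ω) [SigmaFinite μ] (A : ℝ≥0∞)
    (a : J → ℝ) (ha : ∀ j, 0 < a j) (θ : J → ℝ≥0∞) (hθ : ∀ j, 1 < θ j)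
    (hsum : ∑ j, ENNReal.ofReal (a j) * (θ j)⁻¹ = 1)
    (n : ℤ) (x0 : X) (g : J → X → Ω → ℝ≥0∞) (hg : ∀ j, Measurable (Function.uncurry (g j)))
    (c : J → ℝ≥0∞)
    (hgc : ∀ j x, eNorm (θ j) μ (g j x) ≤ (E.cell n x0).indicator (fun _ => A * bK J * c j) x) :
    ∫⁻ x, ∫⁻ ω, ∏ j, E.mx v (fun y => g j y ω) x ^ a j ∂μ ∂v ≤
      bC A a θ * (v (E.cell n x0) * ∏ j, c j ^ a j) := by
  set S := E.cell n x0
  have hmm := fun j => E.measurable_mx_joint v (g j) (hg j)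
  calc ∫⁻ x, ∫⁻ ω, ∏ j, E.mx v (fun y => g j y ω) x ^ a j ∂μ ∂v
      ≤ ∫⁻ x, ∏ j, eNorm (θ j) μ (fun ω => E.mx v (fun y => g j y ω) x) ^ a j ∂v := by
        apply lintegral_mono
        intro x
        exact holder_pow μ a ha θ hsum (fun j ω => E.mx v (fun y => g j y ω) x)
          (fun j => ((hmm j).comp (measurable_const.prodMk measurable_id)).aemeasurable)
    _ ≤ ∏ j, eNorm (θ j) v (fun x => eNorm (θ j) μ (fun ω => E.mx v (fun y => g j y ω) x)) ^ a j := by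
        apply holder_pow v a ha θ hsum
        intro j
        exact (measurable_eNorm (θ j) μ (fun x ω => E.mx v (fun y => g j y ω) x) (hmm j)).aemeasurable
    _ ≤ ∏ j, (doobE (θ j) * (A * bK J * c j) * v S ^ ((θ j)⁻¹).toReal) ^ a j := by
        apply Finset.prod_le_prod'
        intro j _
        apply ENNReal.rpow_le_rpow _ (ha j).le
        exact E.doob_vec v hfin μ (g j) (hg j) (hθ j) _ S (E.meas_cell n x0) (hgc j)
    _ = bC A a θ * (v S * ∏ j, c j ^ a j) := by
        have h1 : ∏ j, (v S ^ ((θ j)⁻¹).toReal) ^ a j = v S := by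
          simp_rw [← ENNReal.rpow_mul]
          rw [prod_rpow_sum _ _ (hpos n x0) (hfin n x0)]
          have : ∑ j, ((θ j)⁻¹).toReal * a j = 1 := by
            rw [← ENNReal.toReal_one, ← hsum, ENNReal.toReal_sum]
            · apply Finset.sum_congr rfl
              intro j _
              rw [ENNReal.toReal_mul, ENNReal.toReal_ofReal (ha j).le, mul_comm]
            · intro j _
              apply ENNReal.mul_ne_top (by simp)
              simpa using (lt_trans one_pos (hθ j)).ne'
          rw [this, ENNReal.rpow_one]
        have h2 : ∀ j, (doobE (θ j) * (A * bK J * c j) * v S ^ ((θ j)⁻¹).toReal) ^ a j =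
            (doobE (θ j) * (A * bK J)) ^ a j * c j ^ a j * (v S ^ ((θ j)⁻¹).toReal) ^ a j := by
          intro j
          rw [← mul_assoc, ENNReal.mul_rpow_of_nonneg _ _ (ha j).le,
            ENNReal.mul_rpow_of_nonneg _ _ (ha j).le]
        simp_rw [h2, Finset.prod_mul_distrib, h1, bC]
        ring

set_option maxHeartbeats 1600000 in
lemma stop_ind (v : Measure X) [SFinite v] (hfin : ∀ n x, v (E.cell n x) ≠ ∞)
    (hpos : ∀ n x, v (E.cell n x) ≠ 0)
    (μ : Measure Ω) [SigmaFinite μ] (A : ℝ≥0∞) (hA1 : 1 ≤ A)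
    (hA : ∀ n x, v (E.cell n x) ≤ A * v (E.cell (n + 1) x))
    (a : J → ℝ) (ha : ∀ j, 0 < a j) (θ : J → ℝ≥0∞) (hθ : ∀ j, 1 < θ j)
    (hsum : ∑ j, ENNReal.ofReal (a j) * (θ j)⁻¹ = 1)
    (h : J → X → Ω → ℝ≥0∞) (hh : ∀ j, Measurable (Function.uncurry (h j))) (N : ℤ) :
    ∀ i : ℕ, ∀ n : ℤ, n + i = N → ∀ x0,
      ∫⁻ x in E.cell n x0, ∫⁻ ω, rs n N (fun k => E.PR v a (fun j y => h j y ω) k x) ∂μ ∂v ≤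
      ∫⁻ x in E.cell n x0, 2 * bC A a θ *
        rs n N (fun k => E.PR v a (fun j y => eNorm (θ j) μ (h j y)) k x) ∂v := by
  classical
  intro i
  induction i using Nat.strong_induction_on with
  | _ i IH =>
  intro n hnN x0
  have hnN' : n ≤ N := by omega
  set S := E.cell n x0 with hS
  set H : J → X → ℝ≥0∞ := fun j y => eNorm (θ j) μ (h j y) with hH
  set c : J → ℝ≥0∞ := fun j => E.av v n (H j) x0 with hc
  set K := bK J with hK
  set C0 := bC A a θ with hC0
  set f : X → Ω → ℤ → ℝ≥0∞ := fun x ω k => E.PR v a (fun j y => h j y ω) k x with hf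
  set G : X → ℤ → ℝ≥0∞ := fun x k => E.PR v a H k x with hG
  let bad : ℤ → X → Prop := fun k x => n < k ∧ k ≤ N ∧ ∃ j, K * c j < E.av v k (H j) x
  have bad_cell : ∀ k x y, y ∈ E.cell k x → bad k x → bad k y := by
    rintro k x y hy ⟨h1, h2, j, hj⟩
    exact ⟨h1, h2, j, by rwa [E.av_eq v (H j) hy]⟩
  let B : ℤ → Set X := fun k => {x | x ∈ S ∧ (bad k x ∨ k = N) ∧ ∀ l, l < k → ¬ bad l x}
  let D : ℤ → Set X := fun k => {x | x ∈ S ∧ bad k x ∧ ∀ l, l < k → ¬ bad l x}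
  have hBsat : ∀ k, n ≤ k → E.Sat k (B k) := by
    rintro k hk x ⟨h1, h2, h3⟩ y hy
    refine ⟨E.sat_cell hk x0 x h1 hy, h2.imp (bad_cell k x y hy) id, fun l hl hb => h3 l hl ?_⟩
    refine bad_cell l y x ?_ hb
    exact (E.cell_subset hl.le x hy : E.e l y = E.e l x).symm
  have hDsat : ∀ k, n ≤ k → E.Sat k (D k) := by
    rintro k hk x ⟨h1, h2, h3⟩ y hy
    refine ⟨E.sat_cell hk x0 x h1 hy, bad_cell k x y hy h2, fun l hl hb => h3 l hl ?_⟩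
    refine bad_cell l y x ?_ hb
    exact (E.cell_subset hl.le x hy : E.e l y = E.e l x).symm
  have hBuniq : ∀ k l x, k ≤ N → l ≤ N → x ∈ B k → x ∈ B l → k = l := by
    have aux : ∀ k l x, l ≤ N → k < l → x ∈ B k → x ∈ B l → False := by
      rintro k l x hl hkl ⟨-, h2, -⟩ ⟨-, -, h6⟩
      rcases h2 with h2 | h2
      · exact h6 k hkl h2
      · omega
    intro k l x hk hl h1 h2
    rcases lt_trichotomy k l with h3 | h3 | h3
    · exact (aux k l x hl h3 h1 h2).elim
    · exact h3
    · exact (aux l k x hk h3 h2 h1).elim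
  -- existence of the stopping level
  have hBex : ∀ x ∈ S, ∃ k, n ≤ k ∧ k ≤ N ∧ x ∈ B k := by
    intro x hx
    by_cases hb : ∃ k : ℕ, bad (n + k) x
    · refine ⟨n + (Nat.find hb : ℕ), by omega, (Nat.find_spec hb).2.1, hx, Or.inl (Nat.find_spec hb), ?_⟩
      intro l hl hbl
      obtain ⟨l', rfl⟩ := Int.le.dest hbl.1.le
      exact Nat.find_min hb (by omega) hbl
    · refine ⟨N, hnN', le_rfl, hx, Or.inr rfl, ?_⟩
      intro l hl hbl
      obtain ⟨l', rfl⟩ := Int.le.dest hbl.1.le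
      exact hb ⟨l', hbl⟩
  -- stopped functions
  let g : J → X → Ω → ℝ≥0∞ := fun j x ω =>
    ∑ k ∈ Finset.Icc n N, (B k).indicator (fun x => E.av v k (fun y => h j y ω) x) x
  have hgm : ∀ j, Measurable (Function.uncurry (g j)) := by
    intro j
    have : Function.uncurry (g j) = fun z : X × Ω => ∑ k ∈ Finset.Icc n N,
        (Prod.fst ⁻¹' (B k)).indicator (fun z : X × Ω => E.av v k (fun y => h j y z.2) z.1) z := by
      ext z; rfl
    rw [this]
    apply Finset.measurable_sum
    intro k hk
    exact (E.measurable_av_joint v k (h j) (hh j)).indicator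
      (measurable_fst (hBsat k (Finset.mem_Icc.1 hk).1).meas)
  have hg_on : ∀ j k x ω, n ≤ k → k ≤ N → x ∈ B k → g j x ω = E.av v k (fun y => h j y ω) x := by
    intro j k x ω h1 h2 hx
    simp only [g]
    rw [Finset.sum_eq_single k]
    · simp [hx]
    · intro l hl hlk
      apply Set.indicator_of_notMem
      intro hxl
      exact hlk (hBuniq l k x (Finset.mem_Icc.1 hl).2 h2 hxl hx)
    · intro hk; exact absurd (Finset.mem_Icc.2 ⟨h1, h2⟩) hk
  have hg_off : ∀ j x ω, x ∉ S → g j x ω = 0 := by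
    intro j x ω hx
    apply Finset.sum_eq_zero
    intro k _
    apply Set.indicator_of_notMem
    exact fun hxk => hx hxk.1
  have hAK : 1 ≤ A * K := one_le_mul hA1 one_le_bK
  -- bound on the norm of the stopped function
  have hgc : ∀ j x, eNorm (θ j) μ (g j x) ≤ S.indicator (fun _ => A * K * c j) x := by
    intro j x
    by_cases hx : x ∈ S
    · rw [Set.indicator_of_mem hx]
      obtain ⟨k, hk1, hk2, hxk⟩ := hBex x hx
      have e1 : g j x = fun ω => E.av v k (fun y => h j y ω) x := by
        ext ω; exact hg_on j k x ω hk1 hk2 hxk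
      rw [e1]
      refine (E.av_minkowski v μ (h j) (hh j) (hθ j) k x).trans ?_
      change E.av v k (H j) x ≤ _
      rcases eq_or_lt_of_le hk1 with rfl | hlt
      · rw [E.av_eq v (H j) hx]
        exact le_mul_of_one_le_left' hAK
      · have h1 : E.av v (k - 1) (H j) x ≤ K * c j := by
          rcases eq_or_lt_of_le (show n ≤ k - 1 by omega) with h2 | h2
          · rw [← h2, E.av_eq v (H j) hx]
            exact le_mul_of_one_le_left' one_le_bK
          · by_contra hcon
            exact hxk.2.2 (k - 1) (by omega) ⟨h2, by omega, j, not_le.1 hcon⟩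
        have h2 : E.av v k (H j) x ≤ A * E.av v (k - 1) (H j) x := by
          unfold av
          have h3 := hA (k - 1) x
          rw [sub_add_cancel] at h3
          rw [ENNReal.div_le_iff (hpos k x) (hfin k x)]
          calc ∫⁻ y in E.cell k x, H j y ∂v ≤ ∫⁻ y in E.cell (k - 1) x, H j y ∂v :=
                lintegral_mono_set (E.cell_subset (by omega) x)
            _ = (∫⁻ y in E.cell (k - 1) x, H j y ∂v) / v (E.cell (k - 1) x) * v (E.cell (k - 1) x) := by
                rw [ENNReal.div_mul_cancel (hpos _ x) (hfin _ x)]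
            _ ≤ (∫⁻ y in E.cell (k - 1) x, H j y ∂v) / v (E.cell (k - 1) x) * (A * v (E.cell k x)) := by
                gcongr
            _ = _ := by ring
        calc E.av v k (H j) x ≤ A * (K * c j) := h2.trans (by gcongr)
          _ = _ := by ring
    · rw [Set.indicator_of_notMem hx]
      have : g j x = fun ω => 0 := by ext ω; exact hg_off j x ω hx
      rw [this]
      have := eNorm_const_mul (θ j) (lt_trans one_pos (hθ j)) μ (fun _ => 0) measurable_const 0
      simp only [zero_mul] at this
      exact this.le
  -- averages of h are dominated by those of g below the stopping level
  have hav : ∀ j x ω k l, n ≤ l → l ≤ k → k ≤ N → x ∈ B k →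
      E.av v l (fun y => h j y ω) x ≤ E.av v l (fun y => g j y ω) x := by
    intro j x ω k l hl hlk hkN hx
    unfold av
    gcongr 1
    set Cl := E.cell l x with hCl
    have hClS : Cl ⊆ S := E.sat_cell hl x0 x hx.1
    have hcover : Cl ⊆ ⋃ k' ∈ Finset.Icc l N, Cl ∩ B k' := by
      intro y hy
      obtain ⟨k', h1, h2, h3⟩ := hBex y (hClS hy)
      have hlk' : l ≤ k' := by
        by_contra hcon
        have hcon : k' < l := not_le.1 hcon
        have : x ∈ B k' := hBsat k' h1 y h3 (by
          have : E.e k' y = E.e k' x := E.mono' hcon.le hy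
          exact this.symm)
        have := hBuniq k k' x hkN h2 hx this
        omega
      simp only [Set.mem_iUnion]
      exact ⟨k', Finset.mem_Icc.2 ⟨hlk', h2⟩, hy, h3⟩
    have hsat' : ∀ k' ∈ Finset.Icc l N, E.Sat k' (Cl ∩ B k') := by
      intro k' hk' y hy
      have h1 := (Finset.mem_Icc.1 hk').1
      exact Set.subset_inter (E.sat_cell h1 x y hy.1) (hBsat k' (hl.trans h1) y hy.2)
    have hdisj : Set.PairwiseDisjoint (↑(Finset.Icc l N)) (fun k' => Cl ∩ B k') := by
      intro k1 h1 k2 h2 hne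
      rw [Function.onFun, Set.disjoint_left]
      intro y hy1 hy2
      exact hne (hBuniq k1 k2 y (Finset.mem_Icc.1 h1).2 (Finset.mem_Icc.1 h2).2 hy1.2 hy2.2)
    calc ∫⁻ y in Cl, h j y ω ∂v ≤ ∫⁻ y in ⋃ k' ∈ Finset.Icc l N, Cl ∩ B k', h j y ω ∂v :=
          lintegral_mono_set hcover
      _ = ∑ k' ∈ Finset.Icc l N, ∫⁻ y in Cl ∩ B k', h j y ω ∂v :=
          lintegral_biUnion_finset hdisj (fun k' hk' => (hsat' k' hk').meas) _
      _ = ∑ k' ∈ Finset.Icc l N, ∫⁻ y in Cl ∩ B k', g j y ω ∂v := by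
          apply Finset.sum_congr rfl
          intro k' hk'
          rw [← (hsat' k' hk').lintegral_av v hfin]
          apply setLIntegral_congr_fun (hsat' k' hk').meas
          intro y hy
          have h1 := Finset.mem_Icc.1 hk'
          exact (hg_on j k' y ω (hl.trans h1.1) h1.2 hy.2).symm
      _ = ∫⁻ y in ⋃ k' ∈ Finset.Icc l N, Cl ∩ B k', g j y ω ∂v :=
          (lintegral_biUnion_finset hdisj (fun k' hk' => (hsat' k' hk').meas) _).symm
      _ ≤ ∫⁻ y in Cl, g j y ω ∂v :=
          lintegral_mono_set (Set.iUnion₂_subset fun k' _ => Set.inter_subset_left)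
  -- pointwise splitting
  have hsplit : ∀ x ∈ S, ∀ ω, rs n N (f x ω) ≤ (∏ j, E.mx v (fun y => g j y ω) x ^ a j) +
      ∑ k ∈ Finset.Ioc n N, (D k).indicator (fun x => rs k N (f x ω)) x := by
    intro x hx ω
    obtain ⟨k, hk1, hk2, hxk⟩ := hBex x hx
    apply iSup₂_le
    rintro l ⟨hl1, hl2⟩
    by_cases hlk : l ≤ k
    · refine le_trans ?_ le_self_add
      apply Finset.prod_le_prod'
      intro j _
      apply ENNReal.rpow_le_rpow _ (ha j).le
      exact (hav j x ω k l hl1 hlk hk2 hxk).trans (le_iSup (fun l => E.av v l (fun y => g j y ω) x) l)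
    · refine le_trans ?_ le_add_self
      have hb : bad k x := by
        rcases hxk.2.1 with h1 | h1
        · exact h1
        · omega
      have hxD : x ∈ D k := ⟨hxk.1, hb, hxk.2.2⟩
      refine le_trans ?_ (Finset.single_le_sum (f := fun k => (D k).indicator (fun x => rs k N (f x ω)) x)
        (fun _ _ => zero_le) (Finset.mem_Ioc.2 ⟨hb.1, hk2⟩))
      simp only [Set.indicator_of_mem hxD]
      exact le_rs (not_le.1 hlk).le hl2 (f x ω)
  -- measure of the union of the bad sets
  set U := ⋃ k ∈ Finset.Ioc n N, D k with hU
  have hDmeas : ∀ k ∈ Finset.Ioc n N, MeasurableSet (D k) := fun k hk =>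
    (hDsat k (Finset.mem_Ioc.1 hk).1.le).meas
  have hUm : MeasurableSet U := Finset.measurableSet_biUnion _ hDmeas
  have hUS : U ⊆ S := Set.iUnion₂_subset fun k _ x hx => hx.1
  have hDdisj : Set.PairwiseDisjoint (↑(Finset.Ioc n N)) D := by
    intro k1 h1 k2 h2 hne
    rw [Function.onFun, Set.disjoint_left]
    intro y hy1 hy2
    exact hne (hBuniq k1 k2 y (Finset.mem_Ioc.1 h1).2 (Finset.mem_Ioc.1 h2).2
      ⟨hy1.1, Or.inl hy1.2.1, hy1.2.2⟩ ⟨hy2.1, Or.inl hy2.2.1, hy2.2.2⟩)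
  have hUv : v U ≤ v S / 2 := by
    calc v U ≤ v (⋃ j, {x | x ∈ S ∧ ∃ k, n ≤ k ∧ K * c j < E.av v k (H j) x}) := by
          apply measure_mono
          intro x hx
          simp only [hU, Set.mem_iUnion] at hx
          obtain ⟨k, hk, hxD⟩ := hx
          obtain ⟨h1, h2, j, hj⟩ := hxD.2.1
          exact Set.mem_iUnion.2 ⟨j, hxD.1, k, h1.le, hj⟩
      _ ≤ ∑ j, v {x | x ∈ S ∧ ∃ k, n ≤ k ∧ K * c j < E.av v k (H j) x} := measure_iUnion_fintype_le _ _
      _ ≤ ∑ j : J, v S / K := Finset.sum_le_sum fun j _ =>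
          E.bad_measure v hfin hpos (H j) K one_le_bK bK_ne_top n x0
      _ = (Fintype.card J : ℝ≥0∞) * (v S / K) := by simp
      _ ≤ ((Fintype.card J : ℝ≥0∞) + 1) * (v S / K) := by gcongr; exact le_self_add
      _ = v S / 2 := by
          rw [hK, bK]
          have h0 : ((Fintype.card J : ℝ≥0∞) + 1) ≠ 0 := by simp
          have h1 : ((Fintype.card J : ℝ≥0∞) + 1) ≠ ∞ := by simp
          rw [div_eq_mul_inv, div_eq_mul_inv, ENNReal.mul_inv (by simp) (by simp),
            mul_comm (2:ℝ≥0∞)⁻¹, ← mul_assoc, ← mul_assoc, mul_right_comm, mul_right_comm,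
            mul_right_comm (_ + 1) (v S), ENNReal.mul_inv_cancel h0 h1]
          ring
  have hSU : v S ≤ 2 * v (S \ U) := by
    have h1 : v S ≤ v U + v (S \ U) := by
      conv_lhs => rw [← Set.union_sdiff_cancel hUS]
      exact measure_union_le _ _
    have h3 : v S / 2 + v S / 2 ≤ v S / 2 + v (S \ U) := by
      rw [ENNReal.add_halves]; exact h1.trans (by gcongr)
    have h4 : v S / 2 ≤ v (S \ U) := by
      rwa [ENNReal.add_le_add_iff_left (ENNReal.div_ne_top (hfin n x0) (by simp))] at h3
    calc v S = 2 * (v S / 2) := by rw [ENNReal.mul_div_cancel (by simp) (by simp)]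
      _ ≤ _ := by gcongr
  -- measurability
  have hfm : ∀ k, Measurable (fun z : X × Ω => rs k N (f z.1 z.2)) := fun k =>
    measurable_rs k N _ fun l => E.measurable_PR_joint v a h hh l
  have hmxm : Measurable (fun z : X × Ω => ∏ j, E.mx v (fun y => g j y z.2) z.1 ^ a j) :=
    Finset.measurable_prod _ fun j _ => (E.measurable_mx_joint v (g j) (hgm j)).pow_const _
  have hfx : ∀ k x, Measurable (fun ω => rs k N (f x ω)) := by
    intro k x
    have := meas_sec (hfm k) x
    exact this
  have hfI : ∀ k, Measurable (fun x => ∫⁻ ω, rs k N (f x ω) ∂μ) := fun k =>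
    Measurable.lintegral_prod_right' (f := fun z : X × Ω => rs k N (f z.1 z.2)) (hfm k)
  have hmxI : Measurable (fun x => ∫⁻ ω, ∏ j, E.mx v (fun y => g j y ω) x ^ a j ∂μ) :=
    Measurable.lintegral_prod_right' (f := fun z : X × Ω => ∏ j, E.mx v (fun y => g j y z.2) z.1 ^ a j) hmxm
  have hSm : MeasurableSet S := E.meas_cell n x0
  -- conclusion
  have hmain := E.main_part v hfin hpos μ A a ha θ hθ hsum n x0 g hgm c hgc
  have hPRn : ∏ j, c j ^ a j = G x0 n := rfl
  calc ∫⁻ x in S, ∫⁻ ω, rs n N (f x ω) ∂μ ∂v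
      ≤ ∫⁻ x in S, ((∫⁻ ω, ∏ j, E.mx v (fun y => g j y ω) x ^ a j ∂μ) +
          ∑ k ∈ Finset.Ioc n N, (D k).indicator (fun x => ∫⁻ ω, rs k N (f x ω) ∂μ) x) ∂v := by
        apply setLIntegral_mono' hSm
        intro x hx
        calc ∫⁻ ω, rs n N (f x ω) ∂μ ≤ ∫⁻ ω, ((∏ j, E.mx v (fun y => g j y ω) x ^ a j) +
              ∑ k ∈ Finset.Ioc n N, (D k).indicator (fun x => rs k N (f x ω)) x) ∂μ :=
              lintegral_mono fun ω => hsplit x hx ω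
          _ = (∫⁻ ω, ∏ j, E.mx v (fun y => g j y ω) x ^ a j ∂μ) + ∫⁻ ω,
              ∑ k ∈ Finset.Ioc n N, (D k).indicator (fun x => rs k N (f x ω)) x ∂μ :=
              lintegral_add_left (by have := meas_sec hmxm x; exact this) _
          _ = _ := by
              congr 1
              have hind : ∀ k ω, (D k).indicator (fun x => rs k N (f x ω)) x =
                  (D k).indicator (fun _ => (1:ℝ≥0∞)) x * rs k N (f x ω) := by
                intro k ω
                by_cases hxD : x ∈ D k <;> simp [hxD]
              rw [lintegral_finsetSum]
              · apply Finset.sum_congr rfl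
                intro k _
                by_cases hxD : x ∈ D k <;> simp [hxD]
              · intro k _
                simp_rw [hind]
                exact (hfx k x).const_mul _
    _ = (∫⁻ x in S, ∫⁻ ω, ∏ j, E.mx v (fun y => g j y ω) x ^ a j ∂μ ∂v) +
          ∑ k ∈ Finset.Ioc n N, ∫⁻ x in S, (D k).indicator (fun x => ∫⁻ ω, rs k N (f x ω) ∂μ) x ∂v := by
        rw [lintegral_add_left hmxI, lintegral_finsetSum]
        intro k hk
        exact (hfI k).indicator (hDmeas k hk)
    _ ≤ C0 * (v S * G x0 n) + ∑ k ∈ Finset.Ioc n N, ∫⁻ x in D k, 2 * C0 * rs n N (G x) ∂v := by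
        refine add_le_add ?_ (Finset.sum_le_sum fun k hk => ?_)
        · exact (setLIntegral_le_lintegral _ _).trans hmain
        · have hk' := Finset.mem_Ioc.1 hk
          calc ∫⁻ x in S, (D k).indicator (fun x => ∫⁻ ω, rs k N (f x ω) ∂μ) x ∂v
              ≤ ∫⁻ x, (D k).indicator (fun x => ∫⁻ ω, rs k N (f x ω) ∂μ) x ∂v :=
                setLIntegral_le_lintegral _ _
            _ = ∫⁻ x in D k, ∫⁻ ω, rs k N (f x ω) ∂μ ∂v := lintegral_indicator (hDmeas k hk) _
            _ ≤ ∫⁻ x in D k, 2 * C0 * rs k N (G x) ∂v := by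
                apply (hDsat k hk'.1.le).lintegral_le
                intro x _
                exact IH (N - k).toNat (by omega) k (by omega) x
            _ ≤ ∫⁻ x in D k, 2 * C0 * rs n N (G x) ∂v := by
                gcongr with x
                exact rs_anti hk'.1.le _
    _ = C0 * (v S * G x0 n) + ∫⁻ x in U, 2 * C0 * rs n N (G x) ∂v := by
        rw [hU, lintegral_biUnion_finset hDdisj hDmeas]
    _ ≤ ∫⁻ x in S \ U, 2 * C0 * rs n N (G x) ∂v + ∫⁻ x in U, 2 * C0 * rs n N (G x) ∂v := by
        gcongr
        calc C0 * (v S * G x0 n) ≤ C0 * ((2 * v (S \ U)) * G x0 n) := by gcongr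
          _ = ∫⁻ x in S \ U, 2 * C0 * G x0 n ∂v := by rw [setLIntegral_const]; ring
          _ ≤ _ := by
              apply setLIntegral_mono' (hSm.diff hUm)
              intro x hx
              gcongr
              refine le_trans (le_of_eq ?_) (le_rs le_rfl hnN' (G x))
              exact (E.PR_eq v a H hx.1).symm
    _ = ∫⁻ x in S, 2 * C0 * rs n N (G x) ∂v := by
        rw [add_comm, ← lintegral_union (hSm.diff hUm) Set.disjoint_sdiff_right,
          Set.union_sdiff_cancel hUS]

/-- Part B. -/
theorem vec_to_scalar (v : Measure X) [SFinite v] (hfin : ∀ n x, v (E.cell n x) ≠ ∞)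
    (hpos : ∀ n x, v (E.cell n x) ≠ 0)
    (μ : Measure Ω) [SigmaFinite μ] (A : ℝ≥0∞) (hA1 : 1 ≤ A)
    (hA : ∀ n x, v (E.cell n x) ≤ A * v (E.cell (n + 1) x))
    (a : J → ℝ) (ha : ∀ j, 0 < a j) (θ : J → ℝ≥0∞) (hθ : ∀ j, 1 < θ j)
    (hsum : ∑ j, ENNReal.ofReal (a j) * (θ j)⁻¹ = 1)
    (h : J → X → Ω → ℝ≥0∞) (hh : ∀ j, Measurable (Function.uncurry (h j))) :
      ∫⁻ x, ∫⁻ ω, ⨆ k : ℤ, E.PR v a (fun j y => h j y ω) k x ∂μ ∂v ≤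
      2 * bC A a θ * ∫⁻ x, ⨆ k : ℤ, E.PR v a (fun j y => eNorm (θ j) μ (h j y)) k x ∂v := by
  have hstep : ∀ b : ℕ, ∫⁻ x, ∫⁻ ω, rs (-b) b (fun k => E.PR v a (fun j y => h j y ω) k x) ∂μ ∂v ≤
      2 * bC A a θ * ∫⁻ x, ⨆ k : ℤ, E.PR v a (fun j y => eNorm (θ j) μ (h j y)) k x ∂v := by
    intro b
    have hsat : E.Sat (-b) (Set.univ : Set X) := fun _ _ => Set.subset_univ _
    have h1 := hsat.lintegral_le v v
      (fun x => ∫⁻ ω, rs (-b) b (fun k => E.PR v a (fun j y => h j y ω) k x) ∂μ)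
      (fun x => 2 * bC A a θ * rs (-b) b (fun k => E.PR v a (fun j y => eNorm (θ j) μ (h j y)) k x))
      (fun x _ => E.stop_ind v hfin hpos μ A hA1 hA a ha θ hθ hsum h hh b (2 * b) (-b) (by push_cast; ring) x)
    rw [setLIntegral_univ, setLIntegral_univ] at h1
    refine h1.trans ?_
    rw [lintegral_const_mul]
    · gcongr with x
      exact iSup₂_le fun k _ => le_iSup (fun k => E.PR v a (fun j y => eNorm (θ j) μ (h j y)) k x) k
    · exact measurable_rs _ _ _ fun k => E.measurable_PR v a _ k
  have hsup : ∀ φ : ℤ → ℝ≥0∞, ⨆ k, φ k = ⨆ b : ℕ, rs (-b) b φ := by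
    intro φ
    apply le_antisymm
    · apply iSup_le
      intro k
      refine le_trans ?_ (le_iSup _ k.natAbs)
      exact le_rs (by omega) (by omega) φ
    · exact iSup_le fun b => iSup₂_le fun k _ => le_iSup φ k
  have hmono : ∀ φ : ℤ → ℝ≥0∞, Monotone (fun b : ℕ => rs (-b) b φ) := by
    intro φ b b' hb
    refine iSup₂_le fun k hk => le_rs (by omega) (by omega) φ
  have hjm : ∀ b : ℕ, Measurable (fun z : X × Ω =>
      rs (-b) b (fun k => E.PR v a (fun j y => h j y z.2) k z.1)) := fun b =>
    measurable_rs _ _ _ fun k => E.measurable_PR_joint v a h hh k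
  have h1 : ∀ x, ∫⁻ ω, ⨆ k : ℤ, E.PR v a (fun j y => h j y ω) k x ∂μ =
      ⨆ b : ℕ, ∫⁻ ω, rs (-b) b (fun k => E.PR v a (fun j y => h j y ω) k x) ∂μ := by
    intro x
    simp_rw [hsup]
    apply lintegral_iSup
    · intro b
      have := meas_sec (hjm b) x
      exact this
    · intro b b' hb ω; exact hmono _ hb
  simp_rw [h1]
  rw [lintegral_iSup]
  · exact iSup_le hstep
  · intro b
    exact Measurable.lintegral_prod_right' (f := fun z : X × Ω =>
      rs (-b) b (fun k => E.PR v a (fun j y => h j y z.2) k z.1)) (hjm b)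
  · intro b b' hb x
    exact lintegral_mono fun ω => hmono _ hb

lemma bC_ne_top {A : ℝ≥0∞} (hA : A ≠ ∞) (a : J → ℝ) (ha : ∀ j, 0 < a j) (θ : J → ℝ≥0∞)
    (hθ : ∀ j, 1 < θ j) : bC A a θ ≠ ∞ := by
  unfold bC
  apply ENNReal.prod_ne_top
  intro j _
  exact ENNReal.rpow_ne_top_of_nonneg (ha j).le
    (ENNReal.mul_ne_top (doobE_ne_top (hθ j)) (ENNReal.mul_ne_top hA bK_ne_top))

end Fil

namespace Fil
variable {X ι : Type} [MeasurableSpace X] [MeasurableSpace ι]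
variable (E : Fil X ι) [Countable ι] [MeasurableSingletonClass ι]
variable {J : Type} [Fintype J]

lemma lintegral_prod_pow_le' {Y : Type*} [MeasurableSpace Y] (μ : Measure Y) [IsProbabilityMeasure μ]
    (f : J → Y → ℝ≥0∞) (hf : ∀ j, Measurable (f j)) (δ : J → ℝ) (hδ : ∀ j, 0 ≤ δ j)
    (hΛ : 0 < ∑ j, δ j) (h1 : ∀ y, ∏ j, f j y ^ δ j = 1) :
    1 ≤ ∏ j, (∫⁻ y, f j y ∂μ) ^ δ j := by
  set Λ := ∑ j, δ j with hΛd
  have h2 : ∀ y, ∏ j, f j y ^ (δ j / Λ) = 1 := by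
    intro y
    have : ∏ j, f j y ^ (δ j / Λ) = (∏ j, f j y ^ δ j) ^ (1 / Λ) := by
      rw [← ENNReal.prod_rpow_of_nonneg (by positivity)]
      apply Finset.prod_congr rfl
      intro j _
      rw [← ENNReal.rpow_mul, mul_one_div]
    rw [this, h1, ENNReal.one_rpow]
  have h3 := ENNReal.lintegral_prod_norm_pow_le (μ := μ) Finset.univ (f := f) (p := fun j => δ j / Λ)
    (fun j _ => (hf j).aemeasurable) (by rw [← Finset.sum_div, ← hΛd, div_self hΛ.ne'])
    (fun j _ => div_nonneg (hδ j) hΛ.le)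
  simp only [h2, lintegral_const, measure_univ, mul_one] at h3
  have h4 := ENNReal.rpow_le_rpow h3 hΛ.le
  rw [ENNReal.one_rpow, ← ENNReal.prod_rpow_of_nonneg hΛ.le] at h4
  refine h4.trans (le_of_eq ?_)
  apply Finset.prod_congr rfl
  intro j _
  rw [← ENNReal.rpow_mul, div_mul_cancel₀ _ hΛ.ne']

/-- Lemma H -/
lemma lemH (v : Measure X) (hfin : ∀ n x, v (E.cell n x) ≠ ∞)
    (hpos : ∀ n x, v (E.cell n x) ≠ 0) (a c : J → ℝ) (ha : ∀ j, 0 ≤ a j)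
    (γ : ℝ) (hγ0 : 0 ≤ γ) (hγ : ∀ j, a j ≤ γ * c j) (σ : J → X → ℝ≥0∞) (hσ : ∀ j, Measurable (σ j))
    (W : ℝ≥0∞) (n : ℤ) (x : X) (hW : ∏ j, E.av v n (σ j) x ^ c j ≤ W)
    (Z : X → ℝ≥0∞) (hZ : Measurable Z) (lam : ℝ) (hlam : 0 < lam)
    (hone : ∀ y, Z y ^ lam * ∏ j, σ j y ^ (γ * c j - a j) = 1) :
    ∏ j, E.av v n (σ j) x ^ a j ≤ W ^ γ * E.av v n Z x ^ lam := by
  have hδ : ∀ j, 0 ≤ γ * c j - a j := fun j => sub_nonneg.2 (hγ j)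
  set S := E.cell n x
  let P : Measure X := (v S)⁻¹ • v.restrict S
  have : IsProbabilityMeasure P := ⟨by
    simp only [P, Measure.smul_apply, Measure.restrict_apply_univ, smul_eq_mul]
    exact ENNReal.inv_mul_cancel (hpos n x) (hfin n x)⟩
  have hav : ∀ f : X → ℝ≥0∞, ∫⁻ y, f y ∂P = E.av v n f x := by
    intro f
    simp only [P, lintegral_smul_measure, smul_eq_mul]
    unfold av
    rw [div_eq_mul_inv, mul_comm]
  let f : Option J → X → ℝ≥0∞ := fun o => o.elim Z σ
  let dl : Option J → ℝ := fun o => o.elim lam (fun j => γ * c j - a j)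
  have key := lintegral_prod_pow_le' P f (by rintro (_ | j); exacts [hZ, hσ j]) dl
    (by rintro (_ | j); exacts [hlam.le, hδ j])
    (by
      rw [Fintype.sum_option]
      exact add_pos_of_pos_of_nonneg hlam (Finset.sum_nonneg fun j _ => hδ j))
    (by intro y; rw [Fintype.prod_option]; exact hone y)
  rw [Fintype.prod_option] at key
  simp only [hav] at key
  change 1 ≤ E.av v n Z x ^ lam * ∏ j, E.av v n (σ j) x ^ (γ * c j - a j) at key
  calc ∏ j, E.av v n (σ j) x ^ a j
      ≤ (∏ j, E.av v n (σ j) x ^ a j) *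
          (E.av v n Z x ^ lam * ∏ j, E.av v n (σ j) x ^ (γ * c j - a j)) :=
        le_mul_of_one_le_right' key
    _ = (∏ j, E.av v n (σ j) x ^ (γ * c j)) * E.av v n Z x ^ lam := by
        have : ∀ j, E.av v n (σ j) x ^ (γ * c j) =
            E.av v n (σ j) x ^ a j * E.av v n (σ j) x ^ (γ * c j - a j) := by
          intro j
          rw [← ENNReal.rpow_add_of_nonneg _ _ (ha j) (hδ j)]
          congr 1; ring
        simp_rw [this, Finset.prod_mul_distrib]
        ring
    _ = (∏ j, E.av v n (σ j) x ^ c j) ^ γ * E.av v n Z x ^ lam := by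
        rw [← ENNReal.prod_rpow_of_nonneg hγ0]
        congr 1
        apply Finset.prod_congr rfl
        intro j _
        rw [← ENNReal.rpow_mul, mul_comm]
    _ ≤ _ := by gcongr

lemma av_pos (v : Measure X) (hfin : ∀ n x, v (E.cell n x) ≠ ∞)
    (hpos : ∀ n x, v (E.cell n x) ≠ 0) (σ : X → ℝ≥0∞) (hσ : Measurable σ)
    (h0 : ∀ x, σ x ≠ 0) (n : ℤ) (x : X) : E.av v n σ x ≠ 0 := by
  unfold av
  rw [Ne, ENNReal.div_eq_zero_iff, not_or]
  refine ⟨?_, hfin n x⟩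
  rw [lintegral_eq_zero_iff hσ]
  intro h
  have : v.restrict (E.cell n x) Set.univ = 0 := by
    rw [Filter.EventuallyEq, ae_iff] at h
    rw [← h]
    congr 1
    ext y; simp [h0 y]
  rw [Measure.restrict_apply_univ] at this
  exact hpos n x this

lemma av_ne_top (v : Measure X) (hfin : ∀ n x, v (E.cell n x) ≠ ∞)
    (hpos : ∀ n x, v (E.cell n x) ≠ 0) (σ : J → X → ℝ≥0∞) (hσ : ∀ j, Measurable (σ j))
    (h0 : ∀ j x, σ j x ≠ 0) (c : J → ℝ) (hc : ∀ j, 0 < c j) (n : ℤ) (x : X)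
    (hW : ∏ j, E.av v n (σ j) x ^ c j ≠ ∞) (j : J) : E.av v n (σ j) x ≠ ∞ := by
  classical
  intro htop
  apply hW
  rw [← Finset.mul_prod_erase Finset.univ _ (Finset.mem_univ j), htop, ENNReal.top_rpow_of_pos (hc j)]
  apply ENNReal.top_mul
  rw [Finset.prod_ne_zero_iff]
  intro i _
  simp only [ne_eq, ENNReal.rpow_eq_zero_iff, not_or, not_and]
  exact ⟨fun h => absurd h (E.av_pos v hfin hpos (σ i) (hσ i) (h0 i) n x), fun _ => not_lt.2 (hc i).le⟩

lemma av_change (v : Measure X) (hfin : ∀ n x, v (E.cell n x) ≠ ∞)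
    (hpos : ∀ n x, v (E.cell n x) ≠ 0) (σ : X → ℝ≥0∞) (hσ : Measurable σ)
    (h0 : ∀ x, σ x ≠ 0) (h1 : ∀ x, σ x ≠ ∞) (n : ℤ) (x : X) (hs : E.av v n σ x ≠ ∞)
    (h : X → ℝ≥0∞) (hh : Measurable h) :
    E.av v n h x = E.av (v.withDensity σ) n (fun y => h y / σ y) x * E.av v n σ x := by
  have hp := E.av_pos v hfin hpos σ hσ h0 n x
  unfold av at hs hp ⊢
  have hm : Measurable (fun y => h y / σ y) := hh.div hσ
  rw [withDensity_apply _ (E.meas_cell n x),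
    setLIntegral_withDensity_eq_setLIntegral_mul v hσ hm (E.meas_cell n x)]
  have : ∀ y, (σ * fun y => h y / σ y) y = h y := by
    intro y
    rw [Pi.mul_apply, ENNReal.mul_div_cancel (h0 y) (h1 y)]
  simp only [this]
  set I := ∫⁻ y in E.cell n x, h y ∂v
  set S := ∫⁻ y in E.cell n x, σ y ∂v
  have hS0 : S ≠ 0 := by intro h; rw [h] at hp; simp at hp
  have hS1 : S ≠ ∞ := by
    intro h; rw [h] at hs
    exact hs (ENNReal.top_div_of_ne_top (hfin n x))
  rw [← mul_div_assoc, ENNReal.div_mul_cancel hS0 hS1]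

lemma withDensity_cell_ne_top (v : Measure X) (hfin : ∀ n x, v (E.cell n x) ≠ ∞) (σ : X → ℝ≥0∞)
    (n : ℤ) (x : X) (hs : E.av v n σ x ≠ ∞) : v.withDensity σ (E.cell n x) ≠ ∞ := by
  rw [withDensity_apply _ (E.meas_cell n x)]
  intro h
  apply hs
  unfold av
  rw [h, ENNReal.top_div_of_ne_top (hfin n x)]

/-- Hölder piece -/
lemma eNorm_piece (v : Measure X) (σ : X → ℝ≥0∞) (hσ : Measurable σ) (h0 : ∀ x, σ x ≠ 0)
    (D : X → ℝ≥0∞) (hD : Measurable D) (a b q : ℝ) (ha : 0 < a) (hb : 0 ≤ b) (hq : 0 < q) (θ : ℝ≥0∞)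
    (hθ0 : θ ≠ 0) (hθ : ENNReal.ofReal b = ENNReal.ofReal a * θ⁻¹) :
    eNorm (ENNReal.ofReal (b * q))⁻¹ v (fun x => D x ^ (a * q) * σ x ^ (b * q)) ≤
      eNorm θ (v.withDensity σ) D ^ (a * q) := by
  rcases hb.eq_or_lt with rfl | hb
  · have : θ = ∞ := by
      simp only [ENNReal.ofReal_zero] at hθ
      have := (mul_eq_zero.1 hθ.symm).resolve_left (by simpa using ha)
      simpa using this
    subst this
    simp only [zero_mul, ENNReal.ofReal_zero, ENNReal.inv_zero, ENNReal.rpow_zero, mul_one, eNorm_top]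
    refine essSup_le_of_ae_le _ ?_
    have h1 := ENNReal.ae_le_essSup (μ := v.withDensity σ) D
    have hac : v ≪ v.withDensity σ := withDensity_absolutelyContinuous' hσ.aemeasurable (ae_of_all _ h0)
    filter_upwards [hac.ae_le h1] with x hx
    exact ENNReal.rpow_le_rpow hx (by positivity)
  · have hθtop : θ ≠ ∞ := by
      rintro rfl
      simp at hθ; linarith
    have hθr : b = a / θ.toReal := by
      have := congrArg ENNReal.toReal hθ
      rw [ENNReal.toReal_ofReal hb.le, ENNReal.toReal_mul, ENNReal.toReal_ofReal ha.le, ENNReal.toReal_inv] at this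
      rw [this, div_eq_mul_inv]
    have hθp : 0 < θ.toReal := ENNReal.toReal_pos hθ0 hθtop
    have hbq : 0 < b * q := by positivity
    rw [eNorm_of_ne_top (by simpa using hbq), eNorm_of_ne_top hθtop]
    rw [ENNReal.toReal_inv, ENNReal.toReal_ofReal hbq.le,
      lintegral_withDensity_eq_lintegral_mul v hσ (hD.pow_const _), ← ENNReal.rpow_mul]
    apply le_of_eq
    have e1 : 1 / (b * q)⁻¹ = 1 / θ.toReal * (a * q) := by rw [hθr]; field_simp
    rw [e1]
    congr 1
    apply lintegral_congr
    intro x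
    rw [ENNReal.mul_rpow_of_nonneg _ _ (by positivity), ← ENNReal.rpow_mul, ← ENNReal.rpow_mul,
      mul_inv_cancel₀ hbq.ne', ENNReal.rpow_one, Pi.mul_apply, mul_comm]
    congr 2
    rw [hθr]; field_simp

lemma Ymain (v : Measure X) (a b : J → ℝ) (ha : ∀ j, 0 < a j) (hb : ∀ j, 0 ≤ b j) (q : ℝ) (hq : 0 < q)
    (hbq : ∑ j, b j = 1 / q)
    (θ : J → ℝ≥0∞) (hθ1 : ∀ j, 1 < θ j) (hθ : ∀ j, ENNReal.ofReal (b j) = ENNReal.ofReal (a j) * (θ j)⁻¹)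
    (σ : J → X → ℝ≥0∞) (hσ : ∀ j, Measurable (σ j)) (h0 : ∀ j x, σ j x ≠ 0)
    (hcell : ∀ j n x, v.withDensity (σ j) (E.cell n x) ≠ ∞)
    (g : J → X → ℝ≥0∞) (hg : ∀ j, Measurable (g j)) :
    ∫⁻ x, ∏ j, (E.mx (v.withDensity (σ j)) (g j) x ^ (a j * q) * σ j x ^ (b j * q)) ∂v ≤
      (∏ j, doobE (θ j) ^ (a j * q)) * ∏ j, eNorm (θ j) (v.withDensity (σ j)) (g j) ^ (a j * q) := by
  have hmx : ∀ j, Measurable (E.mx (v.withDensity (σ j)) (g j)) := fun j => E.measurable_mx _ _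
  refine (holder_eNorm v (fun j => (ENNReal.ofReal (b j * q))⁻¹) ?_ _
    (fun j => (((hmx j).pow_const _).mul ((hσ j).pow_const _)).aemeasurable)).trans ?_
  · simp only [inv_inv]
    rw [← ENNReal.ofReal_sum_of_nonneg (fun j _ => mul_nonneg (hb j) hq.le), ← Finset.sum_mul, hbq,
      one_div_mul_cancel hq.ne', ENNReal.ofReal_one]
  · rw [← Finset.prod_mul_distrib]
    apply Finset.prod_le_prod'
    intro j _
    refine (eNorm_piece v (σ j) (hσ j) (h0 j) _ (hmx j) (a j) (b j) q (ha j) (hb j) hq (θ j)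
      (lt_trans one_pos (hθ1 j)).ne' (hθ j)).trans ?_
    have : 0 ≤ a j * q := (mul_pos (ha j) hq).le
    rw [← ENNReal.mul_rpow_of_nonneg _ _ this]
    apply ENNReal.rpow_le_rpow _ this
    exact E.doob_eNorm _ (hcell j) (g j) (hg j) (hθ1 j)

end Fil

namespace Fil
variable {X ι : Type} [MeasurableSpace X] [MeasurableSpace ι]
variable (E : Fil X ι) [Countable ι] [MeasurableSingletonClass ι]
variable {J : Type} [Fintype J]

lemma pull (v : Measure X) (hfin : ∀ n x, v (E.cell n x) ≠ ∞)
    (n : ℤ) (x : X) (κ : ℝ≥0∞) (k : X → ℝ≥0∞) (hk : ∀ y ∈ E.cell n x, κ ≤ k y)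
    (Z : X → ℝ≥0∞) (τ : X → ℝ≥0∞) (hZ : Measurable Z) (hτ : Measurable τ) (ε : ℝ) (hε : 0 < ε) :
    κ * (E.av v n (fun y => Z y ^ ε * τ y) x) ^ (1 / ε) ≤
      (E.av v n (fun y => (k y * Z y) ^ ε * τ y) x) ^ (1 / ε) := by
  have e : κ = (κ ^ ε) ^ (1 / ε) := by
    rw [← ENNReal.rpow_mul, mul_one_div_cancel hε.ne', ENNReal.rpow_one]
  conv_lhs => rw [e]
  rw [← ENNReal.mul_rpow_of_nonneg _ _ (by positivity)]
  apply ENNReal.rpow_le_rpow _ (by positivity)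
  unfold av
  have hm : Measurable (fun y => Z y ^ ε * τ y) := (hZ.pow_const _).mul hτ
  rw [← mul_div_assoc, ← lintegral_const_mul _ hm]
  gcongr 1
  apply setLIntegral_mono' (E.meas_cell n x)
  intro y hy
  rw [← mul_assoc, ← ENNReal.mul_rpow_of_nonneg _ _ hε.le]
  gcongr
  exact hk y hy

/-- κ -/
def kap (v : Measure X) (a : J → ℝ) (σ h : J → X → ℝ≥0∞) (n : ℤ) (x : X) : ℝ≥0∞ :=
  ∏ j, E.av (v.withDensity (σ j)) n (fun z => h j z / σ j z) x ^ a j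

def kD (v : Measure X) (a : J → ℝ) (σ h : J → X → ℝ≥0∞) (y : X) : ℝ≥0∞ :=
  ∏ j, E.mx (v.withDensity (σ j)) (fun z => h j z / σ j z) y ^ a j

lemma kap_le (v : Measure X) (a : J → ℝ) (ha : ∀ j, 0 < a j) (σ h : J → X → ℝ≥0∞) (n : ℤ) (x y : X)
    (hy : y ∈ E.cell n x) : E.kap v a σ h n x ≤ E.kD v a σ h y := by
  apply Finset.prod_le_prod'
  intro j _
  apply ENNReal.rpow_le_rpow _ (ha j).le
  rw [← E.av_eq _ _ hy]
  exact le_iSup (fun n => E.av (v.withDensity (σ j)) n (fun z => h j z / σ j z) y) n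

lemma measurable_kD (v : Measure X) (a : J → ℝ) (σ h : J → X → ℝ≥0∞) : Measurable (E.kD v a σ h) :=
  Finset.measurable_prod _ fun _ _ => (E.measurable_mx _ _).pow_const _

lemma PR_kap (v : Measure X) (hfin : ∀ n x, v (E.cell n x) ≠ ∞)
    (hpos : ∀ n x, v (E.cell n x) ≠ 0) (a : J → ℝ) (ha : ∀ j, 0 < a j)
    (σ : J → X → ℝ≥0∞) (hσ : ∀ j, Measurable (σ j)) (h0 : ∀ j x, σ j x ≠ 0)
    (h1 : ∀ j x, σ j x ≠ ∞) (hs : ∀ j n x, E.av v n (σ j) x ≠ ∞)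
    (h : J → X → ℝ≥0∞) (hh : ∀ j, Measurable (h j)) (n : ℤ) (x : X) :
    E.PR v a h n x = E.kap v a σ h n x * ∏ j, E.av v n (σ j) x ^ a j := by
  unfold kap PR
  rw [← Finset.prod_mul_distrib]
  apply Finset.prod_congr rfl
  intro j _
  rw [← ENNReal.mul_rpow_of_nonneg _ _ (ha j).le,
    E.av_change v hfin hpos (σ j) (hσ j) (h0 j) (h1 j) n x (hs j n x) (h j) (hh j)]

def cD (a : J → ℝ) (q : ℝ) (θ : J → ℝ≥0∞) : ℝ≥0∞ := ∏ j, doobE (θ j) ^ (a j * q)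

lemma cD_ne_top (a : J → ℝ) (ha : ∀ j, 0 < a j) (q : ℝ) (hq : 0 < q) (θ : J → ℝ≥0∞)
    (hθ : ∀ j, 1 < θ j) : cD a q θ ≠ ∞ :=
  ENNReal.prod_ne_top fun j _ => ENNReal.rpow_ne_top_of_nonneg (mul_pos (ha j) hq).le
    (doobE_ne_top (hθ j))

theorem weighted (v : Measure X) (hfin : ∀ n x, v (E.cell n x) ≠ ∞)
    (hpos : ∀ n x, v (E.cell n x) ≠ 0) (a b c : J → ℝ) (ha : ∀ j, 0 < a j) (hb : ∀ j, 0 ≤ b j)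
    (hc : ∀ j, 0 < c j) (habc : ∀ j, a j = b j + c j) (q : ℝ) (hq : 0 < q) (hbq : ∑ j, b j = 1 / q)
    (γ : ℝ) (hγ0 : 0 ≤ γ) (hγ : ∀ j, a j ≤ γ * c j)
    (θ : J → ℝ≥0∞) (hθ1 : ∀ j, 1 < θ j) (hθ : ∀ j, ENNReal.ofReal (b j) = ENNReal.ofReal (a j) * (θ j)⁻¹)
    (σ : J → X → ℝ≥0∞) (hσ : ∀ j, Measurable (σ j)) (h0 : ∀ j x, σ j x ≠ 0)
    (h1 : ∀ j x, σ j x ≠ ∞) (hone : ∀ x, ∏ j, σ j x ^ c j = 1)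
    (W : ℝ≥0∞) (hWtop : W ≠ ∞) (hW : ∀ n x, ∏ j, E.av v n (σ j) x ^ c j ≤ W)
    (h : J → X → ℝ≥0∞) (hh : ∀ j, Measurable (h j)) :
    ∫⁻ x, (⨆ n : ℤ, E.PR v a h n x) ^ q ∂v ≤ doobC 2 * cD a q θ * (W ^ (γ * q) *
      ∏ j, eNorm (θ j) (v.withDensity (σ j)) (fun z => h j z / σ j z) ^ (a j * q)) := by
  have hs : ∀ j n x, E.av v n (σ j) x ≠ ∞ := fun j n x =>
    E.av_ne_top v hfin hpos σ hσ h0 c hc n x (ne_top_of_le_ne_top hWtop (hW n x)) j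
  have hcell : ∀ j n x, v.withDensity (σ j) (E.cell n x) ≠ ∞ := fun j n x =>
    E.withDensity_cell_ne_top v hfin (σ j) n x (hs j n x)
  set ε := q / 2 with hεd
  have hε : 0 < ε := by positivity
  let Z : X → ℝ≥0∞ := fun y => ∏ j, σ j y ^ b j
  have hZm : Measurable Z := Finset.measurable_prod _ fun j _ => (hσ j).pow_const _
  have hkDm := E.measurable_kD v a σ h
  let Y : X → ℝ≥0∞ := fun y => E.kD v a σ h y * Z y
  have hYm : Measurable Y := hkDm.mul hZm
  have hpt : ∀ n x, E.PR v a h n x ≤ W ^ γ * (E.av v n (fun y => Y y ^ ε) x) ^ (1 / ε) := by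
    intro n x
    rw [E.PR_kap v hfin hpos a ha σ hσ h0 h1 hs h hh n x]
    have hH := E.lemH v hfin hpos a c (fun j => (ha j).le) γ hγ0 hγ σ hσ W n x (hW n x)
      (fun y => Z y ^ ε) (hZm.pow_const _) (1 / ε) (by positivity) (by
        intro y
        rw [← ENNReal.rpow_mul, mul_one_div_cancel hε.ne', ENNReal.rpow_one, ← Finset.prod_mul_distrib]
        have : ∀ j, σ j y ^ b j * σ j y ^ (γ * c j - a j) = (σ j y ^ c j) ^ (γ - 1) := by
          intro j
          rw [← ENNReal.rpow_add _ _ (h0 j y) (h1 j y), ← ENNReal.rpow_mul]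
          congr 1
          rw [habc j]; ring
        simp_rw [this]
        rw [ENNReal.prod_rpow_of_ne_top, hone, ENNReal.one_rpow]
        intro j _
        exact ENNReal.rpow_ne_top_of_nonneg (hc j).le (h1 j y))
    have hp := E.pull v hfin n x (E.kap v a σ h n x) (E.kD v a σ h)
      (fun y hy => E.kap_le v a ha σ h n x y hy) Z (fun _ => 1) hZm measurable_const ε hε
    simp only [mul_one] at hp
    calc E.kap v a σ h n x * ∏ j, E.av v n (σ j) x ^ a j
        ≤ E.kap v a σ h n x * (W ^ γ * E.av v n (fun y => Z y ^ ε) x ^ (1 / ε)) := by gcongr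
      _ = W ^ γ * (E.kap v a σ h n x * E.av v n (fun y => Z y ^ ε) x ^ (1 / ε)) := by ring
      _ ≤ _ := by gcongr
  have hpt2 : ∀ x, (⨆ n : ℤ, E.PR v a h n x) ^ q ≤ W ^ (γ * q) * E.mx v (fun y => Y y ^ ε) x ^ (2:ℝ) := by
    intro x
    have h2 : (⨆ n : ℤ, E.PR v a h n x) ≤ W ^ γ * E.mx v (fun y => Y y ^ ε) x ^ (1 / ε) := by
      apply iSup_le
      intro n
      refine (hpt n x).trans ?_
      gcongr
      exact le_iSup (fun n => E.av v n (fun y => Y y ^ ε) x) n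
    refine (ENNReal.rpow_le_rpow h2 hq.le).trans (le_of_eq ?_)
    rw [ENNReal.mul_rpow_of_nonneg _ _ hq.le, ← ENNReal.rpow_mul, ← ENNReal.rpow_mul]
    congr 2
    rw [hεd]; field_simp
  calc ∫⁻ x, (⨆ n : ℤ, E.PR v a h n x) ^ q ∂v
      ≤ ∫⁻ x, W ^ (γ * q) * E.mx v (fun y => Y y ^ ε) x ^ (2:ℝ) ∂v := lintegral_mono hpt2
    _ = W ^ (γ * q) * ∫⁻ x, E.mx v (fun y => Y y ^ ε) x ^ (2:ℝ) ∂v :=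
        lintegral_const_mul _ ((E.measurable_mx _ _).pow_const _)
    _ ≤ W ^ (γ * q) * (doobC 2 * ∫⁻ x, (Y x ^ ε) ^ (2:ℝ) ∂v) := by
        gcongr
        exact E.doob v hfin _ (hYm.pow_const _) (by norm_num)
    _ ≤ W ^ (γ * q) * (doobC 2 * (cD a q θ *
          ∏ j, eNorm (θ j) (v.withDensity (σ j)) (fun z => h j z / σ j z) ^ (a j * q))) := by
        gcongr
        refine le_trans (le_of_eq ?_) (E.Ymain v a b ha hb q hq hbq θ hθ1 hθ σ hσ h0 hcell
          (fun j z => h j z / σ j z) (fun j => (hh j).div (hσ j)))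
        apply lintegral_congr
        intro x
        rw [← ENNReal.rpow_mul, show ε * 2 = q by rw [hεd]; ring]
        simp only [Y, Z, kD]
        rw [← Finset.prod_mul_distrib, ← ENNReal.prod_rpow_of_nonneg hq.le]
        apply Finset.prod_congr rfl
        intro j _
        rw [ENNReal.mul_rpow_of_nonneg _ _ hq.le, ← ENNReal.rpow_mul, ← ENNReal.rpow_mul]
    _ = _ := by ring

theorem phi_lemma (v : Measure X) (hfin : ∀ n x, v (E.cell n x) ≠ ∞)
    (hpos : ∀ n x, v (E.cell n x) ≠ 0) (a b c : J → ℝ) (ha : ∀ j, 0 < a j) (hb : ∀ j, 0 ≤ b j)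
    (hc : ∀ j, 0 < c j) (habc : ∀ j, a j = b j + c j) (q : ℝ) (hq : 0 < q) (hbq : ∑ j, b j = 1 / q)
    (c0 S : ℝ) (hc0 : 0 < c0) (hS : 0 ≤ S) (hcS : 1 / q = c0 + S)
    (γ : ℝ) (hγ1 : 1 < γ) (hγ : ∀ j, a j ≤ γ * c j)
    (θ : J → ℝ≥0∞) (hθ1 : ∀ j, 1 < θ j) (hθ : ∀ j, ENNReal.ofReal (b j) = ENNReal.ofReal (a j) * (θ j)⁻¹)
    (σ : J → X → ℝ≥0∞) (hσ : ∀ j, Measurable (σ j)) (h0 : ∀ j x, σ j x ≠ 0)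
    (h1 : ∀ j x, σ j x ≠ ∞) (σ0 : X → ℝ≥0∞) (hσ0 : Measurable σ0) (h00 : ∀ x, σ0 x ≠ 0)
    (h01 : ∀ x, σ0 x ≠ ∞)
    (hone : ∀ x, (∏ j, σ j x ^ c j) * σ0 x ^ c0 = 1)
    (W : ℝ≥0∞) (hWtop : W ≠ ∞)
    (hW : ∀ n x, (∏ j, E.av v n (σ j) x ^ c j) * E.av v n σ0 x ^ c0 ≤ W)
    (h : J → X → ℝ≥0∞) (hh : ∀ j, Measurable (h j)) :
    ∃ Φ : X → ℝ≥0∞, Measurable Φ ∧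
      (∀ n x, E.PR v a h n x ≤ Φ x ^ (1 / q) * E.av v n σ0 x ^ S) ∧
      ∫⁻ x, Φ x * σ0 x ∂v ≤ doobC (q * ((γ - 1) * c0 + 1 / q)) * cD a q θ * (W ^ (γ * q) *
      ∏ j, eNorm (θ j) (v.withDensity (σ j)) (fun z => h j z / σ j z) ^ (a j * q)) := by
  have hγ0 : 0 ≤ γ := by linarith
  let σo : Option J → X → ℝ≥0∞ := fun o => o.elim σ0 σ
  let co : Option J → ℝ := fun o => o.elim c0 c
  let ao : Option J → ℝ := fun o => o.elim (γ * c0) a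
  have hσo : ∀ o, Measurable (σo o) := by rintro (_ | j); exacts [hσ0, hσ j]
  have hσo0 : ∀ o x, σo o x ≠ 0 := by rintro (_ | j); exacts [h00, h0 j]
  have hσo1 : ∀ o x, σo o x ≠ ∞ := by rintro (_ | j); exacts [h01, h1 j]
  have hco : ∀ o, 0 < co o := by rintro (_ | j); exacts [hc0, hc j]
  have hao : ∀ o, 0 ≤ ao o := by rintro (_ | j); exacts [by simp only [ao, Option.elim]; positivity, (ha j).le]
  have hγo : ∀ o, ao o ≤ γ * co o := by rintro (_ | j); exacts [le_rfl, hγ j]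
  have hWo : ∀ n x, ∏ o, E.av v n (σo o) x ^ co o ≤ W := by
    intro n x
    rw [Fintype.prod_option, mul_comm]
    exact hW n x
  have hso : ∀ o n x, E.av v n (σo o) x ≠ ∞ := fun o n x =>
    E.av_ne_top v hfin hpos σo hσo hσo0 co hco n x (ne_top_of_le_ne_top hWtop (hWo n x)) o
  have hs : ∀ j n x, E.av v n (σ j) x ≠ ∞ := fun j => hso (some j)
  have hs0 : ∀ n x, E.av v n σ0 x ≠ ∞ := hso none
  have hs00 : ∀ n x, E.av v n σ0 x ≠ 0 := fun n x => E.av_pos v hfin hpos σ0 hσ0 h00 n x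
  have hcell : ∀ j n x, v.withDensity (σ j) (E.cell n x) ≠ ∞ := fun j n x =>
    E.withDensity_cell_ne_top v hfin (σ j) n x (hs j n x)
  have hcell0 : ∀ n x, v.withDensity σ0 (E.cell n x) ≠ ∞ := fun n x =>
    E.withDensity_cell_ne_top v hfin σ0 n x (hs0 n x)
  set R := (γ - 1) * c0 + 1 / q with hR
  have hRp : 0 < R := by
    have : 0 < (γ - 1) * c0 := mul_pos (by linarith) hc0
    positivity
  have hqR : 1 < q * R := by
    have : 0 < q * ((γ - 1) * c0) := mul_pos hq (mul_pos (by linarith) hc0)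
    rw [hR, mul_add, mul_one_div_cancel hq.ne']; linarith
  set ε := 1 / R with hεd
  have hε : 0 < ε := by positivity
  have hεR : 1 / ε = R := by rw [hεd]; simp
  have hRS : R = γ * c0 + S := by rw [hR, hcS]; ring
  let Z : X → ℝ≥0∞ := fun y => (∏ j, σ j y ^ b j) * σ0 y ^ (-(1 / q))
  have hZm : Measurable Z := (Finset.measurable_prod _ fun j _ => (hσ j).pow_const _).mul
    (hσ0.pow_const _)
  have hkDm := E.measurable_kD v a σ h
  let Y : X → ℝ≥0∞ := fun y => E.kD v a σ h y * Z y
  have hYm : Measurable Y := hkDm.mul hZm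
  have hpt : ∀ n x, E.PR v a h n x ≤
      W ^ γ * E.mx (v.withDensity σ0) (fun y => Y y ^ ε) x ^ R * E.av v n σ0 x ^ S := by
    intro n x
    have hH := E.lemH v hfin hpos ao co hao γ hγ0 hγo σo hσo W n x (hWo n x)
      (fun y => Z y ^ ε * σ0 y) ((hZm.pow_const _).mul hσ0) (1 / ε) (by positivity) (by
        intro y
        rw [ENNReal.mul_rpow_of_nonneg _ _ (by positivity), ← ENNReal.rpow_mul,
          mul_one_div_cancel hε.ne', ENNReal.rpow_one, Fintype.prod_option, hεR]
        have e0 : γ * co none - ao none = 0 := by simp [co, ao]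
        rw [e0, ENNReal.rpow_zero, one_mul]
        have e1 : ∀ j, σ j y ^ b j * σ j y ^ (γ * c j - a j) = (σ j y ^ c j) ^ (γ - 1) := by
          intro j
          rw [← ENNReal.rpow_add _ _ (h0 j y) (h1 j y), ← ENNReal.rpow_mul]
          congr 1
          rw [habc j]; ring
        have e2 : σ0 y ^ (-(1 / q)) * σ0 y ^ R = (σ0 y ^ c0) ^ (γ - 1) := by
          rw [← ENNReal.rpow_add _ _ (h00 y) (h01 y), ← ENNReal.rpow_mul]
          congr 1
          rw [hR]; ring
        calc (∏ j, σ j y ^ b j) * σ0 y ^ (-(1 / q)) * σ0 y ^ R * ∏ j, σ j y ^ (γ * c j - a j)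
            = (∏ j, (σ j y ^ b j * σ j y ^ (γ * c j - a j))) * (σ0 y ^ (-(1 / q)) * σ0 y ^ R) := by
              rw [Finset.prod_mul_distrib]; ring
          _ = ((∏ j, σ j y ^ c j) * σ0 y ^ c0) ^ (γ - 1) := by
              simp_rw [e1, e2]
              rw [ENNReal.prod_rpow_of_nonneg (by linarith), ENNReal.mul_rpow_of_nonneg _ _ (by linarith)]
          _ = 1 := by rw [hone, ENNReal.one_rpow])
    rw [Fintype.prod_option, hεR] at hH
    change E.av v n σ0 x ^ (γ * c0) * ∏ j, E.av v n (σ j) x ^ a j ≤ _ at hH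
    have hp := E.pull v hfin n x (E.kap v a σ h n x) (E.kD v a σ h)
      (fun y hy => E.kap_le v a ha σ h n x y hy) Z σ0 hZm hσ0 ε hε
    rw [hεR] at hp
    have hch := E.av_change v hfin hpos σ0 hσ0 h00 h01 n x (hs0 n x) (fun y => Y y ^ ε * σ0 y)
      ((hYm.pow_const _).mul hσ0)
    have e3 : (fun y => Y y ^ ε * σ0 y / σ0 y) = fun y => Y y ^ ε := by
      ext y; exact ENNReal.mul_div_cancel_right (h00 y) (h01 y)
    rw [e3] at hch
    set s := E.av v n σ0 x with hsd
    have hsz : s ^ (γ * c0) ≠ 0 := by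
      simp [ENNReal.rpow_eq_zero_iff, hs00 n x, hs0 n x, ← hsd]
      exact ⟨fun h => absurd h (hs00 n x), fun h => absurd h (hs0 n x)⟩
    have hst : s ^ (γ * c0) ≠ ∞ := ENNReal.rpow_ne_top_of_nonneg (by positivity) (hs0 n x)
    rw [← ENNReal.mul_le_mul_iff_right hsz hst,
      E.PR_kap v hfin hpos a ha σ hσ h0 h1 hs h hh n x]
    calc s ^ (γ * c0) * (E.kap v a σ h n x * ∏ j, E.av v n (σ j) x ^ a j)
        = E.kap v a σ h n x * (s ^ (γ * c0) * ∏ j, E.av v n (σ j) x ^ a j) := by ring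
      _ ≤ E.kap v a σ h n x * (W ^ γ * E.av v n (fun y => Z y ^ ε * σ0 y) x ^ R) := by gcongr
      _ = W ^ γ * (E.kap v a σ h n x * E.av v n (fun y => Z y ^ ε * σ0 y) x ^ R) := by ring
      _ ≤ W ^ γ * (E.av v n (fun y => Y y ^ ε * σ0 y) x ^ R) := by gcongr
      _ = W ^ γ * ((E.av (v.withDensity σ0) n (fun y => Y y ^ ε) x) ^ R * s ^ R) := by
          rw [hch, ENNReal.mul_rpow_of_nonneg _ _ hRp.le]
      _ ≤ W ^ γ * (E.mx (v.withDensity σ0) (fun y => Y y ^ ε) x ^ R * s ^ R) := by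
          gcongr
          exact le_iSup (fun n => E.av (v.withDensity σ0) n (fun y => Y y ^ ε) x) n
      _ = W ^ γ * (E.mx (v.withDensity σ0) (fun y => Y y ^ ε) x ^ R * (s ^ (γ * c0) * s ^ S)) := by
          rw [hRS, ← ENNReal.rpow_add_of_nonneg _ _ (by positivity) hS]
      _ = _ := by ring
  refine ⟨fun x => W ^ (γ * q) * E.mx (v.withDensity σ0) (fun y => Y y ^ ε) x ^ (q * R), 
    ((E.measurable_mx _ _).pow_const _).const_mul _, ?_, ?_⟩
  · intro n x
    refine (hpt n x).trans (le_of_eq ?_)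
    congr 1
    rw [ENNReal.mul_rpow_of_nonneg _ _ (by positivity), ← ENNReal.rpow_mul, ← ENNReal.rpow_mul]
    congr 2 <;> field_simp
  · set ν0 := v.withDensity σ0 with hν0
    calc ∫⁻ x, W ^ (γ * q) * E.mx ν0 (fun y => Y y ^ ε) x ^ (q * R) * σ0 x ∂v
        = W ^ (γ * q) * ∫⁻ x, E.mx ν0 (fun y => Y y ^ ε) x ^ (q * R) ∂ν0 := by
          have hm : Measurable (fun x => E.mx ν0 (fun y => Y y ^ ε) x ^ (q * R)) :=
            (E.measurable_mx _ _).pow_const _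
          rw [hν0, lintegral_withDensity_eq_lintegral_mul v hσ0 hm,
            ← lintegral_const_mul _ (hσ0.mul hm)]
          apply lintegral_congr
          intro x
          rw [Pi.mul_apply]; ring
      _ ≤ W ^ (γ * q) * (doobC (q * R) * ∫⁻ x, (Y x ^ ε) ^ (q * R) ∂ν0) := by
          gcongr
          exact E.doob ν0 hcell0 _ (hYm.pow_const _) hqR
      _ ≤ W ^ (γ * q) * (doobC (q * R) * (cD a q θ *
          ∏ j, eNorm (θ j) (v.withDensity (σ j)) (fun z => h j z / σ j z) ^ (a j * q))) := by
          gcongr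
          refine le_trans (le_of_eq ?_) (E.Ymain v a b ha hb q hq hbq θ hθ1 hθ σ hσ h0 hcell
            (fun j z => h j z / σ j z) (fun j => (hh j).div (hσ j)))
          have hm : Measurable (fun x => (Y x ^ ε) ^ (q * R)) := (hYm.pow_const _).pow_const _
          rw [hν0, lintegral_withDensity_eq_lintegral_mul v hσ0 hm]
          apply lintegral_congr
          intro x
          rw [Pi.mul_apply, ← ENNReal.rpow_mul, show ε * (q * R) = q by rw [hεd]; field_simp]
          simp only [Y, Z, kD]
          rw [← mul_assoc, ENNReal.mul_rpow_of_nonneg _ _ hq.le, ← ENNReal.rpow_mul (σ0 x),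
            show -(1 / q) * q = -1 by field_simp, ENNReal.rpow_neg_one, mul_comm, mul_assoc,
            ENNReal.inv_mul_cancel (h00 x) (h01 x), mul_one,
            ← Finset.prod_mul_distrib, ← ENNReal.prod_rpow_of_nonneg hq.le]
          apply Finset.prod_congr rfl
          intro j _
          rw [ENNReal.mul_rpow_of_nonneg _ _ hq.le, ← ENNReal.rpow_mul, ← ENNReal.rpow_mul]
      _ = _ := by ring

end Fil

/-- Shifts of the one-third-trick grids. -/
def gsh (n : ℤ) (b : Bool) : ℝ := if b then (-1) ^ n / 3 else 0

lemma gsh_step (n : ℤ) (b : Bool) : ∃ k : ℤ, gsh (n + 1) b = 2 * gsh n b - k := by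
  cases b
  · exact ⟨0, by simp [gsh]⟩
  · rcases Int.even_or_odd n with h | h
    · refine ⟨1, ?_⟩
      simp only [gsh, if_true, h.neg_one_zpow, (h.add_one).neg_one_zpow]; norm_num
    · refine ⟨-1, ?_⟩
      simp only [gsh, if_true, h.neg_one_zpow, (h.add_one).neg_one_zpow]; norm_num

lemma floor_half {y y' : ℝ} (h : ⌊2 * y⌋ = ⌊2 * y'⌋) : ⌊y⌋ = ⌊y'⌋ := by
  rw [Int.floor_eq_iff]
  have h1 : (2 * ⌊y'⌋ : ℤ) ≤ ⌊2 * y⌋ := by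
    rw [h, Int.le_floor]; push_cast; linarith [Int.floor_le y']
  have h2 : ⌊2 * y⌋ < (2 * ⌊y'⌋ + 2 : ℤ) := by
    rw [h, Int.floor_lt]; push_cast; linarith [Int.lt_floor_add_one y']
  rw [Int.le_floor] at h1
  rw [Int.floor_lt] at h2
  push_cast at h1 h2
  constructor <;> linarith

/-- The shifted dyadic grids. -/
def grid (d : ℕ) (α : Fin d → Bool) : Fil (Fin d → ℝ) (Fin d → ℤ) where
  e n x i := ⌊(2 : ℝ) ^ n * x i - gsh n (α i)⌋
  meas n := by
    apply measurable_pi_lambda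
    intro i
    exact Int.measurable_floor.comp (((measurable_pi_apply i).const_mul _).sub_const _)
  mono n x y h := by
    funext i
    have h' := congrFun h i
    obtain ⟨k, hk⟩ := gsh_step n (α i)
    have key : ∀ u : ℝ, ⌊(2 : ℝ) ^ (n + 1) * u - gsh (n + 1) (α i)⌋ =
        ⌊2 * ((2 : ℝ) ^ n * u - gsh n (α i))⌋ + k := by
      intro u
      rw [hk, zpow_add_one₀ (by norm_num), ← Int.floor_add_intCast]
      congr 1; ring
    simp only [key] at h'
    exact floor_half (by omega)

def gcube (d : ℕ) (α : Fin d → Bool) (n : ℤ) (x : Fin d → ℝ) : Cube d where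
  corner i := ((2 : ℝ) ^ n)⁻¹ * ((⌊(2 : ℝ) ^ n * x i - gsh n (α i)⌋ : ℝ) + gsh n (α i))
  side := ((2 : ℝ) ^ n)⁻¹
  side_pos := by positivity

lemma gcube_set (d : ℕ) (α : Fin d → Bool) (n : ℤ) (x : Fin d → ℝ) :
    (gcube d α n x).set = (grid d α).cell n x := by
  ext y
  have h2 : (0 : ℝ) < 2 ^ n := by positivity
  simp only [Cube.set, gcube, Fil.cell, grid, Set.mem_ofPred_eq, funext_iff]
  refine forall_congr' fun i => ?_
  rw [Int.floor_eq_iff, inv_mul_le_iff₀ h2, ← mul_add_one, lt_inv_mul_iff₀ h2]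
  constructor <;> rintro ⟨h, h'⟩ <;> constructor <;> linarith

lemma cube_vol {d : ℕ} (Q : Cube d) : Q.vol = ENNReal.ofReal Q.side ^ d := by
  have : Q.set = Set.pi Set.univ (fun i => Set.Ico (Q.corner i) (Q.corner i + Q.side)) := by
    ext x; simp [Cube.set]
  rw [Cube.vol, this, Real.volume_pi_Ico]
  simp

lemma cube_meas {d : ℕ} (Q : Cube d) : MeasurableSet Q.set := by
  have : Q.set = Set.pi Set.univ (fun i => Set.Ico (Q.corner i) (Q.corner i + Q.side)) := by
    ext x; simp [Cube.set]
  rw [this]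
  exact MeasurableSet.univ_pi fun i => measurableSet_Ico

lemma grid_vol (d : ℕ) (α : Fin d → Bool) (n : ℤ) (x : Fin d → ℝ) :
    volume ((grid d α).cell n x) = ENNReal.ofReal (((2 : ℝ) ^ n)⁻¹) ^ d := by
  rw [← gcube_set, ← Cube.vol, cube_vol]; rfl

lemma grid_fin (d : ℕ) (α : Fin d → Bool) (n : ℤ) (x : Fin d → ℝ) :
    volume ((grid d α).cell n x) ≠ ∞ := by
  rw [grid_vol]; exact ENNReal.pow_ne_top ENNReal.ofReal_ne_top

lemma grid_pos (d : ℕ) (α : Fin d → Bool) (n : ℤ) (x : Fin d → ℝ) :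
    volume ((grid d α).cell n x) ≠ 0 := by
  rw [grid_vol]; apply pow_ne_zero
  rw [ne_eq, ENNReal.ofReal_eq_zero, not_le]; positivity

lemma grid_dbl (d : ℕ) (α : Fin d → Bool) (n : ℤ) (x : Fin d → ℝ) :
    volume ((grid d α).cell n x) ≤ 2 ^ d * volume ((grid d α).cell (n + 1) x) := by
  rw [grid_vol, grid_vol, ← mul_pow]
  gcongr
  have : (2 : ℝ≥0∞) = ENNReal.ofReal 2 := by simp
  rw [this, ← ENNReal.ofReal_mul (by norm_num)]
  apply ENNReal.ofReal_le_ofReal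
  rw [zpow_add_one₀ (by norm_num), mul_inv]
  apply le_of_eq
  field_simp

lemma coord_cover (n : ℤ) (u L : ℝ) (hL : L ≤ 1 / 3) :
    ∃ b, ∃ k : ℤ, ∀ y, u ≤ y → y < u + L → ⌊y - gsh n b⌋ = k := by
  by_cases h : u + L ≤ ⌊u⌋ + 1
  · refine ⟨false, ⌊u⌋, fun y h1 h2 => ?_⟩
    rw [Int.floor_eq_iff]
    simp only [gsh, if_false, Bool.false_eq_true]
    constructor <;> linarith [Int.floor_le u]
  · push Not at h
    have hu := Int.lt_floor_add_one u
    rcases Int.even_or_odd n with hn | hn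
    · refine ⟨true, ⌊u⌋, fun y h1 h2 => ?_⟩
      rw [Int.floor_eq_iff]
      simp only [gsh, if_true, hn.neg_one_zpow]
      constructor <;> linarith
    · refine ⟨true, ⌊u⌋ + 1, fun y h1 h2 => ?_⟩
      rw [Int.floor_eq_iff]
      simp only [gsh, if_true, hn.neg_one_zpow]
      push_cast
      constructor <;> linarith

lemma cube_cover {d : ℕ} (Q : Cube d) (x : Fin d → ℝ) (hx : x ∈ Q.set) :
    ∃ α n, Q.set ⊆ (grid d α).cell n x ∧ volume ((grid d α).cell n x) ≤ 6 ^ d * Q.vol := by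
  obtain ⟨k, hk1, hk2⟩ := exists_mem_Ioc_zpow (x := 3 * Q.side) (y := (2 : ℝ))
    (by have := Q.side_pos; positivity) (by norm_num)
  set n : ℤ := -(k + 1) with hn
  have hs : ((2 : ℝ) ^ n)⁻¹ = 2 ^ (k + 1) := by rw [hn, zpow_neg, inv_inv]
  have h2 : (0 : ℝ) < 2 ^ n := by positivity
  have hL : (2 : ℝ) ^ n * Q.side ≤ 1 / 3 := by
    have : Q.side ≤ ((2 : ℝ) ^ n)⁻¹ * (1 / 3) := by rw [hs]; linarith
    rwa [le_inv_mul_iff₀ h2] at this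
  choose b K hb using fun i => coord_cover n ((2 : ℝ) ^ n * Q.corner i) ((2 : ℝ) ^ n * Q.side) hL
  refine ⟨b, n, ?_, ?_⟩
  · have key : ∀ y ∈ Q.set, ∀ i, ⌊(2 : ℝ) ^ n * y i - gsh n (b i)⌋ = K i := by
      intro y hy i
      obtain ⟨h1, h3⟩ := hy i
      apply hb
      · gcongr
      · rw [← mul_add]; gcongr
    intro y hy
    show (grid d b).e n y = (grid d b).e n x
    funext i
    show ⌊_⌋ = ⌊_⌋
    rw [key y hy i, key x hx i]
  · rw [grid_vol, cube_vol, ← mul_pow]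
    gcongr
    have : (6 : ℝ≥0∞) = ENNReal.ofReal 6 := by simp
    rw [this, ← ENNReal.ofReal_mul (by norm_num)]
    apply ENNReal.ofReal_le_ofReal
    rw [hs, zpow_add_one₀ (by norm_num)]
    linarith

/-- The product of averages over grid cells. -/
def pM {d m : ℕ} (α : Fin d → Bool) (r : Fin m → ℝ) (ρ : ℝ) (F : Fin m → (Fin d → ℝ) → ℝ≥0∞)
    (G : (Fin d → ℝ) → ℝ≥0∞) (n : ℤ) (x : Fin d → ℝ) : ℝ≥0∞ :=
  (∏ j, (grid d α).av volume n (fun y => F j y ^ r j) x ^ (1 / r j)) *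
    (grid d α).av volume n (fun y => G y ^ ρ) x ^ (1 / ρ)

lemma measurable_pM {d m : ℕ} (α : Fin d → Bool) (r : Fin m → ℝ) (ρ : ℝ)
    (F : Fin m → (Fin d → ℝ) → ℝ≥0∞)
    (G : (Fin d → ℝ) → ℝ≥0∞) (n : ℤ) : Measurable (pM α r ρ F G n) := by
  unfold pM
  apply Measurable.mul
  · apply Finset.measurable_fun_prod
    intro j _
    exact ((grid d α).measurable_av volume n _).pow_const _
  · exact ((grid d α).measurable_av volume n _).pow_const _

lemma avg_le {d : ℕ} (r : ℝ≥0∞) (hr : r ≠ ∞) (F : (Fin d → ℝ) → ℝ≥0∞) (Q : Cube d)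
    (x : Fin d → ℝ) (α n) (h1 : Q.set ⊆ (grid d α).cell n x)
    (h2 : volume ((grid d α).cell n x) ≤ 6 ^ d * Q.vol) :
    avg r F Q ≤ (6 ^ d) ^ (1 / r.toReal) *
      (grid d α).av volume n (fun y => F y ^ r.toReal) x ^ (1 / r.toReal) := by
  rw [avg, if_neg hr, ← ENNReal.mul_rpow_of_nonneg _ _ (by positivity)]
  apply ENNReal.rpow_le_rpow _ (by positivity)
  unfold Fil.av
  rw [← mul_div_assoc]
  have hc := grid_pos d α n x
  have hc' := grid_fin d α n x
  have hQ : Q.vol ≠ 0 := by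
    rw [cube_vol]; apply pow_ne_zero
    rw [ne_eq, ENNReal.ofReal_eq_zero, not_le]; exact Q.side_pos
  have hQ' : Q.vol ≠ ∞ := by
    rw [cube_vol]; exact ENNReal.pow_ne_top ENNReal.ofReal_ne_top
  rw [ENNReal.le_div_iff_mul_le (Or.inl hc) (Or.inl hc')]
  calc _ ≤ (∫⁻ y in (grid d α).cell n x, F y ^ r.toReal) / Q.vol * (6 ^ d * Q.vol) := by
        gcongr
    _ = _ := by
        rw [mul_comm (6 ^ d), ← mul_assoc, ENNReal.div_mul_cancel hQ hQ', mul_comm]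

def mXK (d : ℕ) {m : ℕ} (r : Fin m → ℝ≥0∞) (ρ : ℝ≥0∞) : ℝ≥0∞ :=
  (∏ j, ((6 : ℝ≥0∞) ^ d) ^ (1 / (r j).toReal)) * (6 ^ d) ^ (1 / ρ.toReal)

lemma mXK_ne_top (d : ℕ) {m : ℕ} (r : Fin m → ℝ≥0∞) (ρ : ℝ≥0∞) : mXK d r ρ ≠ ∞ := by
  unfold mXK
  apply ENNReal.mul_ne_top
  · exact ENNReal.prod_ne_top fun j _ => ENNReal.rpow_ne_top_of_nonneg (by positivity) (by simp)
  · exact ENNReal.rpow_ne_top_of_nonneg (by positivity) (by simp)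

lemma maximalX_le {d m : ℕ} (r : Fin m → ℝ≥0∞) (hr : ∀ j, r j ≠ ∞) (ρ : ℝ≥0∞) (hρ : ρ ≠ ∞)
    (F : Fin m → (Fin d → ℝ) → ℝ≥0∞) (G : (Fin d → ℝ) → ℝ≥0∞) (x : Fin d → ℝ) :
    maximalX r ρ F G x ≤ mXK d r ρ *
      ⨆ α, ⨆ n, pM α (fun j => (r j).toReal) ρ.toReal F G n x := by
  unfold maximalX
  refine iSup₂_le fun Q hx => ?_
  obtain ⟨α, n, h1, h2⟩ := cube_cover Q x hx
  calc _ ≤ (∏ j, ((6 ^ d) ^ (1 / (r j).toReal) * (grid d α).av volume n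
          (fun y => F j y ^ (r j).toReal) x ^ (1 / (r j).toReal))) * ((6 ^ d) ^ (1 / ρ.toReal) *
          (grid d α).av volume n (fun y => G y ^ ρ.toReal) x ^ (1 / ρ.toReal)) := by
        apply mul_le_mul' _ (avg_le ρ hρ G Q x α n h1 h2)
        exact Finset.prod_le_prod' fun j _ => avg_le (r j) (hr j) (F j) Q x α n h1 h2
    _ = mXK d r ρ * pM α (fun j => (r j).toReal) ρ.toReal F G n x := by
        rw [Finset.prod_mul_distrib, mXK, pM]; ring
    _ ≤ _ := by
        gcongr
        exact le_iSup_of_le α (le_iSup_of_le n le_rfl)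

lemma iSup_rpow' {ι : Sort*} (f : ι → ℝ≥0∞) {q : ℝ} (hq : 0 < q) :
    (⨆ i, f i) ^ q = ⨆ i, f i ^ q := by
  have := (ENNReal.orderIsoRpow q hq).map_iSup f
  exact this

lemma maximalX_int {d m : ℕ} (r : Fin m → ℝ≥0∞) (hr : ∀ j, r j ≠ ∞) (ρ : ℝ≥0∞) (hρ : ρ ≠ ∞)
    (F : Fin m → (Fin d → ℝ) → ℝ≥0∞) (G : (Fin d → ℝ) → ℝ≥0∞) (q : ℝ) (hq : 0 < q) :
    ∫⁻ x, maximalX r ρ F G x ^ q ≤ mXK d r ρ ^ q *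
      ∑ α, ∫⁻ x, (⨆ n, pM α (fun j => (r j).toReal) ρ.toReal F G n x) ^ q := by
  have hme : ∀ α : Fin d → Bool, Measurable
      (fun x => (⨆ n, pM α (fun j => (r j).toReal) ρ.toReal F G n x) ^ q) := fun α =>
    (Measurable.iSup fun n => measurable_pM α _ _ F G n).pow_const _
  rw [← lintegral_finsetSum _ fun α _ => hme α, ← lintegral_const_mul _
    (Finset.measurable_fun_sum _ fun α _ => hme α)]
  apply lintegral_mono
  intro x
  calc maximalX r ρ F G x ^ q ≤ (mXK d r ρ *
      ⨆ α, ⨆ n, pM α (fun j => (r j).toReal) ρ.toReal F G n x) ^ q :=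
        ENNReal.rpow_le_rpow (maximalX_le r hr ρ hρ F G x) hq.le
    _ = mXK d r ρ ^ q * ⨆ α, (⨆ n, pM α (fun j => (r j).toReal) ρ.toReal F G n x) ^ q := by
        rw [ENNReal.mul_rpow_of_nonneg _ _ hq.le, iSup_rpow' _ hq]
    _ ≤ _ := by
        refine mul_le_mul' le_rfl ?_
        refine iSup_le fun α => ?_
        exact Finset.single_le_sum (f := fun α =>
          (⨆ n, pM α (fun j => (r j).toReal) ρ.toReal F G n x) ^ q) (fun _ _ => bot_le)
          (Finset.mem_univ α)

/-- exponents on Option -/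
def oE {m : ℕ} {β : Type*} (a : Fin m → β) (a0 : β) : Option (Fin m) → β
  | none => a0
  | some j => a j

lemma pM_rpow {d m : ℕ} (α : Fin d → Bool) (r : Fin m → ℝ) (ρ : ℝ)
    (F : Fin m → (Fin d → ℝ) → ℝ≥0∞)
    (G : (Fin d → ℝ) → ℝ≥0∞) (n : ℤ) (x : Fin d → ℝ) (q : ℝ) (hq : 0 < q) :
    pM α r ρ F G n x ^ q = (grid d α).PR volume (oE (fun j => q / r j) (q / ρ))
      (oE (fun j y => F j y ^ r j) (fun y => G y ^ ρ)) n x := by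
  unfold pM Fil.PR
  rw [Fintype.prod_option, ENNReal.mul_rpow_of_nonneg _ _ hq.le,
    ← ENNReal.prod_rpow_of_nonneg hq.le, mul_comm]
  simp only [oE]
  congr 1
  · rw [← ENNReal.rpow_mul, one_div_mul_eq_div]
  · refine Finset.prod_congr rfl fun j _ => ?_
    rw [← ENNReal.rpow_mul, one_div_mul_eq_div]

lemma pM_PR {d m : ℕ} (α : Fin d → Bool) (r : Fin m → ℝ) (ρ : ℝ)
    (F : Fin m → (Fin d → ℝ) → ℝ≥0∞)
    (G : (Fin d → ℝ) → ℝ≥0∞) (n : ℤ) (x : Fin d → ℝ) :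
    pM α r ρ F G n x = (grid d α).PR volume (oE (fun j => 1 / r j) (1 / ρ))
      (oE (fun j y => F j y ^ r j) (fun y => G y ^ ρ)) n x := by
  simpa using pM_rpow α r ρ F G n x 1 one_pos

lemma maximalX_mono {d k : ℕ} (r : Fin k → ℝ≥0∞) (ρ : ℝ≥0∞) (F : Fin k → (Fin d → ℝ) → ℝ≥0∞)
    {G G' : (Fin d → ℝ) → ℝ≥0∞} (h : ∀ x, G x ≤ G' x) (x : Fin d → ℝ) :
    maximalX r ρ F G x ≤ maximalX r ρ F G' x := by
  unfold maximalX
  refine iSup₂_mono fun Q _ => ?_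
  refine mul_le_mul' le_rfl ?_
  unfold avg
  split_ifs
  · exact essSup_mono_ae (ae_of_all _ h)
  · gcongr
    exact h _

/-- truncation -/
def trG {d : ℕ} (G : (Fin d → ℝ) → ℝ≥0∞) (k : ℕ) (x : Fin d → ℝ) : ℝ≥0∞ :=
  (Metric.closedBall (0 : Fin d → ℝ) k).indicator (fun x => min (G x) k) x

lemma trG_le {d : ℕ} (G : (Fin d → ℝ) → ℝ≥0∞) (k : ℕ) (x) : trG G k x ≤ min (G x) k :=
  Set.indicator_le_self' (fun _ _ => bot_le) x

lemma trG_meas {d : ℕ} {G : (Fin d → ℝ) → ℝ≥0∞} (hG : Measurable G) (k : ℕ) :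
    Measurable (trG G k) :=
  (hG.min measurable_const).indicator Metric.isClosed_closedBall.measurableSet

lemma trG_mono {d : ℕ} (G : (Fin d → ℝ) → ℝ≥0∞) (x) : Monotone (fun k => trG G k x) := by
  intro k l h
  have h1 : (k : ℝ) ≤ l := by exact_mod_cast h
  have h2 : (k : ℝ≥0∞) ≤ l := by exact_mod_cast h
  show (Metric.closedBall (0 : Fin d → ℝ) k).indicator (fun x => min (G x) k) x ≤
    (Metric.closedBall (0 : Fin d → ℝ) l).indicator (fun x => min (G x) l) x
  refine (Set.indicator_le_indicator (g := fun x => min (G x) (l : ℝ≥0∞)) ?_).trans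
    (Set.indicator_le_indicator_of_subset (Metric.closedBall_subset_closedBall h1)
      (fun _ => bot_le) x)
  exact min_le_min le_rfl h2

lemma trG_iSup {d : ℕ} (G : (Fin d → ℝ) → ℝ≥0∞) (x) : ⨆ k, trG G k x = G x := by
  apply le_antisymm
  · exact iSup_le fun k => (trG_le G k x).trans (min_le_left _ _)
  · apply le_of_forall_lt
    intro c hc
    obtain ⟨n, hn⟩ := ENNReal.exists_nat_gt (ne_top_of_lt hc)
    obtain ⟨k, hk⟩ := exists_nat_ge ‖x‖
    refine lt_of_lt_of_le ?_ (le_iSup _ (max n k))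
    rw [trG, Set.indicator_of_mem]
    · apply lt_min hc (hn.trans_le _)
      exact_mod_cast le_max_left n k
    · rw [mem_closedBall_zero_iff]
      refine hk.trans ?_
      exact_mod_cast le_max_right n k

lemma dom_ext {d m : ℕ} (r : Fin m → ℝ≥0∞) (ρ q : ℝ≥0∞) (hq : 0 < q) (hq' : q ≠ ∞) (C_T : ℝ≥0∞)
    (U : (Fin d → ℝ) → ℝ≥0∞) (hU : Measurable U) (F : Fin m → (Fin d → ℝ) → ℝ≥0∞)
    (hyp : ∀ g, MemLinftyC g → eNorm q volume (fun x => U x * nn g x) ≤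
      C_T * eNorm q volume (maximalX r ρ F (nn g)))
    (G : (Fin d → ℝ) → ℝ≥0∞) (hG : Measurable G) :
    ∫⁻ x, (U x * G x) ^ q.toReal ≤ C_T ^ q.toReal * ∫⁻ x, maximalX r ρ F G x ^ q.toReal := by
  have hq0 : 0 < q.toReal := ENNReal.toReal_pos hq.ne' hq'
  have key : ∀ k, ∫⁻ x, (U x * trG G k x) ^ q.toReal ≤
      C_T ^ q.toReal * ∫⁻ x, maximalX r ρ F G x ^ q.toReal := by
    intro k
    set g : (Fin d → ℝ) → ℂ := fun x => ((trG G k x).toReal : ℂ) with hg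
    have hfin : ∀ x, trG G k x ≠ ∞ := fun x =>
      ne_top_of_le_ne_top (by simp) ((trG_le G k x).trans (min_le_right _ _))
    have hnn : nn g = trG G k := by
      funext x
      simp only [nn, hg]
      rw [← enorm_eq_nnnorm, ← ofReal_norm, Complex.norm_real, Real.norm_of_nonneg ENNReal.toReal_nonneg,
        ENNReal.ofReal_toReal (hfin x)]
    have hm : MemLinftyC g := by
      refine ⟨Complex.measurable_ofReal.comp (trG_meas hG k).ennreal_toReal, ⟨k, ?_⟩, ?_⟩
      · intro x
        simp only [hg]
        rw [Complex.norm_real, Real.norm_of_nonneg ENNReal.toReal_nonneg]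
        have := ENNReal.toReal_mono (by simp) ((trG_le G k x).trans (min_le_right _ _))
        simpa using this
      · apply (Metric.isBounded_closedBall (x := (0 : Fin d → ℝ)) (r := k)).subset
        intro x hx
        by_contra h
        apply hx
        simp [hg, trG, Set.indicator_of_notMem h]
    have h1 := hyp g hm
    rw [eNorm_of_ne_top hq', eNorm_of_ne_top hq', hnn] at h1
    have h2 := ENNReal.rpow_le_rpow h1 hq0.le
    rw [ENNReal.mul_rpow_of_nonneg _ _ hq0.le, ← ENNReal.rpow_mul, ← ENNReal.rpow_mul,
      one_div_mul_cancel hq0.ne', ENNReal.rpow_one, ENNReal.rpow_one] at h2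
    refine h2.trans ?_
    refine mul_le_mul' le_rfl (lintegral_mono fun x => ENNReal.rpow_le_rpow ?_ hq0.le)
    exact maximalX_mono r ρ F (fun x => (trG_le G k x).trans (min_le_left _ _)) x
  have e : ∀ x, (U x * G x) ^ q.toReal = ⨆ k, (U x * trG G k x) ^ q.toReal := by
    intro x
    rw [← iSup_rpow' _ hq0, ← ENNReal.mul_iSup, trG_iSup]
  simp_rw [e]
  rw [lintegral_iSup]
  · exact iSup_le key
  · intro k
    exact (hU.mul (trG_meas hG k)).pow_const _
  · intro k l h x
    exact ENNReal.rpow_le_rpow (mul_le_mul' le_rfl (trG_mono G x h)) hq0.le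

/-- The space `L^∞_c` as a submodule. -/
def LinfC (d : ℕ) : Submodule ℂ ((Fin d → ℝ) → ℂ) where
  carrier := {f | MemLinftyC f}
  zero_mem' := ⟨measurable_zero, ⟨0, by simp⟩, by simp⟩
  add_mem' := by
    rintro f g ⟨h1, ⟨M, h2⟩, h3⟩ ⟨h1', ⟨M', h2'⟩, h3'⟩
    refine ⟨h1.add h1', ⟨M + M', fun x => (norm_add_le _ _).trans (add_le_add (h2 x) (h2' x))⟩, ?_⟩
    exact (h3.union h3').subset (Function.support_add _ _)
  smul_mem' := by
    rintro c f ⟨h1, ⟨M, h2⟩, h3⟩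
    refine ⟨h1.const_smul c, ⟨‖c‖ * M, fun x => ?_⟩, h3.subset (Function.support_const_smul_subset _ _)⟩
    rw [Pi.smul_apply, norm_smul]; gcongr; exact h2 x

lemma coe_update {d m : ℕ} [DecidableEq (Fin m)] (f : Fin m → LinfC d) (j : Fin m) (x : LinfC d) :
    (fun k => (Function.update f j x k : (Fin d → ℝ) → ℂ)) =
      Function.update (fun k => (f k : (Fin d → ℝ) → ℂ)) j x := by
  funext k
  by_cases h : k = j
  · subst h; simp
  · simp [h]

def mT {d m : ℕ} (T : (Fin m → ((Fin d → ℝ) → ℂ)) → ((Fin d → ℝ) → ℂ))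
    (hadd : ∀ (f : Fin m → ((Fin d → ℝ) → ℂ)) (j : Fin m) (g : (Fin d → ℝ) → ℂ),
          (∀ k, MemLinftyC (f k)) → MemLinftyC g →
          T (Function.update f j (f j + g)) = T f + T (Function.update f j g))
    (hsmul : ∀ (f : Fin m → ((Fin d → ℝ) → ℂ)) (j : Fin m) (c : ℂ),
          (∀ k, MemLinftyC (f k)) →
          T (Function.update f j (c • f j)) = c • T f) :
    MultilinearMap ℂ (fun _ : Fin m => LinfC d) ((Fin d → ℝ) → ℂ) where
  toFun f := T (fun j => f j)
  map_update_add' := by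
    intro inst f j x y
    obtain rfl : inst = instDecidableEqFin m := Subsingleton.elim _ _
    rw [coe_update, coe_update, coe_update]
    have := hadd (Function.update (fun k => (f k : (Fin d → ℝ) → ℂ)) j x) j y
      (by intro k; rw [← coe_update]; exact (Function.update f j x k).2) y.2
    simpa using this
  map_update_smul' := by
    intro inst f j c x
    obtain rfl : inst = instDecidableEqFin m := Subsingleton.elim _ _
    rw [coe_update, coe_update]
    have := hsmul (Function.update (fun k => (f k : (Fin d → ℝ) → ℂ)) j x) j c
      (by intro k; rw [← coe_update]; exact (Function.update f j x k).2)
    simpa using this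

lemma memInd {d : ℕ} {A : Set (Fin d → ℝ)} (hA : MeasurableSet A) (hb : Bornology.IsBounded A) :
    MemLinftyC (A.indicator (fun _ => (1 : ℂ))) := by
  refine ⟨measurable_const.indicator hA, ⟨1, fun x => ?_⟩, hb.subset Set.support_indicator_subset⟩
  by_cases h : x ∈ A <;> simp [h]

lemma vecSimple_sec {d : ℕ} {Ω : Type*} [MeasurableSpace Ω] {f : (Fin d → ℝ) → Ω → ℂ}
    (hf : VecSimple f) (ω : Ω) : MemLinftyC (fun y => f y ω) := by
  obtain ⟨N, A, ξ, hA, hb, hξ, hM, he⟩ := hf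
  have : (fun y => f y ω) = ∑ i, ξ i ω • (A i).indicator (fun _ => (1 : ℂ)) := by
    funext y
    rw [he, Finset.sum_apply]
    refine Finset.sum_congr rfl fun i _ => ?_
    by_cases h : y ∈ A i <;> simp [h]
  rw [this]
  exact Submodule.sum_mem (LinfC d) fun i _ => Submodule.smul_mem _ _ (memInd (hA i) (hb i))

lemma vecSimple_meas {d : ℕ} {Ω : Type*} [MeasurableSpace Ω] {f : (Fin d → ℝ) → Ω → ℂ}
    (hf : VecSimple f) : Measurable (Function.uncurry f) := by
  obtain ⟨N, A, ξ, hA, hb, hξ, hM, he⟩ := hf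
  have : Function.uncurry f = fun z : (Fin d → ℝ) × Ω =>
      ∑ i, (A i).indicator (fun _ => (1 : ℂ)) z.1 * ξ i z.2 := by
    funext z
    show f z.1 z.2 = _
    rw [he]
    refine Finset.sum_congr rfl fun i _ => ?_
    by_cases h : z.1 ∈ A i <;> simp [h]
  rw [this]
  refine Finset.measurable_fun_sum _ fun i _ => ?_
  exact ((measurable_const.indicator (hA i)).comp measurable_fst).mul ((hξ i).comp measurable_snd)

lemma T_meas {d m : ℕ} {Ω : Type*} [MeasurableSpace Ω]
    (T : (Fin m → ((Fin d → ℝ) → ℂ)) → ((Fin d → ℝ) → ℂ))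
    (hmeas : ∀ f, (∀ j, MemLinftyC (f j)) → Measurable (T f))
    (hadd : ∀ (f : Fin m → ((Fin d → ℝ) → ℂ)) (j : Fin m) (g : (Fin d → ℝ) → ℂ),
          (∀ k, MemLinftyC (f k)) → MemLinftyC g →
          T (Function.update f j (f j + g)) = T f + T (Function.update f j g))
    (hsmul : ∀ (f : Fin m → ((Fin d → ℝ) → ℂ)) (j : Fin m) (c : ℂ),
          (∀ k, MemLinftyC (f k)) →
          T (Function.update f j (c • f j)) = c • T f)
    (f : Fin m → (Fin d → ℝ) → Ω → ℂ) (hf : ∀ j, VecSimple (f j)) :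
    Measurable (fun z : (Fin d → ℝ) × Ω => T (fun j y => f j y z.2) z.1) := by
  choose N A ξ hA hb hξ hM he using hf
  have key : ∀ ω, T (fun j y => f j y ω) = ∑ I : (∀ j, Fin (N j)), (∏ j, ξ j (I j) ω) •
      T (fun j => (A j (I j)).indicator (fun _ => (1 : ℂ))) := by
    intro ω
    let g : ∀ j : Fin m, Fin (N j) → LinfC d := fun j i => ⟨_, memInd (hA j i) (hb j i)⟩
    have h1 := (mT T hadd hsmul).map_sum (fun j (i : Fin (N j)) => ξ j i ω • g j i)
    have h2 : (mT T hadd hsmul) (fun j => ∑ i, ξ j i ω • g j i) = T (fun j y => f j y ω) := by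
      show T _ = T _
      congr 1
      funext j y
      rw [he]
      simp only [Submodule.coe_sum, Submodule.coe_smul, Finset.sum_apply, g]
      refine Finset.sum_congr rfl fun i _ => ?_
      by_cases h : y ∈ A j i <;> simp [h]
    rw [← h2, h1]
    refine Finset.sum_congr rfl fun I _ => ?_
    rw [MultilinearMap.map_smul_univ]
    rfl
  simp_rw [key, Finset.sum_apply, Pi.smul_apply, smul_eq_mul]
  refine Finset.measurable_fun_sum _ fun I _ => ?_
  refine Measurable.mul (Finset.measurable_fun_prod _ fun j _ => (hξ j (I j)).comp measurable_snd) ?_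
  exact (hmeas _ fun j => memInd (hA j (I j)) (hb j (I j))).comp measurable_fst

lemma eNorm_ofReal {α : Type*} [MeasurableSpace α] {t : ℝ} (ht : 0 < t) (μ : Measure α)
    (F : α → ℝ≥0∞) : eNorm (ENNReal.ofReal t) μ F = (∫⁻ x, F x ^ t ∂μ) ^ (1 / t) := by
  rw [eNorm_of_ne_top ENNReal.ofReal_ne_top, ENNReal.toReal_ofReal ht.le]

lemma eNorm_ofReal_rpow {α : Type*} [MeasurableSpace α] {t : ℝ} (ht : 0 < t) (μ : Measure α)
    (F : α → ℝ≥0∞) : eNorm (ENNReal.ofReal t) μ F ^ t = (∫⁻ x, F x ^ t ∂μ) := by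
  rw [eNorm_ofReal ht, ← ENNReal.rpow_mul, one_div_mul_cancel ht.ne', ENNReal.rpow_one]

lemma dual1 {Ω : Type*} [MeasurableSpace Ω] (μ : Measure Ω) (q t : ℝ) (hq : 0 < q) (hqt : q ≤ t)
    (V : Ω → ℝ≥0∞) (hV : Measurable V) (F : ℝ≥0∞) (hF : F = eNorm (ENNReal.ofReal t) μ V)
    (hFt : F ≠ ∞) :
    eNorm (ENNReal.ofReal (1 / q - 1 / t))⁻¹ μ (fun ω => (V ω / F) ^ (t / q - 1)) ≤ 1 := by
  have ht : 0 < t := hq.trans_le hqt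
  rcases hqt.eq_or_lt with h | h
  · subst h
    simp only [div_self hq.ne', sub_self, ENNReal.rpow_zero, ENNReal.ofReal_zero, ENNReal.inv_zero,
      eNorm_top]
    exact essSup_le_of_ae_le _ (ae_of_all _ fun _ => le_rfl)
  · have he : 0 < t / q - 1 := by rw [sub_pos, one_lt_div hq]; exact h
    rw [eNorm_rpow μ _ he]
    have : (ENNReal.ofReal (1 / q - 1 / t))⁻¹ * ENNReal.ofReal (t / q - 1) = ENNReal.ofReal t := by
      have h1 : 0 < 1 / q - 1 / t := by rw [sub_pos]; exact one_div_lt_one_div_of_lt hq h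
      rw [← ENNReal.ofReal_inv_of_pos h1, ← ENNReal.ofReal_mul (by positivity)]
      congr 1
      have : t - q ≠ 0 := by linarith
      field_simp
    rw [this, eNorm_ofReal ht]
    have h2 : ∫⁻ ω, (V ω / F) ^ t ∂μ ≤ 1 := by
      by_cases hF0 : F = 0
      · have := eNorm_eq_zero (by simpa using ht) hV (hF ▸ hF0)
        rw [lintegral_congr_ae (g := fun _ => 0)]
        · simp
        · filter_upwards [this] with ω hω
          simp [hω, ht]
      · simp_rw [ENNReal.div_rpow_of_nonneg _ _ ht.le, div_eq_mul_inv]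
        have hVm : Measurable fun ω => V ω ^ t := hV.pow_const _
        rw [lintegral_mul_const _ hVm, ← eNorm_ofReal_rpow ht, ← hF]
        exact ENNReal.mul_inv_le_one _
    calc _ ≤ ((1 : ℝ≥0∞) ^ (1 / t)) ^ (t / q - 1) := by gcongr
      _ = 1 := by simp

lemma dual2 {Ω : Type*} [MeasurableSpace Ω] (μ : Measure Ω) (q t : ℝ) (hq : 0 < q) (hqt : q ≤ t)
    (V : Ω → ℝ≥0∞) (hV : Measurable V) (hVt : ∀ ω, V ω ≠ ∞) (F : ℝ≥0∞)
    (hF : F = eNorm (ENNReal.ofReal t) μ V)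
    (hFt : F ≠ ∞) :
    F ^ q ≤ ∫⁻ ω, (V ω * (V ω / F) ^ (t / q - 1)) ^ q ∂μ := by
  have ht : 0 < t := hq.trans_le hqt
  by_cases hF0 : F = 0
  · simp [hF0, hq]
  have e : ∀ ω, (V ω * (V ω / F) ^ (t / q - 1)) ^ q = V ω ^ t * (F ^ (t - q))⁻¹ := by
    intro ω
    by_cases h0 : V ω = 0
    · simp [h0, hq, ht]
    rw [ENNReal.mul_rpow_of_nonneg _ _ hq.le, ← ENNReal.rpow_mul]
    have : (t / q - 1) * q = t - q := by field_simp
    rw [this, ENNReal.div_rpow_of_nonneg _ _ (by linarith), div_eq_mul_inv, ← mul_assoc,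
      ← ENNReal.rpow_add _ _ h0 (hVt ω)]
    congr 2
    ring
  simp_rw [e]
  have hVm : Measurable fun ω => V ω ^ t := hV.pow_const _
  rw [lintegral_mul_const _ hVm, ← eNorm_ofReal_rpow ht, ← hF, ← ENNReal.rpow_neg,
    ← ENNReal.rpow_add _ _ hF0 hFt]
  apply le_of_eq
  congr 1
  ring

/-- vector-valued exponents -/
def thE {m : ℕ} (r : Fin m → ℝ≥0∞) (ρ : ℝ) (q t : ℝ) (tj : Fin m → ℝ≥0∞) :
    Option (Fin m) → ℝ≥0∞ :=
  oE (fun j => tj j * ENNReal.ofReal (1 / (r j).toReal))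
    ((ENNReal.ofReal (1 / q - 1 / t))⁻¹ * ENNReal.ofReal (1 / ρ))

def K0 (d : ℕ) {m : ℕ} (r : Fin m → ℝ≥0∞) (ρ : ℝ≥0∞) (q t : ℝ) (tj : Fin m → ℝ≥0∞) : ℝ≥0∞ :=
  mXK d r ρ ^ q * (Fintype.card (Fin d → Bool) *
    (2 * Fil.bC (2 ^ d) (oE (fun j => q / (r j).toReal) (q / ρ.toReal)) (thE r ρ.toReal q t tj)))

lemma oE_comp {m : ℕ} {β γ : Type*} (φ : β → γ) (a : Fin m → β) (b : β) :
    (fun j => φ (oE a b j)) = oE (fun j => φ (a j)) (φ b) := by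
  funext j; cases j <;> rfl

lemma ofReal_mul_inv' {t : ℝ≥0∞} {r : ℝ} (hr : 0 < r) (q : ℝ) (hq : 0 < q) :
    ENNReal.ofReal (q / r) * (t * ENNReal.ofReal (1 / r))⁻¹ = ENNReal.ofReal q * t⁻¹ := by
  have h : ENNReal.ofReal (1 / r) ≠ 0 := by
    rw [ne_eq, ENNReal.ofReal_eq_zero, not_le]; positivity
  rw [ENNReal.mul_inv (Or.inr ENNReal.ofReal_ne_top) (Or.inr h), div_eq_mul_one_div,
    ENNReal.ofReal_mul hq.le, mul_comm t⁻¹, mul_assoc, ← mul_assoc (ENNReal.ofReal (1 / r)),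
    ENNReal.mul_inv_cancel h ENNReal.ofReal_ne_top, one_mul]

section
variable {d m : ℕ} (r : Fin m → ℝ≥0∞) (hr : ∀ j, 0 < r j ∧ r j ≠ ∞) (ρ : ℝ≥0∞) (hρ0 : 0 < ρ)
  (hρ : ρ ≠ ∞) (q t : ℝ) (hq : 0 < q) (hqt : q ≤ t) (hτ : 1 / q - 1 / t < 1 / ρ.toReal)
  (tj : Fin m → ℝ≥0∞) (hrt : ∀ j, r j < tj j) (ht : ∑ j, (tj j)⁻¹ = ENNReal.ofReal (1 / t))

include hr hρ0 hρ hq hτ hrt in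
lemma thE_gt (j) : 1 < thE r ρ.toReal q t tj j := by
  cases j with
  | none =>
    show 1 < (ENNReal.ofReal (1 / q - 1 / t))⁻¹ * ENNReal.ofReal (1 / ρ.toReal)
    have hρ' : 0 < ρ.toReal := ENNReal.toReal_pos hρ0.ne' hρ
    rw [mul_comm, ← div_eq_mul_inv, ENNReal.lt_div_iff_mul_lt (Or.inr (by simp))
      (Or.inl ENNReal.ofReal_ne_top), one_mul]
    exact (ENNReal.ofReal_lt_ofReal_iff (by positivity)).2 hτ
  | some j =>
    show 1 < tj j * ENNReal.ofReal (1 / (r j).toReal)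
    have h := ENNReal.toReal_pos (hr j).1.ne' (hr j).2
    rw [one_div, ENNReal.ofReal_inv_of_pos h, ENNReal.ofReal_toReal (hr j).2, ← div_eq_mul_inv,
      ENNReal.lt_div_iff_mul_lt (Or.inr (by simp)) (Or.inl (hr j).2), one_mul]
    exact hrt j

include hr hρ0 hρ hq in
lemma exp_pos (j) : 0 < oE (fun j => q / (r j).toReal) (q / ρ.toReal) j := by
  cases j with
  | none => exact div_pos hq (ENNReal.toReal_pos hρ0.ne' hρ)
  | some j => exact div_pos hq (ENNReal.toReal_pos (hr j).1.ne' (hr j).2)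

include hr hρ0 hρ hq hτ hrt in
lemma K0_ne_top : K0 d r ρ q t tj ≠ ∞ := by
  unfold K0
  refine ENNReal.mul_ne_top (ENNReal.rpow_ne_top_of_nonneg hq.le (mXK_ne_top d r ρ)) ?_
  refine ENNReal.mul_ne_top (by simp) (ENNReal.mul_ne_top (by simp) ?_)
  exact Fil.bC_ne_top (by simp) _ (exp_pos r hr ρ hρ0 hρ q hq) _
    (thE_gt r hr ρ hρ0 hρ q t hq hτ tj hrt)

include hr hρ0 hρ hq hqt hτ hrt ht in
lemma III_aux {Ω : Type} [MeasurableSpace Ω] (μ : Measure Ω) [SigmaFinite μ]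
    (U : (Fin d → ℝ) → Ω → ℝ≥0∞) (hU : Measurable (Function.uncurry U))
    (Hf : Fin m → (Fin d → ℝ) → Ω → ℝ≥0∞) (hHf : ∀ j, Measurable (Function.uncurry (Hf j)))
    (C_T : ℝ≥0∞)
    (hyp : ∀ ω, ∀ G : (Fin d → ℝ) → ℝ≥0∞, Measurable G → ∫⁻ x, (U x ω * G x) ^ q ≤
      C_T ^ q * ∫⁻ x, maximalX r ρ (fun j y => Hf j y ω) G x ^ q)
    (G : (Fin d → ℝ) → ℝ≥0∞) (Bd : ℝ≥0∞)
    (hBd : ∀ α : Fin d → Bool, ∫⁻ x, (⨆ n, pM α (fun j => (r j).toReal) ρ.toReal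
      (fun j x => eNorm (tj j) μ (Hf j x)) G n x) ^ q ≤ Bd)
    (g : (Fin d → ℝ) → Ω → ℝ≥0∞) (hg : Measurable (Function.uncurry g))
    (hgG : ∀ x, eNorm (ENNReal.ofReal (1 / q - 1 / t))⁻¹ μ (g x) ≤ G x) :
    ∫⁻ x, ∫⁻ ω, (U x ω * g x ω) ^ q ∂μ ≤ K0 d r ρ q t tj * C_T ^ q * Bd := by
  have hρ' : 0 < ρ.toReal := ENNReal.toReal_pos hρ0.ne' hρ
  have hr' : ∀ j, 0 < (r j).toReal := fun j => ENNReal.toReal_pos (hr j).1.ne' (hr j).2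
  have htp : 0 < t := hq.trans_le hqt
  set h : Option (Fin m) → (Fin d → ℝ) → Ω → ℝ≥0∞ :=
    oE (fun j y ω => Hf j y ω ^ (r j).toReal) (fun y ω => g y ω ^ ρ.toReal) with hh
  have hhm : ∀ j, Measurable (Function.uncurry (h j)) := by
    intro j
    cases j with
    | none => exact hg.pow_const _
    | some j => exact (hHf j).pow_const _
  set a := oE (fun j => q / (r j).toReal) (q / ρ.toReal) with ha
  set Z : (Fin d → Bool) → (Fin d → ℝ) → Ω → ℝ≥0∞ := fun α x ω =>
    ⨆ n, (grid d α).PR volume a (fun j y => h j y ω) n x with hZ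
  have hZm : ∀ α, Measurable (Function.uncurry (Z α)) := fun α =>
    Measurable.iSup fun n => (grid d α).measurable_PR_joint volume a h hhm n
  have hZm' : ∀ α, Measurable (fun ω => ∫⁻ x, Z α x ω) := fun α =>
    Measurable.lintegral_prod_left' (f := fun z : (Fin d → ℝ) × Ω => Z α z.1 z.2) (hZm α)
  have hUg : Measurable (fun z : (Fin d → ℝ) × Ω => (U z.1 z.2 * g z.1 z.2) ^ q) :=
    (hU.mul hg).pow_const _
  rw [lintegral_lintegral_swap hUg.aemeasurable]
  have step : ∀ ω, ∫⁻ x, (U x ω * g x ω) ^ q ≤ C_T ^ q * (mXK d r ρ ^ q * ∑ α, ∫⁻ x, Z α x ω) := by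
    intro ω
    have hgm : Measurable (fun x => g x ω) := hg.comp measurable_prodMk_right
    refine (hyp ω _ hgm).trans (mul_le_mul' le_rfl ?_)
    refine (maximalX_int r (fun j => (hr j).2) ρ hρ _ _ q hq).trans (mul_le_mul' le_rfl ?_)
    apply le_of_eq
    refine Finset.sum_congr rfl fun α _ => ?_
    apply lintegral_congr
    intro x
    rw [iSup_rpow' _ hq]
    simp only [hZ]
    refine iSup_congr fun n => ?_
    rw [pM_rpow _ _ _ _ _ _ _ q hq]
    congr 1
    funext j
    cases j <;> rfl
  have vs : ∀ α, ∫⁻ ω, (∫⁻ x, Z α x ω) ∂μ ≤ 2 * Fil.bC (2 ^ d) a (thE r ρ.toReal q t tj) * Bd := by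
    intro α
    rw [← lintegral_lintegral_swap (hZm α).aemeasurable]
    have hsum : ∑ j, ENNReal.ofReal (a j) * (thE r ρ.toReal q t tj j)⁻¹ = 1 := by
      rw [Fintype.sum_option]
      simp only [ha, thE, oE]
      rw [ofReal_mul_inv' hρ' q hq, inv_inv]
      simp_rw [fun j => ofReal_mul_inv' (t := tj j) (hr' j) q hq]
      rw [← Finset.mul_sum, ht, ← mul_add, ← ENNReal.ofReal_add, ← ENNReal.ofReal_mul hq.le]
      · rw [sub_add_cancel, mul_one_div_cancel hq.ne', ENNReal.ofReal_one]
      · rw [sub_nonneg]; exact one_div_le_one_div_of_le hq hqt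
      · positivity
    refine ((grid d α).vec_to_scalar volume (grid_fin d α) (grid_pos d α) μ (2 ^ d)
      (one_le_pow₀ (by norm_num)) (grid_dbl d α) a (exp_pos r hr ρ hρ0 hρ q hq)
      (thE r ρ.toReal q t tj) (thE_gt r hr ρ hρ0 hρ q t hq hτ tj hrt) hsum h hhm).trans ?_
    refine mul_le_mul' le_rfl ((lintegral_mono fun x => ?_).trans (hBd α))
    rw [iSup_rpow' _ hq]
    refine iSup_mono fun n => ?_
    rw [pM_rpow _ _ _ _ _ _ _ q hq]
    unfold Fil.PR
    refine Finset.prod_le_prod' fun j _ => ?_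
    refine ENNReal.rpow_le_rpow ?_ (exp_pos r hr ρ hρ0 hρ q hq j).le
    refine Fil.av_mono _ _ _ (fun y => ?_) x
    cases j with
    | none =>
      show eNorm ((ENNReal.ofReal (1 / q - 1 / t))⁻¹ * ENNReal.ofReal (1 / ρ.toReal)) μ
        (fun ω => g y ω ^ ρ.toReal) ≤ G y ^ ρ.toReal
      rw [eNorm_rpow μ _ hρ', mul_assoc, ← ENNReal.ofReal_mul (by positivity),
        one_div_mul_cancel hρ'.ne', ENNReal.ofReal_one, mul_one]
      exact ENNReal.rpow_le_rpow (hgG y) hρ'.le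
    | some j =>
      show eNorm (tj j * ENNReal.ofReal (1 / (r j).toReal)) μ
        (fun ω => Hf j y ω ^ (r j).toReal) ≤ eNorm (tj j) μ (Hf j y) ^ (r j).toReal
      rw [eNorm_rpow μ _ (hr' j), mul_assoc, ← ENNReal.ofReal_mul (by have := hr' j; positivity),
        one_div_mul_cancel (hr' j).ne', ENNReal.ofReal_one, mul_one]
  calc _ ≤ ∫⁻ ω, C_T ^ q * (mXK d r ρ ^ q * ∑ α, ∫⁻ x, Z α x ω) ∂μ := lintegral_mono step
    _ = C_T ^ q * (mXK d r ρ ^ q * ∑ α, ∫⁻ ω, (∫⁻ x, Z α x ω) ∂μ) := by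
        have hs : Measurable (fun ω => ∑ α, ∫⁻ x, Z α x ω) :=
          Finset.measurable_fun_sum _ fun α _ => hZm' α
        rw [lintegral_const_mul _ (hs.const_mul _), lintegral_const_mul _ hs,
          lintegral_finsetSum _ fun α _ => hZm' α]
    _ ≤ C_T ^ q * (mXK d r ρ ^ q * ∑ α : Fin d → Bool,
        2 * Fil.bC (2 ^ d) a (thE r ρ.toReal q t tj) * Bd) := by
        refine mul_le_mul' le_rfl (mul_le_mul' le_rfl (Finset.sum_le_sum fun α _ => vs α))
    _ = _ := by
        rw [Finset.sum_const, K0, nsmul_eq_mul]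
        simp only [Finset.card_univ, ← ha]
        ring

include hr hρ0 hρ hq hqt hτ hrt ht in
theorem III {Ω : Type} [MeasurableSpace Ω] (μ : Measure Ω) [SigmaFinite μ]
    (U : (Fin d → ℝ) → Ω → ℝ≥0∞) (hU : Measurable (Function.uncurry U))
    (Hf : Fin m → (Fin d → ℝ) → Ω → ℝ≥0∞) (hHf : ∀ j, Measurable (Function.uncurry (Hf j)))
    (C_T : ℝ≥0∞)
    (hyp : ∀ ω, ∀ G : (Fin d → ℝ) → ℝ≥0∞, Measurable G → ∫⁻ x, (U x ω * G x) ^ q ≤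
      C_T ^ q * ∫⁻ x, maximalX r ρ (fun j y => Hf j y ω) G x ^ q)
    (G : (Fin d → ℝ) → ℝ≥0∞) (hG : Measurable G) (Bd : ℝ≥0∞)
    (hBd : ∀ α : Fin d → Bool, ∫⁻ x, (⨆ n, pM α (fun j => (r j).toReal) ρ.toReal
      (fun j x => eNorm (tj j) μ (Hf j x)) G n x) ^ q ≤ Bd) :
    ∫⁻ x, (eNorm (ENNReal.ofReal t) μ (U x) * G x) ^ q ≤ K0 d r ρ q t tj * C_T ^ q * Bd := by
  have htp : 0 < t := hq.trans_le hqt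
  set V : ℕ → (Fin d → ℝ) → Ω → ℝ≥0∞ := fun n x ω =>
    (spanningSets μ n).indicator (fun ω => min (U x ω) n) ω with hV
  have hVm : ∀ n, Measurable (Function.uncurry (V n)) := by
    intro n
    have e : Function.uncurry (V n) = (Prod.snd ⁻¹' (spanningSets μ n)).indicator
        (fun z : (Fin d → ℝ) × Ω => min (Function.uncurry U z) n) := by
      funext z
      rcases z with ⟨x, ω⟩
      by_cases h : ω ∈ spanningSets μ n <;> simp [hV, Function.uncurry, h]
    rw [e]
    exact (hU.min measurable_const).indicator (measurable_snd (measurableSet_spanningSets μ n))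
  have hVs : ∀ n x, Measurable (V n x) := fun n x => by
    have := Fil.meas_sec (hVm n) x; exact this
  have hVle : ∀ n x ω, V n x ω ≤ min (U x ω) n := fun n x ω =>
    Set.indicator_le_self' (f := fun ω => min (U x ω) (n : ℝ≥0∞)) (fun _ _ => bot_le) ω
  have hVmono : ∀ x ω, Monotone (fun n => V n x ω) := by
    intro x ω k l hkl
    have h2 : (k : ℝ≥0∞) ≤ l := by exact_mod_cast hkl
    show (spanningSets μ k).indicator (fun ω => min (U x ω) (k : ℝ≥0∞)) ω ≤
      (spanningSets μ l).indicator (fun ω => min (U x ω) (l : ℝ≥0∞)) ω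
    refine (Set.indicator_le_indicator (g := fun ω => min (U x ω) (l : ℝ≥0∞)) ?_).trans
      (Set.indicator_le_indicator_of_subset (monotone_spanningSets μ hkl)
        (fun _ => bot_le) ω)
    exact min_le_min le_rfl h2
  have hVsup : ∀ x ω, ⨆ n, V n x ω = U x ω := by
    intro x ω
    apply le_antisymm
    · exact iSup_le fun k => (hVle k x ω).trans (min_le_left _ _)
    · apply le_of_forall_lt
      intro c hc
      obtain ⟨n, hn⟩ := ENNReal.exists_nat_gt (ne_top_of_lt hc)
      have hk : ω ∈ spanningSets μ (spanningSetsIndex μ ω) := mem_spanningSetsIndex μ ω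
      set k := spanningSetsIndex μ ω
      refine lt_of_lt_of_le ?_ (le_iSup _ (max n k))
      simp only [hV]
      rw [Set.indicator_of_mem]
      · apply lt_min hc (hn.trans_le _)
        exact_mod_cast le_max_left n k
      · exact monotone_spanningSets μ (le_max_right n k) hk
  set F : ℕ → (Fin d → ℝ) → ℝ≥0∞ := fun n x => eNorm (ENNReal.ofReal t) μ (V n x) with hF
  have hFm : ∀ n, Measurable (F n) := fun n => measurable_eNorm _ μ (V n) (hVm n)
  have hFfin : ∀ n x, F n x ≠ ∞ := by
    intro n x
    simp only [hF]
    rw [eNorm_ofReal htp]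
    apply ENNReal.rpow_ne_top_of_nonneg (by positivity)
    apply ne_top_of_le_ne_top (b := ∫⁻ ω in spanningSets μ n, (n : ℝ≥0∞) ^ t ∂μ)
    · rw [setLIntegral_const]
      exact ENNReal.mul_ne_top (ENNReal.rpow_ne_top_of_nonneg htp.le (by simp))
        (measure_spanningSets_lt_top μ n).ne
    · rw [← lintegral_indicator (measurableSet_spanningSets μ n)]
      apply lintegral_mono
      intro ω
      by_cases h : ω ∈ spanningSets μ n
      · simp only [hV, Set.indicator_of_mem h]
        exact ENNReal.rpow_le_rpow (min_le_right _ _) htp.le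
      · simp [hV, Set.indicator_of_notMem h, htp]
  have hFmono : ∀ x, Monotone (fun n => F n x) := fun x k l hkl =>
    eNorm_mono fun ω => hVmono x ω hkl
  have hFsup : ∀ x, ⨆ n, F n x = eNorm (ENNReal.ofReal t) μ (U x) := by
    intro x
    simp only [hF, eNorm_ofReal htp]
    rw [← iSup_rpow' _ (by positivity), ← lintegral_iSup]
    · simp_rw [← iSup_rpow' _ htp, hVsup]
    · intro n; exact (hVs n x).pow_const _
    · intro k l hkl ω; exact ENNReal.rpow_le_rpow (hVmono x ω hkl) htp.le
  have key : ∀ n, ∫⁻ x, (F n x * G x) ^ q ≤ K0 d r ρ q t tj * C_T ^ q * Bd := by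
    intro n
    set g : (Fin d → ℝ) → Ω → ℝ≥0∞ := fun x ω => G x * (V n x ω / F n x) ^ (t / q - 1) with hg
    have hφm : Measurable (fun z : (Fin d → ℝ) × Ω => (V n z.1 z.2 / F n z.1) ^ (t / q - 1)) :=
      ((hVm n).div ((hFm n).comp measurable_fst)).pow_const _
    have hgm : Measurable (Function.uncurry g) := (hG.comp measurable_fst).mul hφm
    have hτ0 : (0 : ℝ≥0∞) < (ENNReal.ofReal (1 / q - 1 / t))⁻¹ := by simp
    refine le_trans ?_ (III_aux r hr ρ hρ0 hρ q t hq hqt hτ tj hrt ht μ U hU Hf hHf C_T hyp G Bd hBd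
      g hgm ?_)
    · apply lintegral_mono
      intro x
      have hφs : Measurable (fun ω => (V n x ω / F n x) ^ (t / q - 1)) := by
        have := Fil.meas_sec hφm x; exact this
      have hms : Measurable (fun ω => (V n x ω * (V n x ω / F n x) ^ (t / q - 1)) ^ q) :=
        ((hVs n x).mul hφs).pow_const _
      calc (F n x * G x) ^ q = G x ^ q * F n x ^ q := by
            rw [mul_comm, ENNReal.mul_rpow_of_nonneg _ _ hq.le]
        _ ≤ G x ^ q * ∫⁻ ω, (V n x ω * (V n x ω / F n x) ^ (t / q - 1)) ^ q ∂μ := by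
            refine mul_le_mul' le_rfl ?_
            exact dual2 μ q t hq hqt (V n x) (hVs n x) (fun ω => ne_top_of_le_ne_top (by simp)
              ((hVle n x ω).trans (min_le_right _ _))) (F n x) rfl (hFfin n x)
        _ = ∫⁻ ω, G x ^ q * (V n x ω * (V n x ω / F n x) ^ (t / q - 1)) ^ q ∂μ := by
            rw [lintegral_const_mul _ hms]
        _ ≤ _ := by
            apply lintegral_mono
            intro ω
            show G x ^ q * (V n x ω * (V n x ω / F n x) ^ (t / q - 1)) ^ q ≤
              (U x ω * (G x * (V n x ω / F n x) ^ (t / q - 1))) ^ q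
            rw [← ENNReal.mul_rpow_of_nonneg _ _ hq.le, mul_left_comm]
            refine ENNReal.rpow_le_rpow (mul_le_mul' ?_ le_rfl) hq.le
            exact (hVle n x ω).trans (min_le_left _ _)
    · intro x
      have hφs : Measurable (fun ω => (V n x ω / F n x) ^ (t / q - 1)) := by
        have := Fil.meas_sec hφm x; exact this
      simp only [hg]
      rw [eNorm_const_mul _ hτ0 μ _ hφs]
      calc _ ≤ G x * 1 := mul_le_mul' le_rfl
            (dual1 μ q t hq hqt (V n x) (hVs n x) (F n x) rfl (hFfin n x))
        _ = G x := mul_one _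
  have e : ∀ x, (eNorm (ENNReal.ofReal t) μ (U x) * G x) ^ q = ⨆ n, (F n x * G x) ^ q := by
    intro x
    rw [← iSup_rpow' _ hq, ← ENNReal.iSup_mul, hFsup]
  simp_rw [e]
  rw [lintegral_iSup]
  · exact iSup_le key
  · intro k; exact ((hFm k).mul hG).pow_const _
  · intro k l hkl x
    exact ENNReal.rpow_le_rpow (mul_le_mul' (hFmono x hkl) le_rfl) hq.le
end

lemma eNorm_withDensity {X : Type*} [MeasurableSpace X] (v : Measure X) (p : ℝ≥0∞) (hp : 0 < p)
    (σ : X → ℝ≥0∞) (hσ : Measurable σ) (h0 : ∀ x, σ x ≠ 0)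
    (K : X → ℝ≥0∞) (hK : Measurable K) :
    eNorm p (v.withDensity σ) K = eNorm p v (fun x => K x * σ x ^ (p⁻¹).toReal) := by
  by_cases h : p = ∞
  · subst h
    simp only [eNorm_top, ENNReal.inv_top, ENNReal.toReal_zero, ENNReal.rpow_zero, mul_one]
    apply le_antisymm
    · exact essSup_mono_measure (withDensity_absolutelyContinuous v σ)
    · exact essSup_mono_measure (withDensity_absolutelyContinuous' hσ.aemeasurable
        (ae_of_all _ h0))
  · have hp0 : 0 < p.toReal := ENNReal.toReal_pos hp.ne' h
    rw [eNorm_of_ne_top h, eNorm_of_ne_top h]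
    congr 1
    have hm : Measurable fun x => K x ^ p.toReal := hK.pow_const _
    rw [lintegral_withDensity_eq_lintegral_mul _ hσ hm]
    apply lintegral_congr
    intro x
    rw [Pi.mul_apply, ENNReal.mul_rpow_of_nonneg _ _ hp0.le, ← ENNReal.rpow_mul, ENNReal.toReal_inv,
      inv_mul_cancel₀ hp0.ne', ENNReal.rpow_one, mul_comm]

lemma eNorm_change {X : Type*} [MeasurableSpace X] (v : Measure X) (p : ℝ≥0∞) (hp : 0 < p)
    (r c : ℝ) (hr : 0 < r) (hc : c = 1 / r - (p⁻¹).toReal)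
    (σ : X → ℝ≥0∞) (hσ : Measurable σ) (h0 : ∀ x, σ x ≠ 0) (h1 : ∀ x, σ x ≠ ∞)
    (F : X → ℝ≥0∞) (hF : Measurable F) :
    eNorm (p * ENNReal.ofReal (1 / r)) (v.withDensity σ) (fun x => F x ^ r / σ x) ^ (1 / r) =
      eNorm p v (fun x => F x * σ x ^ (-c)) := by
  have e : (fun x => F x ^ r / σ x) = fun x => (F x * σ x ^ (-(1 / r))) ^ r := by
    funext x
    rw [ENNReal.mul_rpow_of_nonneg _ _ hr.le, ← ENNReal.rpow_mul, div_eq_mul_inv]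
    congr 1
    rw [neg_mul, one_div_mul_cancel hr.ne', ENNReal.rpow_neg_one]
  have hm : Measurable (fun x => F x * σ x ^ (-(1 / r))) := hF.mul (hσ.pow_const _)
  rw [e, eNorm_rpow _ _ hr, ← ENNReal.rpow_mul, mul_one_div_cancel hr.ne', ENNReal.rpow_one,
    mul_assoc, ← ENNReal.ofReal_mul (by positivity), one_div_mul_cancel hr.ne', ENNReal.ofReal_one,
    mul_one, eNorm_withDensity v p hp σ hσ h0 _ hm]
  congr 1
  funext x
  rw [mul_assoc, ← ENNReal.rpow_add _ _ (h0 x) (h1 x)]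
  congr 2
  rw [hc]; ring

/-- Abstract weight data. -/
structure Wt (d m : ℕ) (c : Fin m → ℝ) (c0 : ℝ) (σ : Fin m → (Fin d → ℝ) → ℝ≥0∞)
    (σ0 : (Fin d → ℝ) → ℝ≥0∞) (W : ℝ≥0∞) : Prop where
  hσ : ∀ j, Measurable (σ j)
  h0 : ∀ j x, σ j x ≠ 0
  h1 : ∀ j x, σ j x ≠ ∞
  hσ0 : Measurable σ0
  h00 : ∀ x, σ0 x ≠ 0
  h01 : ∀ x, σ0 x ≠ ∞
  hone : ∀ x, (∏ j, σ j x ^ c j) * σ0 x ^ c0 = 1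
  hWtop : W ≠ ∞
  hW : ∀ α n x, (∏ j, (grid d α).av volume n (σ j) x ^ c j) *
    (grid d α).av volume n σ0 x ^ c0 ≤ W

lemma inv_toReal_ofReal {p : ℝ≥0∞} (hp : 0 < p) : ENNReal.ofReal (p⁻¹).toReal = p⁻¹ :=
  ENNReal.ofReal_toReal (by simpa using hp.ne')

section
variable {d m : ℕ} (r p : Fin m → ℝ≥0∞) (hr : ∀ j, 0 < r j ∧ r j ≠ ∞) (hrp : ∀ j, r j < p j)
  (q S R : ℝ) (hq : 0 < q) (hS : 0 ≤ S) (hR : 0 < R) (hRq : 1 / R = 1 / q - S)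
  (c : Fin m → ℝ) (hc : ∀ j, c j = 1 / (r j).toReal - ((p j)⁻¹).toReal)
  (P c0 : ℝ) (hP : P = ∑ j, ((p j)⁻¹).toReal) (hc0 : c0 = P - S) (hc0p : 0 < c0)
  (γ : ℝ) (hγ1 : 1 < γ) (hγ : ∀ j, 1 / (r j).toReal ≤ γ * c j) (hγ0 : 1 / R ≤ γ * c0)

include hr hrp hc in
lemma cc_pos (j) : 0 < c j := by
  rw [hc, sub_pos, one_div, ← ENNReal.toReal_inv]
  exact (ENNReal.toReal_lt_toReal (by simpa using ((hr j).1.trans (hrp j)).ne')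
    (by simpa using (hr j).1.ne')).2 (ENNReal.inv_lt_inv.2 (hrp j))

include hr hrp in
lemma th_gt (j) : 1 < p j * ENNReal.ofReal (1 / (r j).toReal) := by
  have h := ENNReal.toReal_pos (hr j).1.ne' (hr j).2
  rw [one_div, ENNReal.ofReal_inv_of_pos h, ENNReal.ofReal_toReal (hr j).2, ← div_eq_mul_inv,
      ENNReal.lt_div_iff_mul_lt (Or.inr (by simp)) (Or.inl (hr j).2), one_mul]
  exact hrp j

include hr hrp hq hS hR hRq hc hP hc0 hc0p hγ1 hγ hγ0 in
theorem core1 (hPq : P ≤ 1 / q) :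
    ∃ Cc : ℝ≥0∞, Cc ≠ ∞ ∧ ∀ (σ : Fin m → (Fin d → ℝ) → ℝ≥0∞) (σ0 : (Fin d → ℝ) → ℝ≥0∞) (W : ℝ≥0∞),
      Wt d m c c0 σ σ0 W → ∀ (H : Fin m → (Fin d → ℝ) → ℝ≥0∞) (F : (Fin d → ℝ) → ℝ≥0∞) (D : ℝ≥0∞),
      (∀ j, Measurable (H j)) → Measurable F → D ≠ ∞ →
      (∀ j, eNorm (p j) volume (fun x => H j x * σ j x ^ (-c j)) ≠ ∞) →
      (∀ (G : (Fin d → ℝ) → ℝ≥0∞) (Bd : ℝ≥0∞), Measurable G →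
        (∀ α : Fin d → Bool, ∫⁻ x, (⨆ n, pM α (fun j => (r j).toReal) R H G n x) ^ q ≤ Bd) →
        ∫⁻ x, (F x * G x) ^ q ≤ D * Bd) →
      eNorm (ENNReal.ofReal (1 / P)) volume (fun x => F x * σ0 x ^ c0) ≤
        Cc * D ^ (1 / q) * W ^ γ * ∏ j, eNorm (p j) volume (fun x => H j x * σ j x ^ (-c j)) := by
  have hP0 : 0 < P := by linarith
  have hr' : ∀ j, 0 < (r j).toReal := fun j => ENNReal.toReal_pos (hr j).1.ne' (hr j).2
  have hp' : ∀ j, 0 < p j := fun j => (hr j).1.trans (hrp j)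
  set β : ℝ := 1 / q - P with hβ
  have hβ0 : 0 ≤ β := by linarith
  set κ : ℝ≥0∞ := (ENNReal.ofReal β)⁻¹ with hκ
  have hκ0 : 0 < κ := by simp [hκ]
  have hκi : (κ⁻¹).toReal = β := by rw [hκ, inv_inv, ENNReal.toReal_ofReal hβ0]
  set a : Option (Fin m) → ℝ := oE (fun j => 1 / (r j).toReal) (1 / R) with ha
  set θ : Option (Fin m) → ℝ≥0∞ := oE (fun j => p j * ENNReal.ofReal (1 / (r j).toReal))
    (κ * ENNReal.ofReal (1 / R)) with hθ
  have ha0 : ∀ j, 0 < a j := by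
    intro j; cases j with
    | none => exact one_div_pos.2 hR
    | some j => exact one_div_pos.2 (hr' j)
  have hθ1 : ∀ j, 1 < θ j := by
    intro j; cases j with
    | none =>
      show 1 < κ * ENNReal.ofReal (1 / R)
      rw [hκ, mul_comm, ← div_eq_mul_inv, ENNReal.lt_div_iff_mul_lt (Or.inr (by simp))
        (Or.inl ENNReal.ofReal_ne_top), one_mul]
      refine (ENNReal.ofReal_lt_ofReal_iff (by positivity)).2 ?_
      rw [hRq, hβ]; linarith
    | some j => exact th_gt r p hr hrp j
  refine ⟨(Fil.doobC 2 * Fil.cD a q θ) ^ (1 / q), ?_, ?_⟩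
  · exact ENNReal.rpow_ne_top_of_nonneg (by positivity)
      (ENNReal.mul_ne_top (Fil.doobC_ne_top (by norm_num)) (Fil.cD_ne_top a ha0 q hq θ hθ1))
  intro σ σ0 W hw H F D hH hF hD hN hIII
  set N : ℝ≥0∞ := ∏ j, eNorm (p j) volume (fun x => H j x * σ j x ^ (-c j)) with hNdef
  set Y : ℝ≥0∞ := D * (Fil.doobC 2 * Fil.cD a q θ * (W ^ (γ * q) * N ^ q)) with hY
  have hym : Measurable (fun x => F x * σ0 x ^ c0) := hF.mul (hw.hσ0.pow_const _)
  have key : ∀ k, eNorm (ENNReal.ofReal (1 / P)) volume (trG (fun x => F x * σ0 x ^ c0) k) ≤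
      Y ^ (1 / q) := by
    intro k
    set y := trG (fun x => F x * σ0 x ^ c0) k with hy
    have hyM : Measurable y := trG_meas hym k
    have hyle : ∀ x, y x ≤ F x * σ0 x ^ c0 := fun x => (trG_le _ k x).trans (min_le_left _ _)
    have hyfin : ∀ x, y x ≠ ∞ := fun x =>
      ne_top_of_le_ne_top (by simp) ((trG_le _ k x).trans (min_le_right _ _))
    set I := ∫⁻ x, y x ^ (1 / P) with hI
    have hIfin : I ≠ ∞ := by
      apply ne_top_of_le_ne_top (b := ∫⁻ x in Metric.closedBall (0 : Fin d → ℝ) k,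
        (k : ℝ≥0∞) ^ (1 / P))
      · rw [setLIntegral_const]
        exact ENNReal.mul_ne_top (ENNReal.rpow_ne_top_of_nonneg (by positivity) (by simp))
          measure_closedBall_lt_top.ne
      · rw [← lintegral_indicator Metric.isClosed_closedBall.measurableSet]
        apply lintegral_mono
        intro x
        by_cases h : x ∈ Metric.closedBall (0 : Fin d → ℝ) k
        · rw [Set.indicator_of_mem h]
          exact ENNReal.rpow_le_rpow ((trG_le _ k x).trans (min_le_right _ _)) (by positivity)
        · simp only [hy, trG, Set.indicator_of_notMem h]
          rw [ENNReal.zero_rpow_of_pos (by positivity)]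
    set G : (Fin d → ℝ) → ℝ≥0∞ := fun x => y x ^ (1 / P * β) * σ0 x ^ c0 with hG
    have hGm : Measurable G := (hyM.pow_const _).mul (hw.hσ0.pow_const _)
    have hκG : eNorm κ volume (fun x => G x * σ0 x ^ (-c0)) ≤ I ^ β := by
      have e : (fun x => G x * σ0 x ^ (-c0)) = fun x => y x ^ (1 / P * β) := by
        funext x
        simp only [hG]
        rw [mul_assoc, ← ENNReal.rpow_add _ _ (hw.h00 x) (hw.h01 x), add_neg_cancel,
          ENNReal.rpow_zero, mul_one]
      rw [e]
      rcases hβ0.eq_or_lt with h | h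
      · rw [hκ, ← h]
        simp only [mul_zero, ENNReal.rpow_zero, ENNReal.ofReal_zero, ENNReal.inv_zero, eNorm_top]
        exact essSup_le_of_ae_le _ (ae_of_all _ fun _ => le_rfl)
      · rw [eNorm_rpow _ _ (by positivity)]
        have : κ * ENNReal.ofReal (1 / P * β) = ENNReal.ofReal (1 / P) := by
          rw [ENNReal.ofReal_mul (by positivity), hκ, mul_left_comm, ENNReal.inv_mul_cancel
            (by simpa using h) ENNReal.ofReal_ne_top, mul_one]
        rw [this, ENNReal.rpow_mul, eNorm_ofReal_rpow (by positivity)]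
    have hB : ∀ α : Fin d → Bool,
        ∫⁻ x, (⨆ n, pM α (fun j => (r j).toReal) R H G n x) ^ q ≤
        Fil.doobC 2 * Fil.cD a q θ * (W ^ (γ * q) * (N ^ q * I ^ (β * q))) := by
      intro α
      simp_rw [pM_PR]
      refine ((grid d α).weighted volume (grid_fin d α) (grid_pos d α) a
        (oE (fun j => ((p j)⁻¹).toReal) β) (oE c c0) ha0 ?_ ?_ ?_ q hq ?_ γ (by linarith) ?_ θ hθ1 ?_
        (oE σ σ0) ?_ ?_ ?_ ?_ W hw.hWtop ?_ _ ?_).trans ?_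
      · intro j; cases j with
        | none => exact hβ0
        | some j => exact ENNReal.toReal_nonneg
      · intro j; cases j with
        | none => exact hc0p
        | some j => exact cc_pos r p hr hrp c hc j
      · intro j; cases j with
        | none => show 1 / R = β + c0; rw [hRq, hβ, hc0]; ring
        | some j => show 1 / (r j).toReal = ((p j)⁻¹).toReal + c j; rw [hc]; ring
      · rw [Fintype.sum_option]
        show β + ∑ j, ((p j)⁻¹).toReal = _
        rw [← hP, hβ]; ring
      · intro j; cases j with
        | none => exact hγ0
        | some j => exact hγ j
      · intro j; cases j with
        | none =>
          show ENNReal.ofReal β = ENNReal.ofReal (1 / R) * (κ * ENNReal.ofReal (1 / R))⁻¹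
          rw [ofReal_mul_inv' hR 1 one_pos, hκ, inv_inv, ENNReal.ofReal_one, one_mul]
        | some j =>
          show ENNReal.ofReal ((p j)⁻¹).toReal = ENNReal.ofReal (1 / (r j).toReal) *
            (p j * ENNReal.ofReal (1 / (r j).toReal))⁻¹
          rw [ofReal_mul_inv' (hr' j) 1 one_pos, inv_toReal_ofReal (hp' j), ENNReal.ofReal_one,
            one_mul]
      · intro j; cases j with
        | none => exact hw.hσ0
        | some j => exact hw.hσ j
      · intro j; cases j with
        | none => exact hw.h00
        | some j => exact hw.h0 j
      · intro j; cases j with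
        | none => exact hw.h01
        | some j => exact hw.h1 j
      · intro x
        rw [Fintype.prod_option, mul_comm]
        exact hw.hone x
      · intro n x
        rw [Fintype.prod_option, mul_comm]
        exact hw.hW α n x
      · intro j; cases j with
        | none => exact hGm.pow_const _
        | some j => exact (hH j).pow_const _
      · refine mul_le_mul' le_rfl (mul_le_mul' le_rfl ?_)
        rw [Fintype.prod_option, mul_comm]
        refine mul_le_mul' (le_of_eq ?_) ?_
        · rw [hNdef, ← ENNReal.prod_rpow_of_nonneg hq.le]
          refine Finset.prod_congr rfl fun j _ => ?_
          show eNorm (p j * ENNReal.ofReal (1 / (r j).toReal)) (volume.withDensity (σ j))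
            (fun z => H j z ^ (r j).toReal / σ j z) ^ (1 / (r j).toReal * q) = _
          rw [ENNReal.rpow_mul, eNorm_change volume (p j) (hp' j) _ (c j) (hr' j) (hc j) (σ j)
            (hw.hσ j) (hw.h0 j) (hw.h1 j) (H j) (hH j)]
        · show eNorm (κ * ENNReal.ofReal (1 / R)) (volume.withDensity σ0)
            (fun z => G z ^ R / σ0 z) ^ (1 / R * q) ≤ _
          rw [ENNReal.rpow_mul, eNorm_change volume κ hκ0 R c0 hR
            (by rw [hκi, hRq, hβ, hc0]; ring) σ0
            hw.hσ0 hw.h00 hw.h01 G hGm, ENNReal.rpow_mul]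
          exact ENNReal.rpow_le_rpow hκG hq.le
    have h1 := hIII G _ hGm hB
    have h2 : I ≤ ∫⁻ x, (F x * G x) ^ q := by
      apply lintegral_mono
      intro x
      show y x ^ (1 / P) ≤ (F x * (y x ^ (1 / P * β) * σ0 x ^ c0)) ^ q
      by_cases h0 : y x = 0
      · rw [h0, ENNReal.zero_rpow_of_pos (by positivity)]; exact bot_le
      calc y x ^ (1 / P) = (y x * y x ^ (1 / P * β)) ^ q := by
            conv_rhs => rw [← ENNReal.rpow_one (y x), ← ENNReal.rpow_mul, one_mul,
              ← ENNReal.rpow_add _ _ h0 (hyfin x), ← ENNReal.rpow_mul]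
            congr 1
            rw [hβ]; field_simp; ring
        _ ≤ (F x * σ0 x ^ c0 * y x ^ (1 / P * β)) ^ q :=
            ENNReal.rpow_le_rpow (mul_le_mul' (hyle x) le_rfl) hq.le
        _ = _ := by congr 1; ring
    have h3 : I ≤ Y * I ^ (β * q) := by
      refine (h2.trans h1).trans (le_of_eq ?_)
      rw [hY]; ring
    rw [eNorm_ofReal (by positivity), one_div_one_div, ← hI]
    by_cases hI0 : I = 0
    · rw [hI0, ENNReal.zero_rpow_of_pos hP0]; exact bot_le
    have h4 : I ^ (P * q) ≤ Y := by
      have : P * q = 1 - β * q := by rw [hβ]; field_simp; ring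
      rw [this, ENNReal.rpow_sub _ _ hI0 hIfin, ENNReal.rpow_one]
      exact ENNReal.div_le_of_le_mul h3
    calc I ^ P = (I ^ (P * q)) ^ (1 / q) := by
          rw [← ENNReal.rpow_mul]; congr 1; field_simp
      _ ≤ _ := ENNReal.rpow_le_rpow h4 (by positivity)
  have fin : eNorm (ENNReal.ofReal (1 / P)) volume (fun x => F x * σ0 x ^ c0) ≤ Y ^ (1 / q) := by
    have e : (∫⁻ x, (F x * σ0 x ^ c0) ^ (1 / P)) =
        ⨆ k, ∫⁻ x, trG (fun x => F x * σ0 x ^ c0) k x ^ (1 / P) := by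
      rw [← lintegral_iSup]
      · apply lintegral_congr; intro x
        rw [← iSup_rpow' _ (by positivity), trG_iSup]
      · intro k; exact (trG_meas hym k).pow_const _
      · intro k l hkl x
        exact ENNReal.rpow_le_rpow (trG_mono _ x hkl) (by positivity)
    rw [eNorm_ofReal (by positivity), e, iSup_rpow' _ (by positivity)]
    refine iSup_le fun k => ?_
    rw [← eNorm_ofReal (by positivity)]
    exact key k
  refine fin.trans (le_of_eq ?_)
  have hq1 : 0 ≤ 1 / q := by positivity
  rw [hY, ENNReal.mul_rpow_of_nonneg _ _ hq1, ENNReal.mul_rpow_of_nonneg _ _ hq1,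
    ENNReal.mul_rpow_of_nonneg _ _ hq1, ENNReal.mul_rpow_of_nonneg _ _ hq1, ← ENNReal.rpow_mul, ← ENNReal.rpow_mul, mul_assoc γ,
    mul_one_div_cancel hq.ne', mul_one, ENNReal.rpow_one]
  ring
end

lemma cell_alg (a A : ℝ≥0∞) (q S R P c0 β : ℝ) (hq : 0 < q) (hR : 0 < R)
    (hRq : 1 / R = 1 / q - S) (hc0 : c0 = P - S) (hP0 : 0 < P) (hβ : β = P - 1 / q)
    (ha0 : a ≠ 0) (ha1 : a ≠ ∞) (hA0 : A ≠ 0) (hA1 : A ≠ ∞) :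
    (a * (A * ((a * A ^ (-S)) ^ (1 / P)) ^ (-(β * R))) ^ (1 / R)) ^ q = (A ^ c0 * a) ^ (1 / P) := by
  lift a to NNReal using ha1
  lift A to NNReal using hA1
  have hA0' : A ≠ 0 := by simpa using hA0
  have ha0' : a ≠ 0 := by simpa using ha0
  have hAS : A ^ (-S) ≠ 0 := by simp [NNReal.rpow_eq_zero_iff, hA0']
  have hx : (a * A ^ (-S)) ^ (1 / P) ≠ 0 := by
    simp only [ne_eq, NNReal.rpow_eq_zero_iff, mul_eq_zero, not_and_or]
    left; rintro (h | h)
    exacts [ha0' h, hAS (NNReal.rpow_eq_zero_iff.2 h)]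
  rw [← ENNReal.coe_rpow_of_ne_zero hA0', ← ENNReal.coe_mul,
    ← ENNReal.coe_rpow_of_nonneg _ (by positivity), ← ENNReal.coe_rpow_of_ne_zero hx,
    ← ENNReal.coe_mul, ← ENNReal.coe_rpow_of_nonneg _ (by positivity), ← ENNReal.coe_mul,
    ← ENNReal.coe_rpow_of_nonneg _ hq.le, ← ENNReal.coe_rpow_of_ne_zero hA0', ← ENNReal.coe_mul,
    ← ENNReal.coe_rpow_of_nonneg _ (by positivity)]
  congr 1
  simp only [NNReal.mul_rpow, ← NNReal.rpow_mul]
  have e1 : a ^ q * a ^ (1 / P * -(β * R) * (1 / R) * q) = a ^ (1 / P) := by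
    rw [← NNReal.rpow_add ha0']
    congr 1
    rw [hβ]; field_simp; ring
  have e2 : A ^ (1 / R * q) * A ^ (-S * (1 / P) * -(β * R) * (1 / R) * q) = A ^ (c0 * (1 / P)) := by
    rw [← NNReal.rpow_add hA0']
    congr 1
    have : -S * (1 / P) * -(β * R) * (1 / R) * q = S * β * q / P := by field_simp
    rw [this, hRq, hβ, hc0]; field_simp; ring
  calc _ = (a ^ q * a ^ (1 / P * -(β * R) * (1 / R) * q)) *
        (A ^ (1 / R * q) * A ^ (-S * (1 / P) * -(β * R) * (1 / R) * q)) := by ring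
    _ = _ := by rw [e1, e2]; ring

lemma cell_ineq {d m : ℕ} (α : Fin d → Bool) (r : Fin m → ℝ) (q S R P c0 β : ℝ)
    (hq : 0 < q) (hR : 0 < R) (hRq : 1 / R = 1 / q - S) (hc0 : c0 = P - S) (hc0p : 0 < c0)
    (hP0 : 0 < P) (hβ : β = P - 1 / q) (hβ0 : 0 < β)
    (H : Fin m → (Fin d → ℝ) → ℝ≥0∞) (σ0 Φ : (Fin d → ℝ) → ℝ≥0∞) (hσ0 : Measurable σ0)
    (n : ℤ) (x : Fin d → ℝ)
    (hA0 : (grid d α).av volume n σ0 x ≠ 0) (hA1 : (grid d α).av volume n σ0 x ≠ ∞)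
    (hΦ : ∀ y, (grid d α).PR volume (fun j => 1 / r j) (fun j y => H j y ^ r j) n y ≤
      Φ y ^ P * (grid d α).av volume n σ0 y ^ S) :
    pM α r R H (fun y => σ0 y ^ (1 / R) * Φ y ^ (-β)) n x ^ q ≤
      (grid d α).PR volume (oE (fun j => 1 / r j) c0) (oE (fun j y => H j y ^ r j) σ0) n x
        ^ (1 / P) := by
  set A := (grid d α).av volume n σ0 x with hA
  set a := (grid d α).PR volume (fun j => 1 / r j) (fun j y => H j y ^ r j) n x with ha
  have e1 : (grid d α).PR volume (oE (fun j => 1 / r j) c0) (oE (fun j y => H j y ^ r j) σ0) n x =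
      A ^ c0 * a := by
    unfold Fil.PR at ha ⊢
    rw [Fintype.prod_option]; rfl
  rw [e1]
  set V := (grid d α).av volume n (fun y => (σ0 y ^ (1 / R) * Φ y ^ (-β)) ^ R) x with hV
  have e2 : pM α r R H (fun y => σ0 y ^ (1 / R) * Φ y ^ (-β)) n x = a * V ^ (1 / R) := rfl
  rw [e2]
  by_cases ha0 : a = 0
  · rw [ha0, zero_mul, ENNReal.zero_rpow_of_pos hq]; exact bot_le
  by_cases ha1 : a = ∞
  · have : A ^ c0 ≠ 0 := by
      rw [Ne, ENNReal.rpow_eq_zero_iff]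
      rintro (⟨h, _⟩ | ⟨h, _⟩)
      · exact hA0 h
      · exact hA1 h
    rw [ha1, ENNReal.mul_top this, ENNReal.top_rpow_of_pos (by positivity)]; exact le_top
  have hAS0 : A ^ S ≠ 0 := by
      rw [Ne, ENNReal.rpow_eq_zero_iff]
      rintro (⟨h, _⟩ | ⟨h, _⟩)
      · exact hA0 h
      · exact hA1 h
  have hAS1 : A ^ S ≠ ∞ := by
      rw [Ne, ENNReal.rpow_eq_top_iff]
      rintro (⟨h, _⟩ | ⟨h, _⟩)
      · exact hA0 h
      · exact hA1 h
  set K := ((a * A ^ (-S)) ^ (1 / P)) ^ (-(β * R)) with hK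
  have hB : ∀ y ∈ (grid d α).cell n x, Φ y ^ (-(β * R)) ≤ K := by
    intro y hy
    have h1 := hΦ y
    rw [(grid d α).PR_eq _ _ _ hy, (grid d α).av_eq _ _ hy] at h1
    have h2 : a * A ^ (-S) ≤ Φ y ^ P := by
      rw [ENNReal.rpow_neg, ← div_eq_mul_inv]
      exact ENNReal.div_le_of_le_mul h1
    have h3 : (a * A ^ (-S)) ^ (1 / P) ≤ Φ y := by
      calc _ ≤ (Φ y ^ P) ^ (1 / P) := ENNReal.rpow_le_rpow h2 (by positivity)
        _ = Φ y := by rw [← ENNReal.rpow_mul, mul_one_div_cancel hP0.ne', ENNReal.rpow_one]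
    rw [hK, ENNReal.rpow_neg, ENNReal.rpow_neg]
    exact ENNReal.inv_le_inv.2 (ENNReal.rpow_le_rpow h3 (by positivity))
  have hVK : V ≤ A * K := by
    rw [hV, hA]
    unfold Fil.av
    rw [mul_comm, ← mul_div_assoc, ← lintegral_const_mul K hσ0]
    refine ENNReal.div_le_div_right ?_ _
    apply setLIntegral_mono' ((grid d α).meas_cell n x)
    intro y hy
    rw [ENNReal.mul_rpow_of_nonneg _ _ hR.le, ← ENNReal.rpow_mul, ← ENNReal.rpow_mul,
      one_div_mul_cancel hR.ne', ENNReal.rpow_one, mul_comm, neg_mul]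
    exact mul_le_mul' (hB y hy) le_rfl
  calc (a * V ^ (1 / R)) ^ q ≤ (a * (A * K) ^ (1 / R)) ^ q :=
        ENNReal.rpow_le_rpow (mul_le_mul' le_rfl (ENNReal.rpow_le_rpow hVK (by positivity))) hq.le
    _ = _ := cell_alg a A q S R P c0 β hq hR hRq hc0 hP0 hβ ha0 ha1 hA0 hA1

section
variable {d m : ℕ} (r p : Fin m → ℝ≥0∞) (hr : ∀ j, 0 < r j ∧ r j ≠ ∞) (hrp : ∀ j, r j < p j)
  (q S R : ℝ) (hq : 0 < q) (hS : 0 ≤ S) (hR : 0 < R) (hRq : 1 / R = 1 / q - S)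
  (c : Fin m → ℝ) (hc : ∀ j, c j = 1 / (r j).toReal - ((p j)⁻¹).toReal)
  (P c0 : ℝ) (hP : P = ∑ j, ((p j)⁻¹).toReal) (hc0 : c0 = P - S) (hc0p : 0 < c0)
  (γ : ℝ) (hγ1 : 1 < γ) (hγ : ∀ j, 1 / (r j).toReal ≤ γ * c j)

include hr hrp hq hS hR hRq hc hP hc0 hc0p hγ1 hγ in
theorem core2 (hPq : 1 / q < P) :
    ∃ Cc : ℝ≥0∞, Cc ≠ ∞ ∧ ∀ (σ : Fin m → (Fin d → ℝ) → ℝ≥0∞) (σ0 : (Fin d → ℝ) → ℝ≥0∞) (W : ℝ≥0∞),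
      Wt d m c c0 σ σ0 W → ∀ (H : Fin m → (Fin d → ℝ) → ℝ≥0∞) (F : (Fin d → ℝ) → ℝ≥0∞) (D : ℝ≥0∞),
      (∀ j, Measurable (H j)) → Measurable F → D ≠ ∞ →
      (∀ j, eNorm (p j) volume (fun x => H j x * σ j x ^ (-c j)) ≠ ∞) →
      (∀ (G : (Fin d → ℝ) → ℝ≥0∞) (Bd : ℝ≥0∞), Measurable G →
        (∀ α : Fin d → Bool, ∫⁻ x, (⨆ n, pM α (fun j => (r j).toReal) R H G n x) ^ q ≤ Bd) →
        ∫⁻ x, (F x * G x) ^ q ≤ D * Bd) →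
      eNorm (ENNReal.ofReal (1 / P)) volume (fun x => F x * σ0 x ^ c0) ≤
        Cc * D ^ (1 / q) * W ^ γ * ∏ j, eNorm (p j) volume (fun x => H j x * σ j x ^ (-c j)) := by
  have hP0 : 0 < P := by linarith
  have hPi : 0 < 1 / P := by positivity
  have hr' : ∀ j, 0 < (r j).toReal := fun j => ENNReal.toReal_pos (hr j).1.ne' (hr j).2
  have hp' : ∀ j, 0 < p j := fun j => (hr j).1.trans (hrp j)
  obtain ⟨β, hβ⟩ : ∃ β, β = P - 1 / q := ⟨_, rfl⟩
  have hβ0 : 0 < β := by linarith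
  set a : Fin m → ℝ := fun j => 1 / (r j).toReal with ha
  set b : Fin m → ℝ := fun j => ((p j)⁻¹).toReal with hb
  set θ : Fin m → ℝ≥0∞ := fun j => p j * ENNReal.ofReal (1 / (r j).toReal) with hθ
  have ha0 : ∀ j, 0 < a j := fun j => one_div_pos.2 (hr' j)
  have hθ1 : ∀ j, 1 < θ j := fun j => th_gt r p hr hrp j
  have hcp : ∀ j, 0 < c j := cc_pos r p hr hrp c hc
  have hao : ∀ o, 0 < oE a c0 o := by
    rintro (_ | j)
    exacts [hc0p, ha0 j]
  have hθo : ∀ o, 1 < oE θ ∞ o := by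
    rintro (_ | j)
    exacts [ENNReal.one_lt_top, hθ1 j]
  have hbq : ∑ j, b j = 1 / (1 / P) := by rw [one_div_one_div, hP]
  have hγ' : 1 < 1 / P * ((γ - 1) * c0 + 1 / (1 / P)) := by
    have h1 : 0 < (γ - 1) * c0 := mul_pos (by linarith) hc0p
    have : 1 / P * ((γ - 1) * c0 + 1 / (1 / P)) = 1 + 1 / P * ((γ - 1) * c0) := by
      field_simp; ring
    rw [this]
    have := mul_pos hPi h1
    linarith
  have hθe : ∀ j, ENNReal.ofReal (b j) = ENNReal.ofReal (a j) * (θ j)⁻¹ := by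
    intro j
    show ENNReal.ofReal ((p j)⁻¹).toReal = ENNReal.ofReal (1 / (r j).toReal) *
            (p j * ENNReal.ofReal (1 / (r j).toReal))⁻¹
    rw [ofReal_mul_inv' (hr' j) 1 one_pos, inv_toReal_ofReal (hp' j), ENNReal.ofReal_one,
            one_mul]
  obtain ⟨C2, hC2⟩ : ∃ C, C = Fil.doobC 2 * Fil.cD (oE a c0) (1 / P) (oE θ ∞) := ⟨_, rfl⟩
  obtain ⟨C3, hC3⟩ : ∃ C, C = Fil.doobC (1 / P * ((γ - 1) * c0 + 1 / (1 / P))) *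
    Fil.cD a (1 / P) θ := ⟨_, rfl⟩
  have hC2t : C2 ≠ ∞ := by
    rw [hC2]
    exact ENNReal.mul_ne_top (Fil.doobC_ne_top (by norm_num)) (Fil.cD_ne_top _ hao _ hPi _ hθo)
  have hC3t : C3 ≠ ∞ := by
    rw [hC3]
    exact ENNReal.mul_ne_top (Fil.doobC_ne_top hγ') (Fil.cD_ne_top _ ha0 _ hPi _ hθ1)
  obtain ⟨C4, hC4⟩ : ∃ C : ℝ≥0∞, C = (Fintype.card (Fin d → Bool) : ℝ≥0∞) * C3 := ⟨_, rfl⟩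
  have hC4t : C4 ≠ ∞ := by
    rw [hC4]; exact ENNReal.mul_ne_top (by simp) hC3t
  refine ⟨C2 ^ (1 / q) * C4 ^ β, ?_, ?_⟩
  · exact ENNReal.mul_ne_top (ENNReal.rpow_ne_top_of_nonneg (by positivity) hC2t)
      (ENNReal.rpow_ne_top_of_nonneg hβ0.le hC4t)
  intro σ σ0 W hw H F D hH hF hD hN hIII
  obtain ⟨N, hNdef⟩ : ∃ N, N = ∏ j, eNorm (p j) volume (fun x => H j x * σ j x ^ (-c j)) := ⟨_, rfl⟩
  have hNt : N ≠ ∞ := by rw [hNdef]; exact ENNReal.prod_ne_top fun j _ => hN j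
  obtain ⟨Z, hZ⟩ : ∃ Z, Z = W ^ (γ * (1 / P)) * N ^ (1 / P) := ⟨_, rfl⟩
  have hZt : Z ≠ ∞ := by
    rw [hZ]
    exact ENNReal.mul_ne_top (ENNReal.rpow_ne_top_of_nonneg (by positivity) hw.hWtop)
      (ENNReal.rpow_ne_top_of_nonneg hPi.le hNt)
  have hprod : ∏ j, eNorm (θ j) (volume.withDensity (σ j))
      (fun z => H j z ^ (r j).toReal / σ j z) ^ (a j * (1 / P)) = N ^ (1 / P) := by
    rw [hNdef, ← ENNReal.prod_rpow_of_nonneg hPi.le]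
    refine Finset.prod_congr rfl fun j _ => ?_
    rw [ENNReal.rpow_mul, eNorm_change volume (p j) (hp' j) _ (c j) (hr' j) (hc j) (σ j)
            (hw.hσ j) (hw.h0 j) (hw.h1 j) (H j) (hH j)]
  have hΦex : ∀ α : Fin d → Bool, ∃ Φ : (Fin d → ℝ) → ℝ≥0∞, Measurable Φ ∧
      (∀ n x, (grid d α).PR volume a (fun j y => H j y ^ (r j).toReal) n x ≤
        Φ x ^ P * (grid d α).av volume n σ0 x ^ S) ∧
      ∫⁻ x, Φ x * σ0 x ≤ C3 * Z := by
    intro α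
    obtain ⟨Φ, h1, h2, h3⟩ := (grid d α).phi_lemma volume (grid_fin d α) (grid_pos d α) a b c ha0
      (fun j => ENNReal.toReal_nonneg) hcp (fun j => by rw [hc]; ring) (1 / P) hPi hbq
      c0 S hc0p hS (by rw [one_div_one_div, hc0]; ring) γ hγ1 hγ θ hθ1 hθe σ hw.hσ hw.h0 hw.h1
      σ0 hw.hσ0 hw.h00 hw.h01 hw.hone W hw.hWtop (hw.hW α)
      (fun j y => H j y ^ (r j).toReal) (fun j => (hH j).pow_const _)
    rw [one_div_one_div] at h2
    refine ⟨Φ, h1, h2, ?_⟩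
    rw [hprod, ← hZ] at h3
    rw [hC3]; exact h3
  choose Φα hΦm hΦ1 hΦ2 using hΦex
  set Φ : (Fin d → ℝ) → ℝ≥0∞ := fun x => ∑ α, Φα α x with hΦ
  have hΦM : Measurable Φ := Finset.measurable_sum _ fun α _ => hΦm α
  have hΦint : ∫⁻ x, Φ x * σ0 x ≤ C4 * Z := by
    simp only [hΦ, Finset.sum_mul]
    have hm : ∀ α ∈ (Finset.univ : Finset (Fin d → Bool)), Measurable (fun x => Φα α x * σ0 x) :=
      fun α _ => (hΦm α).mul hw.hσ0
    rw [lintegral_finsetSum _ hm]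
    refine (Finset.sum_le_sum fun α _ => hΦ2 α).trans (le_of_eq ?_)
    rw [Finset.sum_const, nsmul_eq_mul, hC4, mul_assoc]; rfl
  set G : (Fin d → ℝ) → ℝ≥0∞ := fun y => σ0 y ^ (1 / R) * Φ y ^ (-β) with hG
  have hGm : Measurable G := (hw.hσ0.pow_const _).mul (hΦM.pow_const _)
  have hBd : ∀ α : Fin d → Bool,
      ∫⁻ x, (⨆ n, pM α (fun j => (r j).toReal) R H G n x) ^ q ≤ C2 * Z := by
    intro α
    have hWo : ∀ n x, ∏ o, (grid d α).av volume n (oE σ σ0 o) x ^ (oE c c0 o) ≤ W := by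
      intro n x
      rw [Fintype.prod_option, mul_comm]
      exact hw.hW α n x
    have hso : ∀ o, Measurable (oE σ σ0 o) := by
      rintro (_ | j)
      exacts [hw.hσ0, hw.hσ j]
    have hs0 : ∀ o x, oE σ σ0 o x ≠ 0 := by
      rintro (_ | j)
      exacts [hw.h00, hw.h0 j]
    have hs1 : ∀ o x, oE σ σ0 o x ≠ ∞ := by
      rintro (_ | j)
      exacts [hw.h01, hw.h1 j]
    have hco : ∀ o, 0 < oE c c0 o := by
      rintro (_ | j)
      exacts [hc0p, hcp j]
    have hw1 := (grid d α).weighted volume (grid_fin d α) (grid_pos d α) (oE a c0)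
        (oE b 0) (oE c c0) hao ?_ hco ?_ (1 / P) hPi ?_ γ (by linarith) ?_ (oE θ ∞) hθo ?_
        (oE σ σ0) hso hs0 hs1 ?_ W hw.hWtop hWo
        (oE (fun j y => H j y ^ (r j).toReal) σ0) ?_
    · refine (le_trans ?_ hw1).trans ?_
      · apply lintegral_mono
        intro x
        show (⨆ n, pM α (fun j => (r j).toReal) R H G n x) ^ q ≤ _
        rw [iSup_rpow' _ hq]
        refine iSup_le fun n => ?_
        refine (cell_ineq α (fun j => (r j).toReal) q S R P c0 β hq hR hRq hc0 hc0p hP0 hβ hβ0 H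
          σ0 Φ hw.hσ0 n x ((grid d α).av_pos volume (grid_fin d α) (grid_pos d α) σ0 hw.hσ0 hw.h00 n x)
          ?_ ?_).trans ?_
        · exact (grid d α).av_ne_top volume (grid_fin d α) (grid_pos d α) (oE σ σ0) hso hs0
            (oE c c0) hco n x (ne_top_of_le_ne_top hw.hWtop (hWo n x)) none
        · intro y
          refine (hΦ1 α n y).trans (mul_le_mul' (ENNReal.rpow_le_rpow ?_ hP0.le) le_rfl)
          exact Finset.single_le_sum (f := fun α => Φα α y) (fun _ _ => bot_le) (Finset.mem_univ α)
        · exact ENNReal.rpow_le_rpow (le_iSup (fun n => (grid d α).PR volume (oE a c0)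
            (oE (fun j y => H j y ^ (r j).toReal) σ0) n x) n) hPi.le
      · rw [hC2, hZ]
        refine mul_le_mul' le_rfl (mul_le_mul' le_rfl ?_)
        rw [Fintype.prod_option, ← hprod]
        refine (mul_le_mul' ?_ le_rfl).trans (one_mul _).le
        show eNorm ∞ (volume.withDensity σ0) (fun z => σ0 z / σ0 z) ^ (c0 * (1 / P)) ≤ 1
        refine ENNReal.rpow_le_one ?_ (by positivity)
        rw [eNorm_top]
        exact essSup_le_of_ae_le _ (ae_of_all _ fun x => ENNReal.div_self_le_one)
    · rintro (_ | j)
      exacts [le_rfl, ENNReal.toReal_nonneg]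
    · rintro (_ | j)
      · show c0 = 0 + c0; ring
      · show 1 / (r j).toReal = ((p j)⁻¹).toReal + c j; rw [hc]; ring
    · rw [Fintype.sum_option]
      show 0 + ∑ j, b j = _
      rw [zero_add, hbq]
    · rintro (_ | j)
      · show c0 ≤ γ * c0
        nlinarith
      · exact hγ j
    · rintro (_ | j)
      · show ENNReal.ofReal 0 = ENNReal.ofReal c0 * (∞ : ℝ≥0∞)⁻¹
        simp
      · exact hθe j
    · intro x
      rw [Fintype.prod_option, mul_comm]
      exact hw.hone x
    · rintro (_ | j)
      · exact hw.hσ0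
      · exact (hH j).pow_const _
  have hI := hIII G _ hGm hBd
  have hFGm : Measurable (fun x => (F x * G x) ^ q) := (hF.mul hGm).pow_const _
  have hae1 : ∀ᵐ x, (F x * G x) ^ q < ∞ := ae_lt_top hFGm
    (ne_top_of_le_ne_top (ENNReal.mul_ne_top hD (ENNReal.mul_ne_top hC2t hZt)) hI)
  have hΦσ : Measurable (fun x => Φ x * σ0 x) := hΦM.mul hw.hσ0
  have hae2 : ∀ᵐ x, Φ x * σ0 x < ∞ := ae_lt_top hΦσ
    (ne_top_of_le_ne_top (ENNReal.mul_ne_top hC4t hZt) hΦint)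
  have hpt : ∀ᵐ x, (F x * σ0 x ^ c0) ^ (1 / P) ≤
      ((F x * G x) ^ q) ^ (1 / (P * q)) * (Φ x * σ0 x) ^ (β / P) := by
    filter_upwards [hae1, hae2] with x h1 h2
    have h1' : F x * G x ≠ ∞ := by
      intro h; rw [h, ENNReal.top_rpow_of_pos hq] at h1; exact lt_irrefl _ h1
    have hΦt : Φ x ≠ ∞ := by
      intro h; rw [h, ENNReal.top_mul (hw.h00 x)] at h2; exact lt_irrefl _ h2
    have hsR : σ0 x ^ (1 / R) ≠ 0 := by
      rw [Ne, ENNReal.rpow_eq_zero_iff]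
      rintro (⟨h, _⟩ | ⟨h, _⟩)
      · exact hw.h00 x h
      · exact hw.h01 x h
    by_cases hΦ0 : Φ x = 0
    · have hGx : G x = ∞ := by
        simp only [hG]
        rw [hΦ0, ENNReal.zero_rpow_of_neg (by linarith), ENNReal.mul_top hsR]
      have hF0 : F x = 0 := by
        by_contra h
        apply h1'
        rw [hGx, ENNReal.mul_top h]
      rw [hF0, zero_mul, ENNReal.zero_rpow_of_pos hPi]; exact bot_le
    · have e : F x * σ0 x ^ c0 = F x * G x * (Φ x * σ0 x) ^ β := by
        simp only [hG]
        rw [ENNReal.mul_rpow_of_nonneg _ _ hβ0.le]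
        have e3 : Φ x ^ (-β) * Φ x ^ β = 1 := by
          rw [← ENNReal.rpow_add _ _ hΦ0 hΦt, neg_add_cancel, ENNReal.rpow_zero]
        have e4 : σ0 x ^ (1 / R) * σ0 x ^ β = σ0 x ^ c0 := by
          rw [← ENNReal.rpow_add _ _ (hw.h00 x) (hw.h01 x)]
          congr 1
          rw [hRq, hβ, hc0]; ring
        calc F x * σ0 x ^ c0 = F x * (σ0 x ^ (1 / R) * σ0 x ^ β) * (Φ x ^ (-β) * Φ x ^ β) := by
              rw [e3, e4, mul_one]
          _ = _ := by ring
      rw [e, ENNReal.mul_rpow_of_nonneg _ _ hPi.le, ← ENNReal.rpow_mul, ← ENNReal.rpow_mul]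
      apply le_of_eq
      congr 2
      · field_simp
      · field_simp
  have hexp : 1 / (P * q) + β / P = 1 := by rw [hβ]; field_simp; ring
  have hH1 : ∫⁻ x, (F x * σ0 x ^ c0) ^ (1 / P) ≤
      (D * (C2 * Z)) ^ (1 / (P * q)) * (C4 * Z) ^ (β / P) := by
    refine (lintegral_mono_ae hpt).trans ?_
    refine (ENNReal.lintegral_mul_norm_pow_le hFGm.aemeasurable hΦσ.aemeasurable
      (by positivity) (by positivity) hexp).trans ?_
    exact mul_le_mul' (ENNReal.rpow_le_rpow hI (by positivity))
      (ENNReal.rpow_le_rpow hΦint (by positivity))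
  rw [eNorm_ofReal hPi, one_div_one_div, ← hNdef]
  refine (ENNReal.rpow_le_rpow hH1 hP0.le).trans (le_of_eq ?_)
  have e1 : 1 / (P * q) * P = 1 / q := by field_simp
  have e2 : β / P * P = β := by field_simp
  have hq1 : 0 ≤ 1 / q := by positivity
  rw [ENNReal.mul_rpow_of_nonneg _ _ hP0.le, ← ENNReal.rpow_mul, ← ENNReal.rpow_mul, e1, e2,
    ENNReal.mul_rpow_of_nonneg _ _ hq1, ENNReal.mul_rpow_of_nonneg _ _ hq1,
    ENNReal.mul_rpow_of_nonneg _ _ hβ0.le]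
  have e3 : Z ^ (1 / q) * Z ^ β = W ^ γ * N := by
    rw [← ENNReal.rpow_add_of_nonneg _ _ hq1 hβ0.le]
    have : 1 / q + β = P := by rw [hβ]; ring
    rw [this, hZ, ENNReal.mul_rpow_of_nonneg _ _ hP0.le, ← ENNReal.rpow_mul, ← ENNReal.rpow_mul,
      one_div_mul_cancel hP0.ne', ENNReal.rpow_one, mul_assoc, one_div_mul_cancel hP0.ne', mul_one]
  calc _ = C2 ^ (1 / q) * C4 ^ β * D ^ (1 / q) * (Z ^ (1 / q) * Z ^ β) := by ring
    _ = _ := by rw [e3]; ring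
end

lemma avg_gcube {d : ℕ} (α : Fin d → Bool) (n : ℤ) (x : Fin d → ℝ) (e : ℝ≥0∞) (c : ℝ) (hc : 0 < c)
    (he : e.toReal = c) (he0 : e ≠ 0) (F σ : (Fin d → ℝ) → ℝ≥0∞)
    (hF : ∀ y, F y ^ (1 / c) = σ y) :
    avg e⁻¹ F (gcube d α n x) = (grid d α).av volume n σ x ^ c := by
  have h1 : e⁻¹ ≠ ∞ := by simpa using he0
  rw [avg, if_neg h1, ENNReal.toReal_inv, he]
  unfold Fil.av Cube.vol
  rw [gcube_set, one_div, inv_inv]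
  simp_rw [← hF, one_div]

lemma mkWt {d m : ℕ} (r p : Fin m → ℝ≥0∞) (s : ℝ≥0∞) (c : Fin m → ℝ) (c0 : ℝ)
    (hcp : ∀ j, 0 < c j) (hc0p : 0 < c0)
    (hc : ∀ j, ((r j)⁻¹ - (p j)⁻¹).toReal = c j) (hc0 : ((∑ j, (p j)⁻¹) - s⁻¹).toReal = c0)
    (w : Fin m → (Fin d → ℝ) → ℝ) (hwm : ∀ j, Measurable (w j)) (hw0 : ∀ j x, 0 < w j x)
    (hA : aConst p r s w ≠ ∞) :
    Wt d m c c0 (fun j x => ENNReal.ofReal (w j x) ^ (-(1 / c j)))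
      (fun x => ENNReal.ofReal (∏ j, w j x) ^ (1 / c0)) (aConst p r s w) := by
  have hn0 : ∀ j x, ENNReal.ofReal (w j x) ≠ 0 := fun j x => by simpa using hw0 j x
  have hp0 : ∀ x, 0 < ∏ j, w j x := fun x => Finset.prod_pos fun j _ => hw0 j x
  have hpn0 : ∀ x, ENNReal.ofReal (∏ j, w j x) ≠ 0 := fun x => by simpa using hp0 x
  have hpm : Measurable (fun x => ∏ j, w j x) := Finset.measurable_fun_prod _ fun j _ => hwm j
  refine ⟨fun j => (hwm j).ennreal_ofReal.pow_const _, ?_, ?_, hpm.ennreal_ofReal.pow_const _, ?_, ?_,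
    ?_, hA, ?_⟩
  · intro j x h
    rcases ENNReal.rpow_eq_zero_iff.1 h with h | h
    · exact hn0 j x h.1
    · exact ENNReal.ofReal_ne_top h.1
  · intro j x h
    rcases ENNReal.rpow_eq_top_iff.1 h with h | h
    · exact hn0 j x h.1
    · exact ENNReal.ofReal_ne_top h.1
  · intro x h
    rcases ENNReal.rpow_eq_zero_iff.1 h with h | h
    · exact hpn0 x h.1
    · exact ENNReal.ofReal_ne_top h.1
  · intro x h
    rcases ENNReal.rpow_eq_top_iff.1 h with h | h
    · exact hpn0 x h.1
    · exact ENNReal.ofReal_ne_top h.1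
  · intro x
    have e1 : ∀ j, (ENNReal.ofReal (w j x) ^ (-(1 / c j))) ^ c j = (ENNReal.ofReal (w j x))⁻¹ := by
      intro j
      rw [← ENNReal.rpow_mul, neg_mul, one_div_mul_cancel (hcp j).ne', ENNReal.rpow_neg_one]
    simp_rw [e1]
    rw [← ENNReal.rpow_mul, one_div_mul_cancel hc0p.ne', ENNReal.rpow_one,
      ENNReal.ofReal_prod_of_nonneg fun j _ => (hw0 j x).le, ← Finset.prod_mul_distrib]
    exact Finset.prod_eq_one fun j _ => ENNReal.inv_mul_cancel (hn0 j x) ENNReal.ofReal_ne_top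
  · intro α n x
    refine le_trans (le_of_eq ?_) (le_iSup _ (gcube d α n x))
    congr 1
    · refine Finset.prod_congr rfl fun j _ => ?_
      refine (avg_gcube α n x _ (c j) (hcp j) (hc j) ?_ _ _ ?_).symm
      · intro h; have := hc j; rw [h] at this; simp at this; exact (hcp j).ne this
      · intro y
        rw [ENNReal.ofReal_inv_of_pos (hw0 j y), ENNReal.inv_rpow, ENNReal.rpow_neg]
    · refine (avg_gcube α n x _ c0 hc0p hc0 ?_ _ _ ?_).symm
      · intro h; rw [h] at hc0; simp at hc0; exact hc0p.ne hc0
      · intro y; rfl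

lemma aConst_pos {d m : ℕ} (c : Fin m → ℝ) (c0 : ℝ) (hc0p : 0 < c0)
    (hcp : ∀ j, 0 < c j)
    (σ : Fin m → (Fin d → ℝ) → ℝ≥0∞) (σ0 : (Fin d → ℝ) → ℝ≥0∞) (W : ℝ≥0∞)
    (hw : Wt d m c c0 σ σ0 W) : W ≠ 0 := by
  intro h
  have h1 := hw.hW (fun _ => false) 0 0
  rw [h, nonpos_iff_eq_zero, mul_eq_zero, Finset.prod_eq_zero_iff] at h1
  rcases h1 with ⟨j, _, h1⟩ | h1
  · rw [ENNReal.rpow_eq_zero_iff_of_pos (hcp j)] at h1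
    exact (grid d _).av_pos volume (grid_fin d _) (grid_pos d _) (σ j) (hw.hσ j) (hw.h0 j) _ _ h1
  · rw [ENNReal.rpow_eq_zero_iff_of_pos hc0p] at h1
    exact (grid d _).av_pos volume (grid_fin d _) (grid_pos d _) σ0 hw.hσ0 hw.h00 _ _ h1

lemma pM_zero {d m : ℕ} (α : Fin d → Bool) (r : Fin m → ℝ) (hr : ∀ j, 0 < r j) (R : ℝ)
    (H : Fin m → (Fin d → ℝ) → ℝ≥0∞) (G : (Fin d → ℝ) → ℝ≥0∞) (j : Fin m)
    (h : ∀ᵐ x, H j x = 0) (n : ℤ) (x : Fin d → ℝ) : pM α r R H G n x = 0 := by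
  unfold pM
  rw [Finset.prod_eq_zero (Finset.mem_univ j), zero_mul]
  have : (grid d α).av volume n (fun y => H j y ^ r j) x = 0 := by
    unfold Fil.av
    have e : ∫⁻ y in (grid d α).cell n x, H j y ^ r j = 0 := by
      have : (fun y => H j y ^ r j) =ᵐ[volume.restrict ((grid d α).cell n x)] fun _ => 0 := by
        filter_upwards [ae_restrict_of_ae h] with y hy
        rw [hy, ENNReal.zero_rpow_of_pos (hr j)]
      rw [lintegral_congr_ae this, lintegral_zero]
    rw [e, ENNReal.zero_div]
  rw [this, ENNReal.zero_rpow_of_pos (one_div_pos.2 (hr j))]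

theorem statement16 (d m : ℕ) (hd : 1 ≤ d) (hm : 1 ≤ m)
    (r : Fin m → ℝ≥0∞) (hr : ∀ j, 0 < r j ∧ r j ≠ ∞)
    (q s : ℝ≥0∞) (hq : 0 < q) (hq' : q ≠ ∞) (hqs : q < s)
    (t : Fin m → ℝ≥0∞) (hrt : ∀ j, r j < t j)
    (hqt : q ≤ (∑ j, (t j)⁻¹)⁻¹) (hts : (∑ j, (t j)⁻¹)⁻¹ < s)
    (htfin : (∑ j, (t j)⁻¹)⁻¹ ≠ ∞)
    (p : Fin m → ℝ≥0∞) (hrp : ∀ j, r j < p j) (hps : (∑ j, (p j)⁻¹)⁻¹ < s) :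
    ∃ C : ℝ≥0∞, 0 < C ∧ C ≠ ∞ ∧
      ∀ (Ω : Type) [MeasurableSpace Ω] (μ : Measure Ω) [SigmaFinite μ],
      ∀ (T : (Fin m → ((Fin d → ℝ) → ℂ)) → ((Fin d → ℝ) → ℂ)) (C_T : ℝ≥0∞),
        -- T maps tuples of functions in L^∞_c to measurable functions
        (∀ f, (∀ j, MemLinftyC (f j)) → Measurable (T f)) →
        -- T is m-linear
        (∀ (f : Fin m → ((Fin d → ℝ) → ℂ)) (j : Fin m) (g : (Fin d → ℝ) → ℂ),
          (∀ k, MemLinftyC (f k)) → MemLinftyC g →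
          T (Function.update f j (f j + g)) = T f + T (Function.update f j g)) →
        (∀ (f : Fin m → ((Fin d → ℝ) → ℂ)) (j : Fin m) (c : ℂ),
          (∀ k, MemLinftyC (f k)) →
          T (Function.update f j (c • f j)) = c • T f) →
        -- scalar-valued domination
        (∀ f g, (∀ j, MemLinftyC (f j)) → MemLinftyC g →
          eNorm q volume (fun x => nn (T f) x * nn g x) ≤
            C_T * eNorm q volume
              (maximalX r (q⁻¹ - s⁻¹)⁻¹ (fun j => nn (f j)) (nn g))) →
        ∀ (w : Fin m → (Fin d → ℝ) → ℝ),
          (∀ j, Measurable (w j)) → (∀ j x, 0 < w j x) →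
          aConst p r s w ≠ ∞ →
        ∀ (f : Fin m → (Fin d → ℝ) → Ω → ℂ), (∀ j, VecSimple (f j)) →
          wNorm (∑ j, (p j)⁻¹)⁻¹ (fun x => ∏ j, w j x)
              (fun x => eNorm (∑ j, (t j)⁻¹)⁻¹ μ
                (fun ω => (‖T (fun j y => f j y ω) x‖₊ : ℝ≥0∞))) ≤
            C * C_T * aConst p r s w ^
                ((max (⨆ j, (r j)⁻¹ / ((r j)⁻¹ - (p j)⁻¹))
                  ((q⁻¹ - s⁻¹) / ((∑ j, (p j)⁻¹) - s⁻¹))).toReal) *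
              ∏ j, wNorm (p j) (w j) (fun x => eNorm (t j) μ (nn (f j x))) := by
  have hr' : ∀ j, 0 < (r j).toReal := fun j => ENNReal.toReal_pos (hr j).1.ne' (hr j).2
  have hp' : ∀ j, 0 < p j := fun j => (hr j).1.trans (hrp j)
  have hpi : ∀ j, (p j)⁻¹ ≠ ∞ := fun j => by simpa using (hp' j).ne'
  have hri : ∀ j, (r j)⁻¹ ≠ ∞ := fun j => by simpa using (hr j).1.ne'
  have hs0 : 0 < s := hq.trans hqs
  have hsi : s⁻¹ ≠ ∞ := by simpa using hs0.ne'
  have hqi : q⁻¹ ≠ ∞ := by simpa using hq.ne'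
  have hQ : 0 < q.toReal := ENNReal.toReal_pos hq.ne' hq'
  have hqsi : s⁻¹ < q⁻¹ := ENNReal.inv_lt_inv.2 hqs
  obtain ⟨S, hSd⟩ : ∃ S, S = (s⁻¹).toReal := ⟨_, rfl⟩
  have hS : 0 ≤ S := hSd ▸ ENNReal.toReal_nonneg
  have hδ0 : q⁻¹ - s⁻¹ ≠ 0 := (tsub_pos_of_lt hqsi).ne'
  have hδt : q⁻¹ - s⁻¹ ≠ ∞ := ENNReal.sub_ne_top hqi
  have hδ : (q⁻¹ - s⁻¹).toReal = 1 / q.toReal - S := by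
    rw [ENNReal.toReal_sub_of_le hqsi.le hqi, ENNReal.toReal_inv, one_div, hSd]
  obtain ⟨ρ, hρd⟩ : ∃ ρ, ρ = (q⁻¹ - s⁻¹)⁻¹ := ⟨_, rfl⟩
  have hρ0 : 0 < ρ := by rw [hρd]; exact ENNReal.inv_pos.2 hδt
  have hρt : ρ ≠ ∞ := by rw [hρd]; simpa using hδ0
  have hR : 0 < ρ.toReal := ENNReal.toReal_pos hρ0.ne' hρt
  have hRq : 1 / ρ.toReal = 1 / q.toReal - S := by
    rw [one_div, ← ENNReal.toReal_inv, hρd, inv_inv, hδ]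
  -- t
  obtain ⟨τ, hτd⟩ : ∃ τ, τ = (∑ j, (t j)⁻¹)⁻¹ := ⟨_, rfl⟩
  rw [← hτd] at hqt hts htfin
  have hτ0 : 0 < τ := hq.trans_le hqt
  have hqt' : q.toReal ≤ τ.toReal := ENNReal.toReal_mono htfin hqt
  have htr0 : 0 < τ.toReal := hQ.trans_le hqt'
  have hτo : ENNReal.ofReal τ.toReal = τ := ENNReal.ofReal_toReal htfin
  have hti : ∑ j, (t j)⁻¹ = ENNReal.ofReal (1 / τ.toReal) := by
    rw [one_div, ENNReal.ofReal_inv_of_pos htr0, hτo, hτd, inv_inv]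
  have hτS : 1 / q.toReal - 1 / τ.toReal < 1 / ρ.toReal := by
    rw [hRq, hSd, one_div τ.toReal, ← ENNReal.toReal_inv]
    have : (s⁻¹).toReal < (τ⁻¹).toReal :=
      (ENNReal.toReal_lt_toReal hsi (by simpa using hτ0.ne')).2 (ENNReal.inv_lt_inv.2 hts)
    linarith
  -- p
  have hps' : s⁻¹ < ∑ j, (p j)⁻¹ := by
    have := ENNReal.inv_lt_inv.2 hps
    rwa [inv_inv] at this
  have hPt : ∑ j, (p j)⁻¹ ≠ ∞ := ENNReal.sum_ne_top.2 fun j _ => hpi j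
  obtain ⟨P, hPd⟩ : ∃ P, P = (∑ j, (p j)⁻¹).toReal := ⟨_, rfl⟩
  have hP : P = ∑ j, ((p j)⁻¹).toReal := by rw [hPd, ENNReal.toReal_sum fun j _ => hpi j]
  obtain ⟨c0, hc0⟩ : ∃ c0, c0 = P - S := ⟨_, rfl⟩
  have hc0e : ((∑ j, (p j)⁻¹) - s⁻¹).toReal = c0 := by
    rw [ENNReal.toReal_sub_of_le hps'.le hPt, hc0, hPd, hSd]
  have hε0 : (∑ j, (p j)⁻¹) - s⁻¹ ≠ 0 := (tsub_pos_of_lt hps').ne'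
  have hc0p : 0 < c0 := by
    rw [← hc0e]; exact ENNReal.toReal_pos hε0 (ENNReal.sub_ne_top hPt)
  have hP0 : 0 < P := by linarith
  have hpe : (∑ j, (p j)⁻¹)⁻¹ = ENNReal.ofReal (1 / P) := by
    rw [one_div, ENNReal.ofReal_inv_of_pos hP0, hPd, ENNReal.ofReal_toReal hPt]
  obtain ⟨c, hc⟩ : ∃ c : Fin m → ℝ, ∀ j, c j = 1 / (r j).toReal - ((p j)⁻¹).toReal :=
    ⟨_, fun j => rfl⟩
  have hcp : ∀ j, 0 < c j := cc_pos r p hr hrp c hc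
  have hce : ∀ j, ((r j)⁻¹ - (p j)⁻¹).toReal = c j := fun j => by
    rw [ENNReal.toReal_sub_of_le (ENNReal.inv_lt_inv.2 (hrp j)).le (hri j), hc, ENNReal.toReal_inv,
      one_div]
  -- γ
  obtain ⟨M, hMd⟩ : ∃ M, M = max (⨆ j, (r j)⁻¹ / ((r j)⁻¹ - (p j)⁻¹))
                  ((q⁻¹ - s⁻¹) / ((∑ j, (p j)⁻¹) - s⁻¹)) := ⟨_, rfl⟩
  have hMt : M ≠ ∞ := by
    have h1 : (⨆ j, (r j)⁻¹ / ((r j)⁻¹ - (p j)⁻¹)) ≤ ∑ j, (r j)⁻¹ / ((r j)⁻¹ - (p j)⁻¹) :=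
      iSup_le fun j => Finset.single_le_sum (f := fun j => (r j)⁻¹ / ((r j)⁻¹ - (p j)⁻¹))
        (fun _ _ => bot_le) (Finset.mem_univ j)
    have h2 : ∑ j, (r j)⁻¹ / ((r j)⁻¹ - (p j)⁻¹) ≠ ∞ := ENNReal.sum_ne_top.2 fun j _ =>
      ENNReal.div_ne_top (hri j) (tsub_pos_of_lt (ENNReal.inv_lt_inv.2 (hrp j))).ne'
    have h3 := ENNReal.div_ne_top hδt hε0
    rw [hMd]
    exact (max_lt (h1.trans_lt h2.lt_top) h3.lt_top).ne
  obtain ⟨γ, hγd⟩ : ∃ γ, γ = M.toReal := ⟨_, rfl⟩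
  have hγ : ∀ j, 1 / (r j).toReal ≤ γ * c j := by
    intro j
    have h1 : (r j)⁻¹ / ((r j)⁻¹ - (p j)⁻¹) ≤ M := by
      rw [hMd]
      exact (le_iSup (fun j => (r j)⁻¹ / ((r j)⁻¹ - (p j)⁻¹)) j).trans (le_max_left _ _)
    have h2 := ENNReal.toReal_mono hMt h1
    rw [ENNReal.toReal_div, hce, ENNReal.toReal_inv, div_le_iff₀ (hcp j), ← hγd] at h2
    rwa [one_div]
  have hγ0 : 1 / ρ.toReal ≤ γ * c0 := by
    have h1 : (q⁻¹ - s⁻¹) / ((∑ j, (p j)⁻¹) - s⁻¹) ≤ M := by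
      rw [hMd]; exact le_max_right _ _
    have h2 := ENNReal.toReal_mono hMt h1
    rw [ENNReal.toReal_div, hc0e, hδ, div_le_iff₀ hc0p, ← hγd] at h2
    rwa [hRq]
  have hγ1 : 1 < γ := by
    obtain ⟨j, hj⟩ : ∃ j, (p j)⁻¹ ≠ 0 := by
      by_contra! h
      rw [Finset.sum_eq_zero fun j _ => h j] at hps'
      exact not_lt_bot hps'
    have h1 := ENNReal.toReal_pos hj (hpi j)
    have h2 := hγ j
    have h3 := hc j
    by_contra! h4
    nlinarith [hcp j]
  -- core
  have hcore : ∃ Cc : ℝ≥0∞, Cc ≠ ∞ ∧ ∀ (σ : Fin m → (Fin d → ℝ) → ℝ≥0∞) (σ0 : (Fin d → ℝ) → ℝ≥0∞)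
      (W : ℝ≥0∞),
      Wt d m c c0 σ σ0 W → ∀ (H : Fin m → (Fin d → ℝ) → ℝ≥0∞) (F : (Fin d → ℝ) → ℝ≥0∞) (D : ℝ≥0∞),
      (∀ j, Measurable (H j)) → Measurable F → D ≠ ∞ →
      (∀ j, eNorm (p j) volume (fun x => H j x * σ j x ^ (-c j)) ≠ ∞) →
      (∀ (G : (Fin d → ℝ) → ℝ≥0∞) (Bd : ℝ≥0∞), Measurable G →
        (∀ α : Fin d → Bool, ∫⁻ x, (⨆ n, pM α (fun j => (r j).toReal) ρ.toReal H G n x) ^ q.toReal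
          ≤ Bd) → ∫⁻ x, (F x * G x) ^ q.toReal ≤ D * Bd) →
      eNorm (ENNReal.ofReal (1 / P)) volume (fun x => F x * σ0 x ^ c0) ≤
        Cc * D ^ (1 / q.toReal) * W ^ γ *
          ∏ j, eNorm (p j) volume (fun x => H j x * σ j x ^ (-c j)) := by
    rcases le_or_gt P (1 / q.toReal) with h | h
    · exact core1 r p hr hrp q.toReal S ρ.toReal hQ hS hR hRq c hc P c0 hP hc0 hc0p γ hγ1 hγ hγ0 h
    · exact core2 r p hr hrp q.toReal S ρ.toReal hQ hS hR hRq c hc P c0 hP hc0 hc0p γ hγ1 hγ h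
  obtain ⟨Cc, hCc, hcore⟩ := hcore
  obtain ⟨K, hKd⟩ : ∃ K, K = K0 d r ρ q.toReal τ.toReal t := ⟨_, rfl⟩
  have hKt : K ≠ ∞ := by
    rw [hKd]
    exact K0_ne_top r hr ρ hρ0 hρt q.toReal τ.toReal hQ hτS t hrt
  refine ⟨Cc * K ^ (1 / q.toReal) + 1, by positivity, ?_, ?_⟩
  · exact ENNReal.add_ne_top.2 ⟨ENNReal.mul_ne_top hCc
      (ENNReal.rpow_ne_top_of_nonneg (by positivity) hKt), ENNReal.one_ne_top⟩
  intro Ω _ μ _ T C_T hTm hTadd hTsmul hdom w hwm hw0 hA f hf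
  rw [← hMd, ← hγd, hpe, ← hτd]
  rw [← hρd] at hdom
  have hWt := mkWt r p s c c0 hcp hc0p hce hc0e w hwm hw0 hA
  have hA0 := aConst_pos c c0 hc0p hcp _ _ _ hWt
  obtain ⟨W, hWd⟩ : ∃ W, W = aConst p r s w := ⟨_, rfl⟩
  rw [← hWd] at hWt hA0 hA ⊢
  set σ : Fin m → (Fin d → ℝ) → ℝ≥0∞ := fun j x => ENNReal.ofReal (w j x) ^ (-(1 / c j)) with hσ
  set σ0 : (Fin d → ℝ) → ℝ≥0∞ := fun x => ENNReal.ofReal (∏ j, w j x) ^ (1 / c0) with hσ0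
  have hσe : ∀ j x, σ j x ^ (-c j) = ENNReal.ofReal (w j x) := by
    intro j x
    simp only [hσ]
    rw [← ENNReal.rpow_mul, neg_mul_neg, one_div_mul_cancel (hcp j).ne', ENNReal.rpow_one]
  have hσ0e : ∀ x, σ0 x ^ c0 = ENNReal.ofReal (∏ j, w j x) := by
    intro x
    simp only [hσ0]
    rw [← ENNReal.rpow_mul, one_div_mul_cancel hc0p.ne', ENNReal.rpow_one]
  obtain ⟨U, hUd⟩ : ∃ U : (Fin d → ℝ) → Ω → ℝ≥0∞,
    U = fun x ω => (‖T (fun j y => f j y ω) x‖₊ : ℝ≥0∞) := ⟨_, rfl⟩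
  have hU : Measurable (Function.uncurry U) := by
    rw [hUd]
    exact (T_meas T hTm hTadd hTsmul f hf).nnnorm.coe_nnreal_ennreal
  obtain ⟨Hf, hHfd⟩ : ∃ Hf : Fin m → (Fin d → ℝ) → Ω → ℝ≥0∞,
    Hf = fun j x => nn (f j x) := ⟨_, rfl⟩
  have hHf : ∀ j, Measurable (Function.uncurry (Hf j)) := by
    intro j
    rw [hHfd]
    exact (vecSimple_meas (hf j)).nnnorm.coe_nnreal_ennreal
  obtain ⟨H, hHd⟩ : ∃ H : Fin m → (Fin d → ℝ) → ℝ≥0∞,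
    H = fun j x => eNorm (t j) μ (Hf j x) := ⟨_, rfl⟩
  have hH : ∀ j, Measurable (H j) := by
    intro j; rw [hHd]; exact measurable_eNorm _ _ _ (hHf j)
  obtain ⟨F, hFd⟩ : ∃ F : (Fin d → ℝ) → ℝ≥0∞, F = fun x => eNorm τ μ (U x) := ⟨_, rfl⟩
  have hF : Measurable F := by rw [hFd]; exact measurable_eNorm _ _ _ hU
  have hyp : ∀ ω, ∀ G : (Fin d → ℝ) → ℝ≥0∞, Measurable G → ∫⁻ x, (U x ω * G x) ^ q.toReal ≤
      C_T ^ q.toReal * ∫⁻ x, maximalX r ρ (fun j y => Hf j y ω) G x ^ q.toReal := by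
    intro ω G hG
    have hsec : ∀ j, MemLinftyC (fun y => f j y ω) := fun j => vecSimple_sec (hf j) ω
    have hUω : Measurable (fun x => U x ω) := by
      rw [hUd]
      exact (hTm _ hsec).nnnorm.coe_nnreal_ennreal
    refine dom_ext r ρ q hq hq' C_T (fun x => U x ω) hUω (fun j y => Hf j y ω) ?_ G hG
    intro g hg
    have := hdom (fun j y => f j y ω) g hsec hg
    rw [hUd, hHfd]
    exact this
  have hIII : ∀ (G : (Fin d → ℝ) → ℝ≥0∞) (Bd : ℝ≥0∞), Measurable G →
        (∀ α : Fin d → Bool, ∫⁻ x, (⨆ n, pM α (fun j => (r j).toReal) ρ.toReal H G n x) ^ q.toReal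
          ≤ Bd) → ∫⁻ x, (F x * G x) ^ q.toReal ≤ K * C_T ^ q.toReal * Bd := by
    intro G Bd hG hBd
    rw [hHd] at hBd
    have := III r hr ρ hρ0 hρt q.toReal τ.toReal hQ hqt' hτS t hrt hti μ U hU Hf hHf C_T hyp G hG Bd
      hBd
    rw [hτo, ← hKd] at this
    rw [hFd]
    exact this
  have hL : wNorm (ENNReal.ofReal (1 / P)) (fun x => ∏ j, w j x)
              (fun x => eNorm τ μ
                (fun ω => (‖T (fun j y => f j y ω) x‖₊ : ℝ≥0∞))) =
      eNorm (ENNReal.ofReal (1 / P)) volume (fun x => F x * σ0 x ^ c0) := by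
    unfold wNorm
    simp_rw [hσ0e]
    rw [hFd, hUd]
  have hN : ∀ j, wNorm (p j) (w j) (fun x => eNorm (t j) μ (nn (f j x))) =
      eNorm (p j) volume (fun x => H j x * σ j x ^ (-c j)) := by
    intro j
    unfold wNorm
    simp_rw [hσe]
    rw [hHd, hHfd]
  rw [hL]
  simp_rw [hN]
  have hvan : ∫⁻ x, F x ^ q.toReal = 0 →
      eNorm (ENNReal.ofReal (1 / P)) volume (fun x => F x * σ0 x ^ c0) ≤ 0 := by
    intro h0
    have hm2 : Measurable (fun x => F x ^ q.toReal) := hF.pow_const _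
    rw [lintegral_eq_zero_iff hm2] at h0
    rw [eNorm_ofReal (by positivity)]
    have : (fun x => (F x * σ0 x ^ c0) ^ (1 / P)) =ᵐ[volume] fun _ => 0 := by
      filter_upwards [h0] with x hx
      have : F x = 0 := (ENNReal.rpow_eq_zero_iff_of_pos hQ).1 hx
      rw [this, zero_mul, ENNReal.zero_rpow_of_pos (by positivity)]
    rw [lintegral_congr_ae this, lintegral_zero, ENNReal.zero_rpow_of_pos (by positivity)]
  by_cases hz : ∃ j, eNorm (p j) volume (fun x => H j x * σ j x ^ (-c j)) = 0
  · obtain ⟨j, hj⟩ := hz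
    have hm1 : Measurable (fun x => H j x * σ j x ^ (-c j)) :=
      (hH j).mul ((hWt.hσ j).pow_const _)
    have hH0 : ∀ᵐ x, H j x = 0 := by
      filter_upwards [eNorm_eq_zero (hp' j) hm1 hj] with x hx
      rw [hσe, mul_eq_zero] at hx
      rcases hx with h | h
      · exact h
      · exact absurd h (by simpa using hw0 j x)
    have h0 := hIII (fun _ => 1) 0 measurable_const (fun α => by
      simp_rw [pM_zero α (fun j => (r j).toReal) hr' ρ.toReal H _ j hH0]
      simp [ENNReal.zero_rpow_of_pos hQ])
    simp only [mul_one, mul_zero, nonpos_iff_eq_zero] at h0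
    exact (hvan h0).trans bot_le
  push Not at hz
  have hWγ : W ^ γ ≠ 0 := by
    rw [Ne, ENNReal.rpow_eq_zero_iff_of_pos (by linarith)]; exact hA0
  have hC0 : Cc * K ^ (1 / q.toReal) + 1 ≠ 0 := by simp
  by_cases hCT : C_T = ∞
  · rw [hCT, ENNReal.mul_top hC0, ENNReal.top_mul hWγ, ENNReal.top_mul]
    · exact le_top
    · exact Finset.prod_ne_zero_iff.2 fun j _ => hz j
  by_cases hNt : ∀ j, eNorm (p j) volume (fun x => H j x * σ j x ^ (-c j)) ≠ ∞
  · have h1 := hcore σ σ0 W hWt H F (K * C_T ^ q.toReal) hH hF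
      (ENNReal.mul_ne_top hKt (ENNReal.rpow_ne_top_of_nonneg hQ.le hCT)) hNt hIII
    refine h1.trans (mul_le_mul' (mul_le_mul' ?_ le_rfl) le_rfl)
    rw [ENNReal.mul_rpow_of_nonneg _ _ (by positivity), ← ENNReal.rpow_mul,
      mul_one_div_cancel hQ.ne', ENNReal.rpow_one, ← mul_assoc]
    exact mul_le_mul' le_self_add le_rfl
  · push Not at hNt
    obtain ⟨j, hj⟩ := hNt
    by_cases hCT0 : C_T = 0
    · have h0 := hIII (fun _ => 1) ∞ measurable_const (fun α => le_top)
      rw [hCT0, ENNReal.zero_rpow_of_pos hQ, mul_zero, zero_mul, nonpos_iff_eq_zero] at h0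
      simp only [mul_one] at h0
      exact (hvan h0).trans bot_le
    · have : ∏ j, eNorm (p j) volume (fun x => H j x * σ j x ^ (-c j)) = ∞ := by
        rw [← Finset.mul_prod_erase _ _ (Finset.mem_univ j), hj, ENNReal.top_mul]
        exact Finset.prod_ne_zero_iff.2 fun i _ => hz i
      rw [this, ENNReal.mul_top]
      · exact le_top
      · exact mul_ne_zero (mul_ne_zero hC0 hCT0) hWγ

end
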